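/- arXiv:1405.0767 — 2 statements merged into one kernel-verified Lean document; each statement's English description precedes it below -/
import Mathlib

section
/- Let π be a permutation of {1,2,3,4} belonging to the Rauzy class of (4321). Then the set { L = (l_1,l_2,l_3,l_4) ∈ ℝ⁴ : l_i ≥ 0 for all i, l_1+l_2+l_3+l_4 = 1, and the interval exchange transformation T_{π,L} is uniquely ergodic } is a path-connected subset of ℝ⁴. -/
open MeasureTheory

/-- The interval exchange transformation determined by a permutation `π` of `Fin n`
and a length vector `L`. -/
noncomputable def ietMap {n : ℕ} (π : Equiv.Perm (Fin n)) (L : Fin n → ℝ) (x : ℝ) : ℝ :=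
  if h : ∃ j : Fin n,
      (∑ k ∈ Finset.univ.filter (fun k => k < j), L k) ≤ x ∧
      x < (∑ k ∈ Finset.univ.filter (fun k => k < j), L k) + L j then
    x - (∑ k ∈ Finset.univ.filter (fun k => k < h.choose), L k)
      + (∑ k ∈ Finset.univ.filter (fun k => π k < π h.choose), L k)
  else x

/-- `T` is uniquely ergodic (as a transformation of `[0,1)`). -/
def UniquelyErgodicOn01 (T : ℝ → ℝ) : Prop :=
  ∀ μ : Measure ℝ, IsProbabilityMeasure μ → μ (Set.Ico (0:ℝ) 1)ᶜ = 0 →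
    (∀ A : Set ℝ, MeasurableSet A → μ (T ⁻¹' A) = μ A) →
    μ = volume.restrict (Set.Ico (0:ℝ) 1)

/-- The Rauzy class of the permutation `(4321)`, written 0-based: the seven
permutations `σ` of `Fin 4` such that `(σ⁻¹ 0, σ⁻¹ 1, σ⁻¹ 2, σ⁻¹ 3)` is one of
the listed tuples. -/
def RauzyClass4321 : Set (Equiv.Perm (Fin 4)) :=
  {σ | (σ⁻¹ 0, σ⁻¹ 1, σ⁻¹ 2, σ⁻¹ 3) ∈
    ({((3 : Fin 4), (2 : Fin 4), (1 : Fin 4), (0 : Fin 4)),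
      (3, 1, 0, 2), (3, 0, 2, 1), (1, 3, 2, 0), (2, 1, 3, 0), (1, 3, 0, 2), (2, 0, 3, 1)} :
      Set (Fin 4 × Fin 4 × Fin 4 × Fin 4))}

namespace IETPath

/-- Left endpoint of the interval of letter `j`, when letters are ordered by rank `r`. -/
def rp (r : Fin 4 → Fin 4) (L : Fin 4 → ℝ) (j : Fin 4) : ℝ :=
  ∑ k, if r k < r j then L k else 0

/-- Distribution functions of invariant measures. -/
def Eqn (t b : Fin 4 → Fin 4) (L : Fin 4 → ℝ) (F : ℝ → ℝ) : Prop :=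
  ∀ j y, 0 ≤ y → y ≤ L j →
    F (rp t L j + y) - F (rp t L j) = F (rp b L j + y) - F (rp b L j)

def PU (t b : Fin 4 → Fin 4) (L : Fin 4 → ℝ) : Prop :=
  ∀ F : ℝ → ℝ, Monotone F → F 0 = 0 → Eqn t b L F →
    ∃ c, ∀ x, 0 ≤ x → x ≤ ∑ i, L i → F x = c * x

def QU (t b : Fin 4 → Fin 4) (L : Fin 4 → ℝ) : Prop :=
  ∀ F : ℝ → ℝ, Monotone F → Continuous F → F 0 = 0 → Eqn t b L F →
    ∃ c, ∀ x, 0 ≤ x → x ≤ ∑ i, L i → F x = c * x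

theorem Eqn.symm {t b L F} (h : Eqn t b L F) : Eqn b t L F :=
  fun j y h0 h1 => (h j y h0 h1).symm

theorem PU.symm {t b L} (h : PU t b L) : PU b t L :=
  fun F h1 h2 h3 => h F h1 h2 h3.symm

theorem QU.symm {t b L} (h : QU t b L) : QU b t L :=
  fun F h1 h2 h3 h4 => h F h1 h2 h3 h4.symm

/-- Rauzy matrix: winner `a`, loser `l`. -/
def mv (a l : Fin 4) (w : Fin 4 → ℝ) : Fin 4 → ℝ := fun i => w i + if i = a then w l else 0

structure TopStep (t b b' : Fin 4 → Fin 4) (a l : Fin 4) : Prop where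
  ne : a ≠ l
  tl : ∀ k, t k ≤ t a
  bl : ∀ k, b k ≤ b l
  ti : ∀ k j, t k = t j → k = j
  bi : ∀ k j, b k = b j → k = j
  bi' : ∀ k j, b' k = b' j → k = j
  h1 : ∀ k j, k ≠ l → j ≠ l → (b' k < b' j ↔ b k < b j)
  h2 : ∀ j, j ≠ l → (b' l < b' j ↔ b a < b j)
  h3 : ∀ k, k ≠ l → (b' k < b' l ↔ b k ≤ b a)

theorem sum_mv (a l : Fin 4) (w : Fin 4 → ℝ) : ∑ i, mv a l w i = ∑ i, w i + w l := by
  simp [mv, Finset.sum_add_distrib]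

theorem mv_nonneg {a l : Fin 4} {w : Fin 4 → ℝ} (h : ∀ i, 0 ≤ w i) : ∀ i, 0 ≤ mv a l w i := by
  intro i; unfold mv; split_ifs
  · exact add_nonneg (h _) (h _)
  · simpa using h i

theorem rp_mv (r : Fin 4 → Fin 4) (a l : Fin 4) (w : Fin 4 → ℝ) (j) :
    rp r (mv a l w) j = rp r w j + if r a < r j then w l else 0 := by
  unfold rp mv
  have : ∀ k, (if r k < r j then w k + (if k = a then w l else 0) else 0)
      = (if r k < r j then w k else 0) + (if k = a then (if r a < r j then w l else 0) else 0) := by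
    intro k; by_cases hk : k = a
    · subst hk; split_ifs <;> simp
    · simp [hk]
  rw [Finset.sum_congr rfl (fun k _ => this k), Finset.sum_add_distrib]
  simp

theorem mv_win (a l : Fin 4) (w) : mv a l w a = w a + w l := by simp [mv]
theorem mv_ne {a i : Fin 4} (l : Fin 4) (w) (h : i ≠ a) : mv a l w i = w i := by simp [mv, h]

theorem rp_nonneg (r : Fin 4 → Fin 4) {w : Fin 4 → ℝ} (h : ∀ i, 0 ≤ w i) (j) : 0 ≤ rp r w j :=
  Finset.sum_nonneg (fun k _ => by split_ifs; exacts [h k, le_rfl])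

theorem rp_add_le (r : Fin 4 → Fin 4) {w : Fin 4 → ℝ} (h : ∀ i, 0 ≤ w i) (j) :
    rp r w j + w j ≤ ∑ i, w i := by
  unfold rp
  rw [← Finset.add_sum_erase _ _ (Finset.mem_univ j),
    ← Finset.add_sum_erase (Finset.univ) w (Finset.mem_univ j), if_neg (lt_irrefl _), zero_add,
    add_comm]
  gcongr with k hk
  split_ifs
  · exact le_rfl
  · exact h k

theorem rp_lt_le (r : Fin 4 → Fin 4) {w : Fin 4 → ℝ} (h : ∀ i, 0 ≤ w i) {i j} (hij : r i < r j) :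
    rp r w i + w i ≤ rp r w j := by
  unfold rp
  rw [← Finset.add_sum_erase _ _ (Finset.mem_univ i),
    ← Finset.add_sum_erase (Finset.univ) (fun k => if r k < r j then w k else 0)
      (Finset.mem_univ i), if_neg (lt_irrefl _), zero_add, if_pos hij,
    add_comm]
  gcongr with k hk
  split_ifs with h1 h2 h2
  · exact le_rfl
  · exact absurd (h1.trans hij) h2
  · exact h k
  · exact le_rfl

section
variable {t b b' : Fin 4 → Fin 4} {a l : Fin 4}

theorem TopStep.r1 (S : TopStep t b b' a l) (w : Fin 4 → ℝ) (j) : rp t (mv a l w) j = rp t w j := by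
  rw [rp_mv, if_neg (not_lt.2 (S.tl j)), add_zero]

theorem TopStep.r2 (S : TopStep t b b' a l) (w : Fin 4 → ℝ) (j) (hj : j ≠ l) : rp b (mv a l w) j = rp b' w j := by
  rw [rp_mv]; unfold rp
  rw [← Finset.add_sum_erase _ _ (Finset.mem_univ l),
    ← Finset.add_sum_erase (Finset.univ) (fun k => if b' k < b' j then w k else 0)
      (Finset.mem_univ l)]
  rw [if_neg (not_lt.2 (S.bl j)), zero_add, add_comm]
  congr 1
  · simp only [S.h2 j hj]
  · apply Finset.sum_congr rfl
    intro k hk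
    simp only [S.h1 k j (Finset.ne_of_mem_erase hk) hj]

theorem TopStep.r3 (S : TopStep t b b' a l) (w : Fin 4 → ℝ) : rp b (mv a l w) l = ∑ i, w i := by
  rw [rp_mv]; unfold rp
  have hlt : ∀ k, k ≠ l → b k < b l := fun k hk =>
    lt_of_le_of_ne (S.bl k) (fun h => hk (S.bi _ _ h))
  rw [if_pos (hlt a S.ne), ← Finset.add_sum_erase _ _ (Finset.mem_univ l),
    ← Finset.add_sum_erase (Finset.univ) w (Finset.mem_univ l), if_neg (lt_irrefl _), zero_add,
    add_comm]
  congr 1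
  apply Finset.sum_congr rfl
  intro k hk
  rw [if_pos (hlt k (Finset.ne_of_mem_erase hk))]

theorem TopStep.r4 (S : TopStep t b b' a l) (w : Fin 4 → ℝ) : rp b' w l = rp b (mv a l w) a + w a := by
  rw [rp_mv, if_neg (lt_irrefl _), add_zero]; unfold rp
  rw [← Finset.add_sum_erase _ _ (Finset.mem_univ a),
    ← Finset.add_sum_erase (Finset.univ) (fun k => if b k < b a then w k else 0)
      (Finset.mem_univ a)]
  rw [if_neg (lt_irrefl (b a)), zero_add, add_comm, if_pos ((S.h3 a S.ne).2 le_rfl)]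
  congr 1
  apply Finset.sum_congr rfl
  intro k hk
  by_cases hkl : k = l
  · subst hkl
    rw [if_neg (lt_irrefl _), if_neg (not_lt.2 (S.bl a))]
  · simp only [S.h3 k hkl]
    congr 1
    rw [eq_iff_iff]
    exact ⟨fun h => lt_of_le_of_ne h (fun h => (Finset.ne_of_mem_erase hk) (S.bi _ _ h)), le_of_lt⟩

theorem TopStep.r5 (S : TopStep t b b' a l) (w : Fin 4 → ℝ) : rp t w a + w a = ∑ i, w i := by
  unfold rp
  rw [← Finset.add_sum_erase _ _ (Finset.mem_univ a),
    ← Finset.add_sum_erase (Finset.univ) w (Finset.mem_univ a), if_neg (lt_irrefl _), zero_add,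
    add_comm]
  congr 1
  apply Finset.sum_congr rfl
  intro k hk
  rw [if_pos (lt_of_le_of_ne (S.tl k) (fun h => (Finset.ne_of_mem_erase hk) (S.ti _ _ h)))]

/-- restriction of an invariant function to the induced system -/
theorem TopStep.restrict (S : TopStep t b b' a l) {w : Fin 4 → ℝ} (hw : ∀ i, 0 ≤ w i) {F : ℝ → ℝ}
    (h : Eqn t b (mv a l w) F) : Eqn t b' w F := by
  intro j y h0 h1
  by_cases hj : j = l
  · subst hj
    have e1 := h j y h0 (by rw [mv_ne _ _ S.ne.symm]; exact h1)
    rw [S.r1, S.r3] at e1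
    have e2 := h a (w a + y) (by linarith [hw a]) (by rw [mv_win]; linarith)
    have e3 := h a (w a) (hw a) (by rw [mv_win]; linarith [hw j])
    rw [S.r1, ← add_assoc, ← add_assoc, S.r5, ← S.r4] at e2
    rw [S.r1, S.r5, ← S.r4] at e3
    linarith
  · have := h j y h0 (h1.trans (by unfold mv; split_ifs <;> linarith [hw l]))
    rwa [S.r1, S.r2 w j hj] at this

/-- on the removed interval `F` is a copy -/
theorem TopStep.copy (S : TopStep t b b' a l) {w : Fin 4 → ℝ} {F : ℝ → ℝ}
    (h : Eqn t b (mv a l w) F) {y : ℝ} (h0 : 0 ≤ y) (h1 : y ≤ w l) :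
    F (∑ i, w i + y) - F (∑ i, w i) = F (rp t w l + y) - F (rp t w l) := by
  have e1 := h l y h0 (by rw [mv_ne _ _ S.ne.symm]; exact h1)
  rw [S.r1, S.r3] at e1
  exact e1.symm

theorem TopStep.PU_up (S : TopStep t b b' a l) {w : Fin 4 → ℝ} (hw : ∀ i, 0 ≤ w i) (h : PU t b' w) :
    PU t b (mv a l w) := by
  intro F hF F0 hE
  obtain ⟨c, hc⟩ := h F hF F0 (S.restrict hw hE)
  refine ⟨c, fun x x0 x1 => ?_⟩
  rw [sum_mv] at x1
  rcases le_total x (∑ i, w i) with h | h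
  · exact hc x x0 h
  · have := S.copy hE (y := x - ∑ i, w i) (by linarith) (by linarith)
    have h5 := rp_add_le t hw l
    have h6 := rp_nonneg t hw l
    rw [add_sub_cancel] at this
    have e1 := hc (rp t w l) h6 (by linarith [hw l])
    have e2 := hc (rp t w l + (x - ∑ i, w i)) (by linarith) (by linarith)
    have e3 := hc (∑ i, w i) (Finset.sum_nonneg fun i _ => hw i) le_rfl
    rw [e1, e2, e3] at this
    linarith
end

end IETPath

namespace IETPath

/-- top and bottom rank vectors of the seven Rauzy states -/
def tR : Fin 7 → Fin 4 → Fin 4 :=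
  ![![0,1,2,3], ![0,1,2,3], ![0,1,2,3], ![0,1,3,2], ![0,2,3,1], ![0,3,1,2], ![0,2,3,1]]
def bR : Fin 7 → Fin 4 → Fin 4 :=
  ![![3,2,1,0], ![1,3,2,0], ![2,1,3,0], ![1,3,2,0], ![3,2,1,0], ![3,2,1,0], ![2,3,1,0]]

/-- Rauzy moves: `true` = top wins -/
def nxt (y : Bool) (s : Fin 7) : Fin 7 :=
  if y then (![1,2,0,3,6,5,4] : Fin 7 → Fin 7) s else (![4,3,2,1,5,0,6] : Fin 7 → Fin 7) s
def lT : Fin 7 → Fin 4 := ![3,3,3,2,2,1,2]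
def lB : Fin 7 → Fin 4 := ![0,1,2,1,0,0,1]
def win (y : Bool) (s : Fin 7) : Fin 4 := if y then lT s else lB s
def los (y : Bool) (s : Fin 7) : Fin 4 := if y then lB s else lT s

theorem step_top (s : Fin 7) :
    TopStep (tR s) (bR s) (bR (nxt true s)) (win true s) (los true s) := by
  constructor <;> revert s <;> decide

theorem step_bot (s : Fin 7) :
    TopStep (bR s) (tR s) (tR (nxt false s)) (win false s) (los false s) := by
  constructor <;> revert s <;> decide

theorem tR_nxt (s) : tR (nxt true s) = tR s := by revert s; decide
theorem bR_nxt (s) : bR (nxt false s) = bR s := by revert s; decide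

theorem win_ne_los (y s) : win y s ≠ los y s := by revert y s; decide

theorem tR_inj (s) : Function.Injective (tR s) := by
  intro i j; revert s i j; decide
theorem bR_inj (s) : Function.Injective (bR s) := by
  intro i j; revert s i j; decide

/-- The Rauzy matrix of a move. -/
def M (y : Bool) (s : Fin 7) (w : Fin 4 → ℝ) : Fin 4 → ℝ := mv (win y s) (los y s) w

def W (s : Fin 7) : Set (Fin 4 → ℝ) :=
  {L | (∀ i, 0 ≤ L i) ∧ 0 < ∑ i, L i ∧ PU (tR s) (bR s) L}

theorem PU_M (y s) {w : Fin 4 → ℝ} (hw : ∀ i, 0 ≤ w i) (h : PU (tR (nxt y s)) (bR (nxt y s)) w) :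
    PU (tR s) (bR s) (M y s w) := by
  cases y
  · rw [bR_nxt] at h
    exact ((step_bot s).PU_up hw h.symm).symm
  · rw [tR_nxt] at h
    exact (step_top s).PU_up hw h

theorem sum_M (y s) (w : Fin 4 → ℝ) : ∑ i, M y s w i = ∑ i, w i + w (los y s) := sum_mv _ _ _

theorem M_nonneg (y s) {w : Fin 4 → ℝ} (h : ∀ i, 0 ≤ w i) : ∀ i, 0 ≤ M y s w i := mv_nonneg h

theorem M_mem_W (y s) {w : Fin 4 → ℝ} (h : w ∈ W (nxt y s)) : M y s w ∈ W s :=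
  ⟨M_nonneg y s h.1, by rw [sum_M]; linarith [h.1 (los y s), h.2.1], PU_M y s h.1 h.2.2⟩

theorem continuous_M (y s) : Continuous (M y s) := by
  unfold M mv
  refine continuous_pi fun i => ?_
  split_ifs <;> fun_prop

theorem M_add (y s v w) : M y s (v + w) = M y s v + M y s w := by
  funext i; simp only [M, mv, Pi.add_apply]; split_ifs <;> ring

theorem M_smul (y s) (c : ℝ) (w) : M y s (c • w) = c • M y s w := by
  funext i; simp only [M, mv, Pi.smul_apply, smul_eq_mul]; split_ifs <;> ring

theorem joined_M (y s) {v w : Fin 4 → ℝ} (h : JoinedIn (W (nxt y s)) v w) :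
    JoinedIn (W s) (M y s v) (M y s w) := by
  obtain ⟨γ, hγ⟩ := h
  refine ⟨γ.map (continuous_M y s), fun x => ?_⟩
  exact M_mem_W y s (hγ x)

/-- one step of Rauzy induction (with weak inequalities) -/
theorem exists_step (s) {L : Fin 4 → ℝ} (h : ∀ i, 0 ≤ L i) :
    ∃ y L', (∀ i, 0 ≤ L' i) ∧ L = M y s L' := by
  have key : ∀ y, L (los y s) ≤ L (win y s) → ∃ y L', (∀ i, 0 ≤ L' i) ∧ L = M y s L' := by
    intro y hy
    refine ⟨y, fun i => L i - if i = win y s then L (los y s) else 0, fun i => ?_, ?_⟩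
    · beta_reduce
      split_ifs with hi
      · rw [hi]; linarith
      · simpa using h i
    · funext i
      simp only [M, mv, if_neg (win_ne_los y s).symm]
      split_ifs <;> ring
  rcases le_total (L (lB s)) (L (lT s)) with h1 | h1
  · exact key true h1
  · exact key false h1

end IETPath

namespace IETPath

/-- extension of a distribution function by a copy of a piece -/
def ext (ℓ m src : ℝ) (F : ℝ → ℝ) (x : ℝ) : ℝ :=
  F (min x ℓ) + (F (src + max 0 (min (x - ℓ) m)) - F src)

theorem ext_le {ℓ m src : ℝ} (F : ℝ → ℝ) {x : ℝ} (hx : x ≤ ℓ) : ext ℓ m src F x = F x := by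
  unfold ext
  rw [min_eq_left hx, max_eq_left ((min_le_left _ _).trans (by linarith))]
  simp

theorem ext_add {ℓ m src : ℝ} (F : ℝ → ℝ) {z : ℝ} (h0 : 0 ≤ z) (h1 : z ≤ m) :
    ext ℓ m src F (ℓ + z) = F ℓ + (F (src + z) - F src) := by
  unfold ext
  rw [min_eq_right (by linarith), add_sub_cancel_left, min_eq_left h1, max_eq_right h0]

theorem ext_ge {ℓ m src : ℝ} (F : ℝ → ℝ) {x : ℝ} (h0 : 0 ≤ m) (h1 : ℓ + m ≤ x) :
    ext ℓ m src F x = F ℓ + (F (src + m) - F src) := by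
  unfold ext
  rw [min_eq_right (by linarith), min_eq_right (by linarith), max_eq_right h0]

theorem ext_mono {ℓ m src : ℝ} {F : ℝ → ℝ} (h : Monotone F) : Monotone (ext ℓ m src F) := by
  intro x y hxy
  unfold ext
  have h1 := h (min_le_min_right ℓ hxy)
  have h2 : F (src + max 0 (min (x - ℓ) m)) ≤ F (src + max 0 (min (y - ℓ) m)) := by
    apply h; gcongr
  linarith

theorem ext_cont {ℓ m src : ℝ} {F : ℝ → ℝ} (h : Continuous F) : Continuous (ext ℓ m src F) := by
  unfold ext; fun_prop

def Dfct (t b : Fin 4 → Fin 4) (L : Fin 4 → ℝ) (F : ℝ → ℝ) (δ : ℝ) : Prop :=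
  ∃ c : Fin 4 → ℝ, (∀ j, 0 ≤ c j) ∧ ∑ j, c j ≤ δ ∧ ∀ j y, 0 ≤ y → y ≤ L j →
    |(F (rp t L j + y) - F (rp t L j)) - (F (rp b L j + y) - F (rp b L j))| ≤ c j

theorem Dfct.symm {t b L F δ} (h : Dfct t b L F δ) : Dfct b t L F δ := by
  obtain ⟨c, h0, h1, h2⟩ := h
  exact ⟨c, h0, h1, fun j y a b => by rw [abs_sub_comm]; exact h2 j y a b⟩

theorem Eqn.dfct {t b L F} (h : Eqn t b L F) : Dfct t b L F 0 :=
  ⟨0, fun _ => le_rfl, by simp, fun j y a b => by rw [h j y a b]; simp⟩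

theorem Dfct.eqn {t b L F} (h : Dfct t b L F 0) : Eqn t b L F := by
  obtain ⟨c, h0, h1, h2⟩ := h
  intro j y a b
  have : c j ≤ 0 := (Finset.single_le_sum (fun i _ => h0 i) (Finset.mem_univ j)).trans h1
  exact sub_eq_zero.1 (abs_eq_zero.1 (le_antisymm ((h2 j y a b).trans this) (abs_nonneg _)))

section
variable {t b b' : Fin 4 → Fin 4} {a l : Fin 4}

theorem TopStep.a_end (S : TopStep t b b' a l) (w : Fin 4 → ℝ) : rp b' w a + w a = rp b' w l := by
  rw [S.r4, S.r2 w a S.ne]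

theorem TopStep.dfct_ext (S : TopStep t b b' a l) {L : Fin 4 → ℝ} (hL : ∀ i, 0 ≤ L i) {F : ℝ → ℝ} {δ : ℝ}
    (h : Dfct t b' L F δ) (src : ℝ) (hs : src = rp t L l ∨ src = rp b' L l) :
    Dfct t b (mv a l L) (ext (∑ i, L i) (L l) src F) δ := by
  obtain ⟨c, c0, c1, c2⟩ := h
  -- common computations
  have ht : ∀ j, rp t L j + L j ≤ ∑ i, L i := fun j => rp_add_le t hL j
  have hb : ∀ j, rp b' L j + L j ≤ ∑ i, L i := fun j => rp_add_le b' hL j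
  have hother : ∀ j y, j ≠ l → 0 ≤ y → y ≤ L j →
      |(ext (∑ i, L i) (L l) src F (rp t (mv a l L) j + y) - ext (∑ i, L i) (L l) src F (rp t (mv a l L) j))
        - (ext (∑ i, L i) (L l) src F (rp b (mv a l L) j + y) - ext (∑ i, L i) (L l) src F (rp b (mv a l L) j))| ≤ c j := by
    intro j y hj y0 y1
    rw [S.r1, S.r2 L j hj, ext_le, ext_le, ext_le, ext_le]
    · exact c2 j y y0 y1
    all_goals linarith [ht j, hb j, hL j]
  have hl : ∀ y, 0 ≤ y → y ≤ L l →
      (ext (∑ i, L i) (L l) src F (rp t (mv a l L) l + y) - ext (∑ i, L i) (L l) src F (rp t (mv a l L) l))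
        - (ext (∑ i, L i) (L l) src F (rp b (mv a l L) l + y) - ext (∑ i, L i) (L l) src F (rp b (mv a l L) l))
      = (F (rp t L l + y) - F (rp t L l)) - (F (src + y) - F src) := by
    intro y y0 y1
    rw [S.r1, S.r3, ext_add F y0 y1, ext_le F (x := ∑ i, L i) le_rfl, ext_le, ext_le]
    · ring
    all_goals linarith [ht l, hL l]
  have ha : ∀ z, 0 ≤ z → z ≤ L l →
      (ext (∑ i, L i) (L l) src F (rp t (mv a l L) a + (L a + z)) - ext (∑ i, L i) (L l) src F (rp t (mv a l L) a))
        - (ext (∑ i, L i) (L l) src F (rp b (mv a l L) a + (L a + z)) - ext (∑ i, L i) (L l) src F (rp b (mv a l L) a))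
      = ((F (rp t L a + L a) - F (rp t L a)) - (F (rp b' L a + L a) - F (rp b' L a)))
        + ((F (src + z) - F src) - (F (rp b' L l + z) - F (rp b' L l))) := by
    intro z z0 z1
    rw [S.r1, S.r2 L a S.ne, ← add_assoc, ← add_assoc, S.r5, S.a_end, ext_add F z0 z1,
      ext_le, ext_le, ext_le]
    · ring
    · linarith [hb a, hL a]
    · linarith [hb l]
    · linarith [ht a, hL a]
  rcases hs with hs | hs
  · refine ⟨fun j => if j = l then 0 else c j + if j = a then c l else 0, fun j => ?_, ?_, ?_⟩
    · beta_reduce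
      have := c0 j; have := c0 l
      split_ifs <;> linarith
    · refine le_trans (le_of_eq ?_) c1
      rw [← Finset.add_sum_erase _ _ (Finset.mem_univ l), if_pos rfl, zero_add,
        ← Finset.add_sum_erase Finset.univ c (Finset.mem_univ l)]
      have : ∀ j ∈ Finset.univ.erase l, (if j = l then 0 else c j + if j = a then c l else 0)
          = c j + if j = a then c l else 0 := fun j hj => if_neg (Finset.ne_of_mem_erase hj)
      rw [Finset.sum_congr rfl this, Finset.sum_add_distrib, Finset.sum_ite_eq',
        if_pos (Finset.mem_erase.2 ⟨S.ne, Finset.mem_univ _⟩), add_comm]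
    · intro j y y0 y1
      beta_reduce
      by_cases hj : j = l
      · subst hj
        rw [if_pos rfl, hl y y0 (by rwa [mv_ne _ _ S.ne.symm] at y1), hs]
        simp
      rw [if_neg hj]
      by_cases hja : j = a
      · subst hja
        rw [if_pos rfl]
        rcases le_total y (L j) with h | h
        · exact (hother j y hj y0 h).trans (by linarith [c0 l])
        · have hz := ha (y - L j) (by linarith) (by rw [mv_win] at y1; linarith)
          rw [add_sub_cancel] at hz
          rw [hz, hs]
          refine (abs_add_le _ _).trans (add_le_add ?_ ?_)
          · exact c2 j _ (hL j) le_rfl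
          · exact c2 l _ (by linarith) (by rw [mv_win] at y1; linarith)
      · rw [if_neg hja, add_zero]
        exact hother j y hj y0 (by rwa [mv_ne _ _ hja] at y1)
  · refine ⟨c, c0, c1, ?_⟩
    intro j y y0 y1
    by_cases hj : j = l
    · subst hj
      rw [mv_ne _ _ S.ne.symm] at y1
      rw [hl y y0 y1, hs]
      exact c2 j y y0 y1
    by_cases hja : j = a
    · subst hja
      rcases le_total y (L j) with h | h
      · exact hother j y hj y0 h
      · have hz := ha (y - L j) (by linarith) (by rw [mv_win] at y1; linarith)
        rw [add_sub_cancel] at hz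
        rw [hz, hs, sub_self, add_zero]
        exact c2 j _ (hL j) le_rfl
    · exact hother j y hj y0 (by rwa [mv_ne _ _ hja] at y1)

theorem TopStep.QU_down (S : TopStep t b b' a l) {L : Fin 4 → ℝ} (hL : ∀ i, 0 ≤ L i)
    (h : QU t b (mv a l L)) : QU t b' L := by
  intro F hm hc h0 hE
  have hs : 0 ≤ ∑ i, L i := Finset.sum_nonneg fun i _ => hL i
  obtain ⟨c, h⟩ := h (ext (∑ i, L i) (L l) (rp t L l) F) (ext_mono hm) (ext_cont hc)
    (by rw [ext_le F hs, h0]) (S.dfct_ext hL hE.dfct _ (Or.inl rfl)).eqn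
  refine ⟨c, fun x x0 x1 => ?_⟩
  rw [← h x x0 (by rw [sum_mv]; linarith [hL l]), ext_le F x1]

structure Good (r : Fin 4 → Fin 4) (L w : Fin 4 → ℝ) (F : ℝ → ℝ) : Prop where
  mono : Monotone F
  cont : Continuous F
  lo : ∀ x, x ≤ 0 → F x = 0
  hi : ∀ x, ∑ i, L i ≤ x → F x = ∑ i, w i
  lf : ∀ j, F (rp r L j) = rp r w j
  rt : ∀ j, F (rp r L j + L j) = rp r w j + w j

theorem Good.nonneg {r L w F} (h : Good r L w F) (x) : 0 ≤ F x := by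
  rcases le_total x 0 with hx | hx
  · rw [h.lo x hx]
  · rw [← h.lo 0 le_rfl]; exact h.mono hx

theorem Good.le {r L w F} (h : Good r L w F) (x) : F x ≤ ∑ i, w i := by
  rcases le_total (∑ i, L i) x with hx | hx
  · rw [h.hi x hx]
  · rw [← h.hi _ le_rfl]; exact h.mono hx

theorem TopStep.good_top (S : TopStep t b b' a l) {L w : Fin 4 → ℝ} (hL : ∀ i, 0 ≤ L i) {F : ℝ → ℝ}
    (h : Good t L w F) :
    Good t (mv a l L) (mv a l w) (ext (∑ i, L i) (L l) (rp t L l) F) := by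
  have ht : ∀ j, rp t L j + L j ≤ ∑ i, L i := fun j => rp_add_le t hL j
  have hs : 0 ≤ ∑ i, L i := Finset.sum_nonneg fun i _ => hL i
  refine ⟨ext_mono h.mono, ext_cont h.cont, fun x hx => ?_, fun x hx => ?_, fun j => ?_, fun j => ?_⟩
  · rw [ext_le F (hx.trans hs), h.lo x hx]
  · rw [sum_mv] at hx
    rw [ext_ge F (hL l) hx, h.hi _ le_rfl, h.lf, h.rt, sum_mv]; ring
  · rw [S.r1, S.r1, ext_le F (by linarith [ht j, hL j]), h.lf]
  · rw [S.r1, S.r1]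
    by_cases hj : j = a
    · subst hj
      rw [mv_win, mv_win, ← add_assoc, ← add_assoc, S.r5, S.r5, ext_add F (hL l) le_rfl, h.hi _ le_rfl, h.lf, h.rt]
      ring
    · rw [mv_ne _ _ hj, mv_ne _ _ hj, ext_le F (ht j), h.rt]

theorem TopStep.good_bot (S : TopStep t b b' a l) {L w : Fin 4 → ℝ} (hL : ∀ i, 0 ≤ L i) {F : ℝ → ℝ}
    (h : Good b' L w F) :
    Good b (mv a l L) (mv a l w) (ext (∑ i, L i) (L l) (rp b' L l) F) := by
  have ht : ∀ j, rp b' L j + L j ≤ ∑ i, L i := fun j => rp_add_le b' hL j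
  have hs : 0 ≤ ∑ i, L i := Finset.sum_nonneg fun i _ => hL i
  refine ⟨ext_mono h.mono, ext_cont h.cont, fun x hx => ?_, fun x hx => ?_, fun j => ?_, fun j => ?_⟩
  · rw [ext_le F (hx.trans hs), h.lo x hx]
  · rw [sum_mv] at hx
    rw [ext_ge F (hL l) hx, h.hi _ le_rfl, h.lf, h.rt, sum_mv]; ring
  · by_cases hj : j = l
    · subst hj
      rw [S.r3, S.r3, ext_le F le_rfl, h.hi _ le_rfl]
    · rw [S.r2 L j hj, S.r2 w j hj, ext_le F (by linarith [ht j, hL j]), h.lf]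
  · by_cases hj : j = l
    · subst hj
      rw [S.r3, S.r3, mv_ne _ _ S.ne.symm, mv_ne _ _ S.ne.symm, ext_add F (hL j) le_rfl, h.hi _ le_rfl, h.lf, h.rt]
      ring
    rw [S.r2 L j hj, S.r2 w j hj]
    by_cases hja : j = a
    · subst hja
      rw [mv_win, mv_win, ← add_assoc, ← add_assoc, S.a_end, S.a_end, ext_le F (ht l), h.rt]
    · rw [mv_ne _ _ hja, mv_ne _ _ hja, ext_le F (ht j), h.rt]

theorem ext_close {r : Fin 4 → Fin 4} {L w : Fin 4 → ℝ} {F G : ℝ → ℝ}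
    (hF : Good r L w F) (hG : Good r L w G) (l : Fin 4) {ε : ℝ} (h : ∀ x, |F x - G x| ≤ ε) (x : ℝ) :
    |ext (∑ i, L i) (L l) (rp r L l) F x - ext (∑ i, L i) (L l) (rp r L l) G x| ≤ ε := by
  rcases le_total x (∑ i, L i) with hx | hx
  · rw [ext_le F hx, ext_le G hx]; exact h x
  · unfold ext
    rw [min_eq_right hx, hF.hi _ le_rfl, hG.hi _ le_rfl, hF.lf, hG.lf]
    refine le_trans (le_of_eq ?_) (h (rp r L l + max 0 (min (x - ∑ i, L i) (L l))))
    congr 1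
    ring
end

theorem QU_M (y s) {w : Fin 4 → ℝ} (hw : ∀ i, 0 ≤ w i) (h : QU (tR s) (bR s) (M y s w)) :
    QU (tR (nxt y s)) (bR (nxt y s)) w := by
  cases y
  · rw [bR_nxt]
    exact ((step_bot s).QU_down hw h.symm).symm
  · rw [tR_nxt]
    exact (step_top s).QU_down hw h

/-- extension along a Rauzy move -/
def E (y : Bool) (s : Fin 7) (L : Fin 4 → ℝ) (F : ℝ → ℝ) : ℝ → ℝ :=
  ext (∑ i, L i) (L (los y s)) (rp (tR (nxt y s)) L (los y s)) F

theorem good_E (y s) {L w : Fin 4 → ℝ} (hL : ∀ i, 0 ≤ L i) {F : ℝ → ℝ}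
    (h : Good (tR (nxt y s)) L w F) : Good (tR s) (M y s L) (M y s w) (E y s L F) := by
  cases y
  · exact (step_bot s).good_bot hL h
  · have := tR_nxt s
    unfold E
    rw [this] at h ⊢
    exact (step_top s).good_top hL h

theorem dfct_E (y s) {L : Fin 4 → ℝ} (hL : ∀ i, 0 ≤ L i) {F : ℝ → ℝ} {δ}
    (h : Dfct (tR (nxt y s)) (bR (nxt y s)) L F δ) : Dfct (tR s) (bR s) (M y s L) (E y s L F) δ := by
  cases y
  · rw [bR_nxt] at h
    exact ((step_bot s).dfct_ext hL h.symm _ (Or.inr rfl)).symm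
  · have := tR_nxt s
    unfold E
    rw [this] at h ⊢
    exact (step_top s).dfct_ext hL h _ (Or.inl rfl)

/-- piecewise linear base function -/
noncomputable def base (r : Fin 4 → Fin 4) (L w : Fin 4 → ℝ) (x : ℝ) : ℝ :=
  ∑ k, w k * max 0 (min 1 ((x - rp r L k) / L k))

theorem good_base {r : Fin 4 → Fin 4} (hr : Function.Injective r) {L w : Fin 4 → ℝ} (hL : ∀ i, 0 < L i)
    (hw : ∀ i, 0 ≤ w i) : Good r L w (base r L w) := by
  have one : ∀ k x, rp r L k + L k ≤ x → max 0 (min 1 ((x - rp r L k) / L k)) = 1 := by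
    intro k x hx
    rw [min_eq_left, max_eq_right zero_le_one]
    rw [le_div_iff₀ (hL k)]; linarith
  have zero : ∀ k x, x ≤ rp r L k → max 0 (min 1 ((x - rp r L k) / L k)) = 0 := by
    intro k x hx
    rw [max_eq_left]
    exact (min_le_right _ _).trans (div_nonpos_of_nonpos_of_nonneg (by linarith) (hL k).le)
  have hL' : ∀ i, 0 ≤ L i := fun i => (hL i).le
  refine ⟨fun x y hxy => ?_, ?_, fun x hx => ?_, fun x hx => ?_, fun j => ?_, fun j => ?_⟩
  · unfold base
    refine Finset.sum_le_sum fun k _ => mul_le_mul_of_nonneg_left ?_ (hw k)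
    have := (hL k).le
    gcongr
  · unfold base; fun_prop
  · unfold base
    refine Finset.sum_eq_zero fun k _ => ?_
    rw [zero k x (hx.trans (rp_nonneg r hL' k)), mul_zero]
  · unfold base
    refine Finset.sum_congr rfl fun k _ => ?_
    rw [one k x ((rp_add_le r hL' k).trans hx), mul_one]
  · unfold base
    rw [show rp r w j = ∑ k, if r k < r j then w k else 0 from rfl]
    refine Finset.sum_congr rfl fun k _ => ?_
    split_ifs with h
    · rw [one k _ (rp_lt_le r hL' h), mul_one]
    · rw [zero, mul_zero]
      rcases (not_lt.1 h).eq_or_lt with h | h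
      · rw [hr h]
      · linarith [rp_lt_le r hL' h, hL j]
  · unfold base
    rw [show rp r w j = ∑ k, if r k < r j then w k else 0 from rfl, ← Finset.add_sum_erase Finset.univ _ (Finset.mem_univ j),
      ← Finset.add_sum_erase Finset.univ (fun k => if r k < r j then w k else 0) (Finset.mem_univ j),
      if_neg (lt_irrefl _), zero_add, one j _ le_rfl, mul_one, add_comm]
    congr 1
    refine Finset.sum_congr rfl fun k hk => ?_
    split_ifs with h
    · rw [one k _ ((rp_lt_le r hL' h).trans (by linarith [hL j])), mul_one]
    · rw [zero, mul_zero]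
      rcases (not_lt.1 h).eq_or_lt with h | h
      · exact absurd (hr h).symm (Finset.ne_of_mem_erase hk)
      · exact rp_lt_le r hL' h

theorem Good.dfct {r L w F} (h : Good r L w F) (t b : Fin 4 → Fin 4) (L' : Fin 4 → ℝ) (hw : 0 ≤ ∑ i, w i) :
    Dfct t b L' F (4 * ∑ i, w i) := by
  refine ⟨fun _ => ∑ i, w i, fun _ => hw, by simp, fun j y y0 y1 => ?_⟩
  have a1 := h.mono (show rp t L' j ≤ rp t L' j + y by linarith)
  have a2 := h.mono (show rp b L' j ≤ rp b L' j + y by linarith)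
  have := h.nonneg (rp t L' j); have := h.le (rp t L' j + y)
  have := h.nonneg (rp b L' j); have := h.le (rp b L' j + y)
  rw [abs_le]; constructor <;> linarith

end IETPath

open MeasureTheory Filter Topology

namespace IETPath

/-- an infinite Rauzy path -/
def RPath (s : ℕ → Fin 7) (y : ℕ → Bool) : Prop := ∀ k, s (k+1) = nxt (y k) (s k)

/-- a compatible sequence of nonnegative vectors -/
structure Orb (s : ℕ → Fin 7) (y : ℕ → Bool) (w : ℕ → Fin 4 → ℝ) : Prop where
  nn : ∀ k i, 0 ≤ w k i
  eq : ∀ k, w k = M (y k) (s k) (w (k+1))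

theorem Orb.shift {s y w} (h : Orb s y w) (n : ℕ) :
    Orb (fun k => s (k+n)) (fun k => y (k+n)) (fun k => w (k+n)) :=
  ⟨fun k => h.nn _, fun k => by
    rw [show k + 1 + n = k + n + 1 by ring]; exact h.eq (k+n)⟩

theorem RPath.shift {s y} (h : RPath s y) (n : ℕ) :
    RPath (fun k => s (k+n)) (fun k => y (k+n)) := fun k => by
  beta_reduce; rw [show k + 1 + n = k + n + 1 by ring]; exact h (k+n)

noncomputable def G (s : ℕ → Fin 7) (y : ℕ → Bool) (L w : ℕ → Fin 4 → ℝ) : ℕ → ℕ → ℝ → ℝ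
  | 0, i => base (tR (s i)) (L i) (w i)
  | n+1, i => E (y i) (s i) (L (i+1)) (G s y L w n (i+1))

theorem good_G {s y L w} (hp : RPath s y) (hL : Orb s y L) (hpos : ∀ k i, 0 < L k i)
    (hw : Orb s y w) (n) : ∀ i, Good (tR (s i)) (L i) (w i) (G s y L w n i) := by
  induction n with
  | zero => intro i; exact good_base (tR_inj _) (hpos i) (hw.nn i)
  | succ n ih =>
    intro i
    have := ih (i+1)
    rw [hp i] at this
    rw [hL.eq i, hw.eq i]
    exact good_E (y i) (s i) (hL.nn (i+1)) this

theorem dfct_G {s y L w} (hp : RPath s y) (hL : Orb s y L) (hpos : ∀ k i, 0 < L k i)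
    (hw : Orb s y w) (n) : ∀ i, Dfct (tR (s i)) (bR (s i)) (L i) (G s y L w n i) (4 * ∑ j, w (i+n) j) := by
  induction n with
  | zero =>
    intro i
    exact (good_G hp hL hpos hw 0 i).dfct _ _ _ (Finset.sum_nonneg fun j _ => hw.nn _ j)
  | succ n ih =>
    intro i
    have := ih (i+1)
    rw [hp i] at this
    rw [hL.eq i]
    rw [show i + (n+1) = i + 1 + n by ring]
    exact dfct_E (y i) (s i) (hL.nn (i+1)) this

theorem close_G {s y L w} (hp : RPath s y) (hL : Orb s y L) (hpos : ∀ k i, 0 < L k i)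
    (hw : Orb s y w) (n m) : ∀ i x, |G s y L w n i x - G s y L w (n+m) i x| ≤ ∑ j, w (i+n) j := by
  induction n with
  | zero =>
    intro i x
    have h1 := good_G hp hL hpos hw 0 i
    have h2 := good_G hp hL hpos hw (0+m) i
    have := h1.nonneg x; have := h1.le x; have := h2.nonneg x; have := h2.le x
    rw [abs_le]; constructor <;> simp only [add_zero] <;> linarith
  | succ n ih =>
    intro i x
    rw [show n + 1 + m = (n + m) + 1 by ring, show i + (n+1) = i + 1 + n by ring]
    have h1 := good_G hp hL hpos hw n (i+1)
    have h2 := good_G hp hL hpos hw (n+m) (i+1)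
    rw [hp i] at h1 h2
    exact ext_close h1 h2 (los (y i) (s i)) (ih (i+1)) x

theorem shrink {s y L w} (hp : RPath s y) (hL : Orb s y L) (hpos : ∀ k i, 0 < L k i)
    (hw : Orb s y w) (hlim : Tendsto (fun k => ∑ j, w k j) atTop (𝓝 0))
    (hQ : QU (tR (s 0)) (bR (s 0)) (L 0)) : ∃ c : ℝ, w 0 = c • L 0 := by
  have hcl : ∀ n m x, |G s y L w n 0 x - G s y L w (n+m) 0 x| ≤ ∑ j, w n j := by
    intro n m x; have := close_G hp hL hpos hw n m 0 x; rwa [zero_add] at this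
  have hg := fun n => good_G hp hL hpos hw n 0
  have hcau : ∀ x, CauchySeq (fun n => G s y L w n 0 x) := by
    intro x
    refine cauchySeq_of_le_tendsto_0' (fun n => ∑ j, w n j) ?_ hlim
    intro n m hnm
    obtain ⟨k, rfl⟩ := Nat.exists_eq_add_of_le hnm
    exact hcl n k x
  choose F hF using fun x => cauchySeq_tendsto_of_complete (hcau x)
  have hunif : ∀ n x, |G s y L w n 0 x - F x| ≤ ∑ j, w n j := by
    intro n x
    have h1 : Tendsto (fun m => |G s y L w n 0 x - G s y L w (m + n) 0 x|) atTop
        (𝓝 |G s y L w n 0 x - F x|) :=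
      (tendsto_const_nhds.sub ((tendsto_add_atTop_iff_nat n).2 (hF x))).abs
    refine le_of_tendsto h1 (Eventually.of_forall fun m => ?_)
    rw [add_comm]; exact hcl n m x
  have hUC : TendstoUniformly (fun n x => G s y L w n 0 x) F atTop := by
    rw [Metric.tendstoUniformly_iff]
    intro ε hε
    filter_upwards [hlim.eventually (gt_mem_nhds hε)] with n hn x
    rw [dist_comm, Real.dist_eq]
    exact (hunif n x).trans_lt hn
  have hcont : Continuous F := hUC.continuous (Frequently.of_forall fun n => (hg n).cont)
  have hmono : Monotone F := fun a b hab =>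
    le_of_tendsto_of_tendsto' (hF a) (hF b) fun n => (hg n).mono hab
  have hconst : ∀ x v, (∀ n, G s y L w n 0 x = v) → F x = v := by
    intro x v h
    refine tendsto_nhds_unique (hF x) ?_
    simp only [h]; exact tendsto_const_nhds
  have h0 : F 0 = 0 := hconst 0 0 fun n => (hg n).lo 0 le_rfl
  have hE : Eqn (tR (s 0)) (bR (s 0)) (L 0) F := by
    intro j v v0 v1
    have hd : ∀ n, |((G s y L w n 0) (rp (tR (s 0)) (L 0) j + v) - (G s y L w n 0) (rp (tR (s 0)) (L 0) j))
        - ((G s y L w n 0) (rp (bR (s 0)) (L 0) j + v) - (G s y L w n 0) (rp (bR (s 0)) (L 0) j))|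
        ≤ 4 * ∑ i, w n i := by
      intro n
      obtain ⟨c, c0, c1, c2⟩ := dfct_G hp hL hpos hw n 0
      rw [zero_add] at c1
      exact (c2 j v v0 v1).trans
        ((Finset.single_le_sum (fun i _ => c0 i) (Finset.mem_univ j)).trans c1)
    have hl := (((hF (rp (tR (s 0)) (L 0) j + v)).sub (hF (rp (tR (s 0)) (L 0) j))).sub
      ((hF (rp (bR (s 0)) (L 0) j + v)).sub (hF (rp (bR (s 0)) (L 0) j)))).abs
    have h4 : Tendsto (fun n => 4 * ∑ i, w n i) atTop (𝓝 0) := by simpa using hlim.const_mul 4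
    have := le_of_tendsto_of_tendsto' hl h4 hd
    exact sub_eq_zero.1 (abs_eq_zero.1 (le_antisymm this (abs_nonneg _)))
  obtain ⟨c, hc⟩ := hQ F hmono hcont h0 hE
  refine ⟨c, funext fun j => ?_⟩
  have e1 := hconst _ _ fun n => (hg n).lf j
  have e2 := hconst _ _ fun n => (hg n).rt j
  have i1 := rp_nonneg (tR (s 0)) (hL.nn 0) j
  have i2 := rp_add_le (tR (s 0)) (hL.nn 0) j
  have i3 := hL.nn 0 j
  rw [hc _ i1 (by linarith)] at e1
  rw [hc _ (by linarith) i2] at e2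
  simp only [Pi.smul_apply, smul_eq_mul]
  linarith

end IETPath

open MeasureTheory Filter Topology

namespace IETPath

theorem Orb.loser_tendsto {s y w} (h : Orb s y w) :
    Tendsto (fun k => w (k+1) (los (y k) (s k))) atTop (𝓝 0) := by
  have heq : ∀ k, ∑ j, w k j = ∑ j, w (k+1) j + w (k+1) (los (y k) (s k)) := by
    intro k
    conv_lhs => rw [h.eq k]
    exact sum_M _ _ _
  have hanti : Antitone (fun k => ∑ j, w k j) :=
    antitone_nat_of_succ_le fun k => by rw [heq k]; linarith [h.nn (k+1) (los (y k) (s k))]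
  have hbdd : BddBelow (Set.range fun k => ∑ j, w k j) :=
    ⟨0, by rintro _ ⟨k, rfl⟩; exact Finset.sum_nonneg fun j _ => h.nn k j⟩
  have h1 := tendsto_atTop_ciInf hanti hbdd
  have h2 := h1.sub ((tendsto_add_atTop_iff_nat 1).2 h1)
  rw [sub_self] at h2
  refine h2.congr fun k => ?_
  rw [heq k]; ring

theorem Orb.anti {s y w} (h : Orb s y w) (j) : Antitone (fun k => w k j) :=
  antitone_nat_of_succ_le fun k => by
    rw [h.eq k]; unfold M mv
    have := h.nn (k+1) (los (y k) (s k))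
    split_ifs <;> linarith

theorem Orb.const {s y w} (h : Orb s y w) {j : Fin 4} {K : ℕ} (hK : ∀ k ≥ K, win (y k) (s k) ≠ j) :
    ∀ k ≥ K, w k j = w K j := by
  intro k hk
  induction k, hk using Nat.le_induction with
  | base => rfl
  | succ k hk ih =>
    rw [← ih, h.eq k]; unfold M
    rw [mv_ne _ _ (hK k hk).symm]

section
variable {s : ℕ → Fin 7} {y : ℕ → Bool} {L : ℕ → Fin 4 → ℝ}

theorem loses_wins (hL : Orb s y L) (hpos : ∀ k i, 0 < L k i)
    (a : Fin 4) (h : ∃ᶠ k in atTop, los (y k) (s k) = a) : ∃ᶠ k in atTop, win (y k) (s k) = a := by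
  by_contra hn
  rw [not_frequently] at hn
  obtain ⟨K, hK⟩ := eventually_atTop.1 hn
  have hc := hL.const hK
  have := hL.loser_tendsto.eventually (gt_mem_nhds (hpos K a))
  obtain ⟨k, ⟨hk1, hk2⟩, hk3⟩ := ((h.and_eventually this).and_eventually (eventually_ge_atTop K)).exists
  rw [hk1, hc (k+1) (by omega)] at hk2
  exact lt_irrefl _ hk2

theorem exists_freq_loser (p : ℕ → Fin 4) : ∃ a, ∃ᶠ k in atTop, p k = a := by
  by_contra hn
  push Not at hn
  obtain ⟨k, hk⟩ := (eventually_all.2 hn).exists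
  exact hk (p k) rfl

theorem win_stays (y s) : win y (nxt y s) = win y s ∧ los (!y) (nxt y s) = win y s := by
  revert y s; decide

theorem wins_loses (hp : RPath s y) (hL : Orb s y L) (hpos : ∀ k i, 0 < L k i)
    (a : Fin 4) (h : ∃ᶠ k in atTop, win (y k) (s k) = a) : ∃ᶠ k in atTop, los (y k) (s k) = a := by
  by_contra hn
  rw [not_frequently] at hn
  obtain ⟨K, hK⟩ := eventually_atTop.1 hn
  obtain ⟨k0, hk0, hk0'⟩ := (h.and_eventually (eventually_ge_atTop K)).exists
  have hall : ∀ k ≥ k0, win (y k) (s k) = a := by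
    intro k hk
    induction k, hk using Nat.le_induction with
    | base => exact hk0
    | succ k hk ih =>
      have h1 := win_stays (y k) (s k)
      rw [← hp k, ih] at h1
      by_cases hy : y (k+1) = y k
      · rw [hy]; exact h1.1
      · have : y (k+1) = !(y k) := by
          cases h1 : y (k+1) <;> cases h2 : y k <;> simp_all
        exact absurd (this ▸ h1.2) (hK (k+1) (by omega))
  obtain ⟨b, hb⟩ := exists_freq_loser (fun k => los (y k) (s k))
  obtain ⟨k, hk1, hk2⟩ := (hb.and_eventually (eventually_ge_atTop k0)).exists
  obtain ⟨k', hk1', hk2'⟩ := ((loses_wins hL hpos b hb).and_eventually (eventually_ge_atTop k0)).exists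
  rw [hall k' hk2'] at hk1'
  apply win_ne_los (y k) (s k)
  rw [hall k hk2, hk1', hk1]

def V (s : ℕ → Fin 7) (y : ℕ → Bool) (X : Fin 7) (c : Bool) : Prop :=
  ∃ᶠ k in atTop, s k = X ∧ y k = c

theorem V_of {P : Fin 7 → Bool → Prop} (h : ∃ᶠ k in atTop, P (s k) (y k)) :
    ∃ X c, P X c ∧ V s y X c := by
  by_contra hn
  push Not at hn
  have : ∀ p : Fin 7 × Bool, ∀ᶠ k in atTop, P p.1 p.2 → ¬ (s k = p.1 ∧ y k = p.2) := by
    rintro ⟨X, c⟩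
    by_cases hP : P X c
    · exact (not_frequently.1 (hn X c hP)).mono fun k hk _ => hk
    · exact Eventually.of_forall fun k hk => absurd hk hP
  obtain ⟨k, hk1, hk2⟩ := (h.and_eventually (eventually_all.2 this)).exists
  exact hk2 (s k, y k) hk1 ⟨rfl, rfl⟩

theorem V_out (hp : RPath s y) {X c} (h : V s y X c) : V s y (nxt c X) true ∨ V s y (nxt c X) false := by
  have : ∃ᶠ k in atTop, s (k+1) = nxt c X := h.mono fun k hk => by rw [hp k, hk.1, hk.2]
  have h2 : ∃ᶠ k in atTop, s k = nxt c X := by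
    rw [frequently_atTop] at this ⊢
    intro a
    obtain ⟨b, hb, hb'⟩ := this a
    exact ⟨b+1, by omega, hb'⟩
  obtain ⟨X', c', h3, h4⟩ := V_of (P := fun X' _ => X' = nxt c X) h2
  subst h3
  cases c'
  · exact Or.inr h4
  · exact Or.inl h4

theorem V_trap (hp : RPath s y) (hL : Orb s y L) (hpos : ∀ k i, 0 < L k i) {X c} (h : V s y X c)
    (hX : nxt c X = X) : V s y X (!c) := by
  by_contra hn
  obtain ⟨K, hK⟩ := eventually_atTop.1 (not_frequently.1 hn)
  obtain ⟨k0, hk0, hk0'⟩ := (h.and_eventually (eventually_ge_atTop K)).exists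
  have hall : ∀ k ≥ k0, s k = X ∧ y k = c := by
    intro k hk
    induction k, hk using Nat.le_induction with
    | base => exact hk0
    | succ k hk ih =>
      have h1 : s (k+1) = X := by rw [hp k, ih.1, ih.2, hX]
      refine ⟨h1, ?_⟩
      have := hK (k+1) (by omega)
      simp only [h1, true_and] at this
      cases h1 : y (k+1) <;> cases c <;> simp_all
  have hlose : ∃ᶠ k in atTop, los (y k) (s k) = los c X := h.mono fun k hk => by rw [hk.1, hk.2]
  obtain ⟨k, hk1, hk2⟩ := ((loses_wins hL hpos _ hlose).and_eventually (eventually_ge_atTop k0)).exists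
  rw [(hall k hk2).1, (hall k hk2).2] at hk1
  exact win_ne_los _ _ hk1

theorem V_lose_win (hL : Orb s y L) (hpos : ∀ k i, 0 < L k i) {X c} (h : V s y X c) :
    ∃ X' c', win c' X' = los c X ∧ V s y X' c' :=
  V_of (P := fun X' c' => win c' X' = los c X)
    (loses_wins hL hpos _ (h.mono fun k hk => by rw [hk.1, hk.2]))

theorem V_win_lose (hp : RPath s y) (hL : Orb s y L) (hpos : ∀ k i, 0 < L k i) {X c} (h : V s y X c) :
    ∃ X' c', los c' X' = win c X ∧ V s y X' c' :=
  V_of (P := fun X' c' => los c' X' = win c X)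
    (wins_loses hp hL hpos _ (h.mono fun k hk => by rw [hk.1, hk.2]))

theorem comb (U : Fin 7 → Bool → Prop) (ne : ∃ X c, U X c)
    (out : ∀ X c, U X c → U (nxt c X) true ∨ U (nxt c X) false)
    (trap : ∀ X c, U X c → nxt c X = X → U X (!c))
    (lw : ∀ X c, U X c → ∃ X' c', win c' X' = los c X ∧ U X' c')
    (wl : ∀ X c, U X c → ∃ X' c', los c' X' = win c X ∧ U X' c') :
    ∀ a, ∃ X c, los c X = a ∧ U X c := by
  have w3 : ∀ X c, win c X = 3 → U X c → U 0 true ∨ U 1 true ∨ U 2 true := by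
    intro X c h; revert X c
    intro X c; fin_cases X <;> cases c <;> simp +decide
    all_goals tauto
  have w0 : ∀ X c, win c X = 0 → U X c → U 0 false ∨ U 4 false ∨ U 5 false := by
    intro X c; fin_cases X <;> cases c <;> simp +decide
    all_goals tauto
  have o := fun X c => out X c
  have Cb : U 2 false → U 2 true := fun h => trap _ _ h (by decide)
  have Dt : U 3 true → U 3 false := fun h => trap _ _ h (by decide)
  have ct : U 5 true → U 5 false := fun h => trap _ _ h (by decide)
  have db : U 6 false → U 6 true := fun h => trap _ _ h (by decide)
  have At : U 0 true → U 1 true ∨ U 1 false := out 0 true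
  have Ab : U 0 false → U 4 true ∨ U 4 false := out 0 false
  have Bt : U 1 true → U 2 true ∨ U 2 false := out 1 true
  have Bb : U 1 false → U 3 true ∨ U 3 false := out 1 false
  have Ct : U 2 true → U 0 true ∨ U 0 false := out 2 true
  have Db : U 3 false → U 1 true ∨ U 1 false := out 3 false
  have bt : U 4 true → U 6 true ∨ U 6 false := out 4 true
  have bb : U 4 false → U 5 true ∨ U 5 false := out 4 false
  have cb : U 5 false → U 0 true ∨ U 0 false := out 5 false
  have dt : U 6 true → U 4 true ∨ U 4 false := out 6 true
  have Bb3 : U 1 false → U 0 true ∨ U 1 true ∨ U 2 true := fun h => by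
    obtain ⟨X, c, h1, h2⟩ := lw 1 false h
    exact w3 X c h1 h2
  have bt0 : U 4 true → U 0 false ∨ U 4 false ∨ U 5 false := fun h => by
    obtain ⟨X, c, h1, h2⟩ := lw 4 true h
    exact w0 X c h1 h2
  have hA : U 0 true ∨ U 0 false := by
    obtain ⟨X, c, h⟩ := ne
    have hC' := fun h => Ct (Cb h)
    have hBt := fun h => (Bt h).elim Ct hC'
    have hBb := fun h => (Bb3 h).elim Or.inl (fun h => h.elim hBt Ct)
    have hD' := fun h => (Db h).elim hBt hBb
    have hc' := fun h => cb (ct h)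
    have hbb := fun h => (bb h).elim hc' cb
    have hbt := fun h => (bt0 h).elim Or.inr (fun h => h.elim hbb cb)
    have hd := fun h => (dt h).elim hbt hbb
    fin_cases X <;> cases c
    exacts [Or.inr h, Or.inl h, hBb h, hBt h, hC' h, Ct h, hD' h, hD' (Dt h), hbb h, hbt h, cb h,
      hc' h, hd (db h), hd h]
  have inv : ∀ X c a, (win c X = a ∨ los c X = a) → U X c → ∃ X c, los c X = a ∧ U X c := by
    rintro X c a (rfl | rfl) h
    · exact wl X c h
    · exact ⟨X, c, rfl, h⟩
  intro a
  have h03 : a = 0 ∨ a = 3 → ∃ X c, los c X = a ∧ U X c := by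
    intro ha
    rcases hA with h | h
    · refine inv _ _ a ?_ h; rcases ha with rfl | rfl <;> decide
    · refine inv _ _ a ?_ h; rcases ha with rfl | rfl <;> decide
  have h1 : a = 1 → ∃ X c, los c X = a ∧ U X c := by
    rintro rfl
    have : U 1 true ∨ U 1 false ∨ U 5 true ∨ U 5 false ∨ U 6 true ∨ U 6 false := by
      clear trap lw wl out o w3 w0 inv Bb3 bt0 h03
      grind only
    rcases this with h | h | h | h | h | h
    all_goals exact inv _ _ _ (by decide) h
  have h2 : a = 2 → ∃ X c, los c X = a ∧ U X c := by
    rintro rfl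
    have : U 4 true ∨ U 4 false ∨ U 2 true ∨ U 2 false ∨ U 3 true ∨ U 3 false := by
      clear trap lw wl out o w3 w0 inv Bb3 bt0 h03
      grind only
    rcases this with h | h | h | h | h | h
    all_goals exact inv _ _ _ (by decide) h
  fin_cases a
  · exact h03 (Or.inl rfl)
  · exact h1 rfl
  · exact h2 rfl
  · exact h03 (Or.inr rfl)

theorem all_lose (hp : RPath s y) (hL : Orb s y L) (hpos : ∀ k i, 0 < L k i) (a : Fin 4) :
    ∃ᶠ k in atTop, los (y k) (s k) = a := by
  obtain ⟨X, c, h1, h2⟩ := comb (V s y)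
    (by obtain ⟨X, c, -, h⟩ := V_of (s := s) (y := y) (P := fun _ _ => True)
          (Frequently.of_forall fun _ => trivial)
        exact ⟨X, c, h⟩)
    (fun X c h => V_out hp h) (fun X c h => V_trap hp hL hpos h)
    (fun X c h => V_lose_win hL hpos h) (fun X c h => V_win_lose hp hL hpos h) a
  subst h1
  exact h2.mono fun k hk => by rw [hk.1, hk.2]

theorem tendsto_zero (hp : RPath s y) (hL : Orb s y L) (hpos : ∀ k i, 0 < L k i) {w}
    (hw : Orb s y w) : Tendsto (fun k => ∑ j, w k j) atTop (𝓝 0) := by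
  have hj : ∀ j, Tendsto (fun k => w k j) atTop (𝓝 0) := by
    intro j
    rw [Metric.tendsto_atTop]
    intro ε hε
    obtain ⟨k, hk1, hk2⟩ := ((all_lose hp hL hpos j).and_eventually
      (hw.loser_tendsto.eventually (gt_mem_nhds hε))).exists
    refine ⟨k+1, fun n hn => ?_⟩
    rw [hk1] at hk2
    rw [Real.dist_eq, sub_zero, abs_of_nonneg (hw.nn n j)]
    exact (hw.anti j hn).trans_lt hk2
  have := tendsto_finsetSum Finset.univ fun j _ => hj j
  simpa using this

end
end IETPath

open MeasureTheory Filter Topology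

namespace IETPath

/-- composite Rauzy matrix -/
def NN (s : ℕ → Fin 7) (y : ℕ → Bool) : ℕ → (Fin 4 → ℝ) → (Fin 4 → ℝ)
  | 0, w => w
  | k+1, w => NN s y k (M (y k) (s k) w)

theorem M_inj (c X) : Function.Injective (M c X) := by
  intro v w h
  have h1 : ∀ i, i ≠ win c X → v i = w i := fun i hi => by
    have := congrFun h i
    unfold M at this
    rwa [mv_ne _ _ hi, mv_ne _ _ hi] at this
  funext i
  by_cases hi : i = win c X
  · have := congrFun h i
    unfold M at this
    rw [hi, mv_win, mv_win, h1 _ (win_ne_los c X).symm] at this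
    rw [hi]; linarith
  · exact h1 i hi

section
variable (s : ℕ → Fin 7) (y : ℕ → Bool)

theorem NN_inj (k) : Function.Injective (NN s y k) := by
  induction k with
  | zero => exact fun _ _ h => h
  | succ k ih => exact ih.comp (M_inj _ _)

theorem NN_cont (k) : Continuous (NN s y k) := by
  induction k with
  | zero => exact continuous_id
  | succ k ih => exact ih.comp (continuous_M _ _)

theorem NN_nonneg (k) : ∀ {w}, (∀ i, 0 ≤ w i) → ∀ i, 0 ≤ NN s y k w i := by
  induction k with
  | zero => exact fun h => h
  | succ k ih => exact fun h => ih (M_nonneg _ _ h)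

theorem NN_smul (k) (c : ℝ) : ∀ w, NN s y k (c • w) = c • NN s y k w := by
  induction k with
  | zero => exact fun _ => rfl
  | succ k ih => intro w; simp only [NN, M_smul, ih]

theorem NN_sum (k) : ∀ {w}, (∀ i, 0 ≤ w i) → ∑ i, w i ≤ ∑ i, NN s y k w i := by
  induction k with
  | zero => exact fun _ => le_rfl
  | succ k ih =>
    intro w h
    refine le_trans ?_ (ih (M_nonneg _ _ h))
    rw [sum_M]; linarith [h (los (y k) (s k))]

theorem Orb.NN {s y w} (h : Orb s y w) (k) : NN s y k (w k) = w 0 := by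
  induction k with
  | zero => rfl
  | succ k ih =>
    rw [← ih]; conv_rhs => rw [h.eq k]
    rfl

/-- simplex of the composite matrix -/
def Cn (k : ℕ) : Set (Fin 4 → ℝ) := {v | ∃ w : Fin 4 → ℝ, (∀ i, 0 ≤ w i) ∧ v = NN s y k w ∧ ∑ i, v i = 1}

theorem Cn_compact (k) : IsCompact (Cn s y k) := by
  have : Cn s y k = NN s y k '' {w | (∀ i, 0 ≤ w i) ∧ ∑ i, NN s y k w i = 1} := by
    ext v; constructor
    · rintro ⟨w, h1, rfl, h2⟩; exact ⟨w, ⟨h1, h2⟩, rfl⟩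
    · rintro ⟨w, ⟨h1, h2⟩, rfl⟩; exact ⟨w, h1, rfl, h2⟩
  rw [this]
  refine IsCompact.image ?_ (NN_cont s y k)
  have hcl : IsClosed {w : Fin 4 → ℝ | (∀ i, 0 ≤ w i) ∧ ∑ i, NN s y k w i = 1} := by
    refine IsClosed.inter ?_ ?_
    · exact isClosed_le (f := fun _ => (0 : Fin 4 → ℝ)) continuous_const continuous_id
    · refine isClosed_eq (continuous_finsetSum _ fun i _ => ?_) continuous_const
      exact (continuous_apply i).comp (NN_cont s y k)
  refine (isCompact_Icc (a := (0 : Fin 4 → ℝ)) (b := 1)).of_isClosed_subset hcl ?_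
  rintro w ⟨h1, h2⟩
  refine ⟨fun i => h1 i, fun i => ?_⟩
  have := NN_sum s y k h1
  rw [h2] at this
  exact (Finset.single_le_sum (fun j _ => h1 j) (Finset.mem_univ i)).trans this

theorem Cn_anti (k) : Cn s y (k+1) ⊆ Cn s y k := by
  rintro v ⟨w, h1, h2, h3⟩
  exact ⟨M (y k) (s k) w, M_nonneg _ _ h1, h2, h3⟩

theorem exists_orb {A : Set (Fin 4 → ℝ)} (hA : IsClosed A) (h : ∀ k, (Cn s y k ∩ A).Nonempty) :
    ∃ w, Orb s y w ∧ w 0 ∈ A ∧ ∑ i, w 0 i = 1 := by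
  obtain ⟨v, hv⟩ := IsCompact.nonempty_iInter_of_sequence_nonempty_isCompact_isClosed
    (fun k => Cn s y k ∩ A) (fun k => Set.inter_subset_inter_left _ (Cn_anti s y k)) h
    ((Cn_compact s y 0).inter_right hA) (fun k => (Cn_compact s y k).isClosed.inter hA)
  rw [Set.mem_iInter] at hv
  choose w h1 h2 h3 using fun k => (hv k).1
  have h0 : v = w 0 := h2 0
  refine ⟨w, ⟨h1, fun k => ?_⟩, h0 ▸ (hv 0).2, h0 ▸ h3 0⟩
  apply NN_inj s y k
  rw [← h2 k]; exact h2 (k+1)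

theorem cone_shrink {s y} {L : ℕ → Fin 4 → ℝ} (hp : RPath s y) (hL : Orb s y L)
    (hpos : ∀ k i, 0 < L k i) (hQ : QU (tR (s 0)) (bR (s 0)) (L 0)) (h1 : ∑ i, L 0 i = 1)
    {U : Set (Fin 4 → ℝ)} (hU : U ∈ 𝓝 (L 0)) : ∀ᶠ k in atTop, Cn s y k ⊆ U := by
  obtain ⟨O, hOU, hO, hLO⟩ := mem_nhds_iff.1 hU
  suffices h : ∃ k, Cn s y k ⊆ O by
    obtain ⟨k, hk⟩ := h
    filter_upwards [eventually_ge_atTop k] with n hn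
    exact ((antitone_nat_of_succ_le (f := Cn s y) (Cn_anti s y)) hn).trans (hk.trans hOU)
  by_contra hn
  push Not at hn
  obtain ⟨w, w1, w2, w3⟩ := exists_orb s y (A := Oᶜ) hO.isClosed_compl fun k => by
    obtain ⟨x, hx, hx'⟩ := Set.not_subset.1 (hn k)
    exact ⟨x, hx, hx'⟩
  obtain ⟨c, hc⟩ := shrink hp hL hpos w1 (tendsto_zero hp hL hpos w1) hQ
  have : c = 1 := by
    rw [hc] at w3
    simpa [← Finset.mul_sum, h1] using w3
  rw [hc, this, one_smul] at w2
  exact w2 hLO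

end

section Concat
variable {X : Type*} [TopologicalSpace X]

theorem inf_concat {q : ℕ → X} {A : ℕ → Set X} {p : X} (hj : ∀ k, JoinedIn (A k) (q k) (q (k+1)))
    (hA : ∀ U ∈ 𝓝 p, ∀ᶠ k in atTop, A k ⊆ U) : JoinedIn ((⋃ k, A k) ∪ {p}) (q 0) p := by
  choose γ hγ using hj
  let f : ℝ → X := fun x => (γ ⌊x⌋₊).extend (x - ⌊x⌋₊)
  have hext : ∀ k x, (γ k).extend x ∈ A k := by
    intro k x
    have : (γ k).extend x ∈ Set.range (γ k) := by
      rw [← Path.extend_range]; exact ⟨x, rfl⟩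
    obtain ⟨u, hu⟩ := this
    rw [← hu]; exact hγ k u
  have hfA : ∀ x, f x ∈ A ⌊x⌋₊ := fun x => hext _ _
  have hfn : ∀ x n, ⌊x⌋₊ = n → f x = (γ n).extend (x - n) := by rintro x n rfl; rfl
  let S : ℕ → Set ℝ := fun n => {x | ((n:ℝ) ≤ x ∨ n = 0) ∧ x ≤ n + 1}
  have hfS : ∀ n, ∀ x ∈ S n, f x = (γ n).extend (x - n) := by
    rintro n x ⟨h1, h2⟩
    rcases h2.eq_or_lt with h2 | h2
    · have : ⌊x⌋₊ = n + 1 := by rw [h2]; exact_mod_cast Nat.floor_natCast (n+1)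
      rw [hfn x _ this, h2]
      push_cast
      rw [sub_self, add_sub_cancel_left, Path.extend_zero, Path.extend_one]
    · have : ⌊x⌋₊ = n := by
        rcases h1 with h1 | h1
        · exact (Nat.floor_eq_iff ((Nat.cast_nonneg n).trans h1)).2 ⟨h1, h2⟩
        · subst h1; exact Nat.floor_eq_zero.2 (by simpa using h2)
      exact hfn x n this
  have hfc : Continuous f := by
    refine LocallyFinite.continuous (f := S) ?_ ?_ ?_ ?_
    · intro x
      refine ⟨Set.Iio (x+1), Iio_mem_nhds (by linarith), ?_⟩
      refine (Set.finite_le_nat ⌈x+1⌉₊).subset ?_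
      rintro n ⟨z, ⟨h1, h2⟩, h3⟩
      rw [Set.mem_Iio] at h3
      rcases h1 with h1 | h1
      · exact_mod_cast (h1.trans h3.le).trans (Nat.le_ceil _)
      · simp [h1]
    · rw [Set.eq_univ_iff_forall]
      intro x
      rw [Set.mem_iUnion]
      refine ⟨⌊x⌋₊, ?_, (Nat.lt_floor_add_one x).le⟩
      rcases le_total 0 x with h | h
      · exact Or.inl (Nat.floor_le h)
      · exact Or.inr (Nat.floor_of_nonpos h)
    · intro n
      refine IsClosed.inter ?_ (isClosed_le continuous_id continuous_const)
      exact (isClosed_le continuous_const continuous_id).union isClosed_const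
    · intro n
      refine ContinuousOn.congr ?_ (hfS n)
      exact ((γ n).continuous_extend.comp (continuous_id.sub continuous_const)).continuousOn
  let g : ℝ → X := fun t => if t < 1 then f (t / (1 - t)) else p
  have hgc : Continuous g := by
    rw [continuous_iff_continuousAt]
    intro t
    rcases lt_trichotomy t 1 with h | h | h
    · have : g =ᶠ[𝓝 t] fun t => f (t / (1 - t)) := by
        filter_upwards [Iio_mem_nhds h] with u hu
        exact if_pos hu
      refine ContinuousAt.congr ?_ this.symm
      have h1 : ContinuousAt (fun t : ℝ => t / (1 - t)) t :=
        continuousAt_id.div (continuousAt_const.sub continuousAt_id) (by simpa using (sub_pos.2 h).ne')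
      exact ContinuousAt.comp (f := fun t : ℝ => t / (1 - t)) hfc.continuousAt h1
    · subst h
      have hg1 : g 1 = p := if_neg (lt_irrefl _)
      unfold ContinuousAt
      rw [hg1]
      intro U hU
      obtain ⟨K, hK⟩ := eventually_atTop.1 (hA U hU)
      have hlt : (K:ℝ) / (K+1) < 1 := by
        rw [div_lt_one (by positivity)]; linarith
      rw [mem_map]
      filter_upwards [Ioi_mem_nhds hlt] with t ht
      by_cases h : t < 1
      · have : g t = f (t / (1-t)) := if_pos h
        rw [Set.mem_preimage, this]
        refine hK _ ?_ (hfA _)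
        apply Nat.le_floor
        rw [Set.mem_Ioi, div_lt_iff₀ (by positivity)] at ht
        rw [le_div_iff₀ (by linarith)]
        nlinarith
      · have : g t = p := if_neg h
        rw [Set.mem_preimage, this]
        exact mem_of_mem_nhds hU
    · have : g =ᶠ[𝓝 t] fun t => p := by
        filter_upwards [Ioi_mem_nhds h] with u hu
        exact if_neg (not_lt.2 (le_of_lt hu))
      exact continuousAt_const.congr this.symm
  have hg0 : g 0 = q 0 := by simp [g, f]
  have hg1 : g 1 = p := if_neg (lt_irrefl _)
  refine ⟨⟨⟨fun t => g t, hgc.comp continuous_subtype_val⟩, by simpa using hg0, by simpa using hg1⟩, ?_⟩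
  intro t
  show g t ∈ _
  by_cases h : (t:ℝ) < 1
  · have : g t = f (t / (1-t)) := if_pos h
    rw [this]
    exact Or.inl (Set.mem_iUnion.2 ⟨_, hfA _⟩)
  · have : g t = p := if_neg h
    rw [this]; exact Or.inr rfl

end Concat

end IETPath

open MeasureTheory Filter Topology

namespace IETPath

/-- quasi-periodic extension -/
noncomputable def qext (F : ℝ → ℝ) (P v : ℝ) : ℝ := F (v - P * ⌊v / P⌋) + ⌊v / P⌋ * F P

theorem qext_eq {F : ℝ → ℝ} {P : ℝ} (hP : 0 < P) (h0 : F 0 = 0) (n : ℤ) {u : ℝ} (hu0 : 0 ≤ u) (hu1 : u ≤ P) :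
    qext F P (n * P + u) = n * F P + F u := by
  unfold qext
  rcases hu1.eq_or_lt with h | h
  · subst h
    have : ⌊(n * u + u) / u⌋ = n + 1 := by
      rw [show (n * u + u) / u = ((n + 1 : ℤ) : ℝ) by push_cast; field_simp]
      exact Int.floor_intCast _
    rw [this]; push_cast
    rw [show n * u + u - u * (n + 1) = 0 by ring, h0]; ring
  · have : ⌊(n * P + u) / P⌋ = n := by
      rw [Int.floor_eq_iff]
      constructor
      · rw [le_div_iff₀ hP]; linarith
      · rw [div_lt_iff₀ hP]; nlinarith
    rw [this, show n * P + u - P * n = u by ring]; ring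

theorem exists_rep {P : ℝ} (hP : 0 < P) (v : ℝ) : ∃ (n : ℤ) (u : ℝ), 0 ≤ u ∧ u < P ∧ v = n * P + u := by
  refine ⟨⌊v / P⌋, v - ⌊v / P⌋ * P, ?_, ?_, by ring⟩
  · have := Int.floor_le (v / P)
    rw [le_div_iff₀ hP] at this; linarith
  · have := Int.lt_floor_add_one (v / P)
    rw [div_lt_iff₀ hP] at this; linarith

theorem qext_mono {F : ℝ → ℝ} {P : ℝ} (hP : 0 < P) (h0 : F 0 = 0) (hm : Monotone F) : Monotone (qext F P) := by
  intro v v' h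
  obtain ⟨n, u, u0, u1, rfl⟩ := exists_rep hP v
  obtain ⟨n', u', u0', u1', rfl⟩ := exists_rep hP v'
  rw [qext_eq hP h0 n u0 u1.le, qext_eq hP h0 n' u0' u1'.le]
  have hn : n ≤ n' := by
    by_contra hn
    push Not at hn
    have : (n':ℝ) + 1 ≤ n := by exact_mod_cast hn
    nlinarith
  have hFP : 0 ≤ F P := by rw [← h0]; exact hm hP.le
  rcases hn.eq_or_lt with h1 | h1
  · subst h1
    have : u ≤ u' := by linarith
    linarith [hm this]
  · have : (n:ℝ) + 1 ≤ n' := by exact_mod_cast h1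
    have h2 := hm u1.le
    have h3 := hm u0'
    rw [h0] at h3
    nlinarith

theorem lin_of_quasi {H : ℝ → ℝ} (hm : Monotone H) (h0 : H 0 = 0) {P Y : ℝ} (hP : 0 < P) (hirr : Irrational (Y / P))
    (h1 : ∀ v, H (v + P) = H v + H P) (h2 : ∀ v, H (v + Y) = H v + H Y) : ∀ v, H v = H P / P * v := by
  set c := H P / P with hc
  have hcP : c * P = H P := by rw [hc]; field_simp
  have hc0 : 0 ≤ c := div_nonneg (by rw [← h0]; exact hm hP.le) hP.le
  -- the set of good quasi-periods
  have nP : ∀ n : ℕ, ∀ v, H (v + n * P) = H v + n * H P := by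
    intro n; induction n with
    | zero => intro v; simp
    | succ n ih => intro v; push_cast; rw [show v + (n + 1) * P = (v + n * P) + P by ring, h1, ih]; ring
  have nY : ∀ n : ℕ, ∀ v, H (v + n * Y) = H v + n * H Y := by
    intro n; induction n with
    | zero => intro v; simp
    | succ n ih => intro v; push_cast; rw [show v + (n + 1) * Y = (v + n * Y) + Y by ring, h2, ih]; ring
  have zP : ∀ (n : ℤ) v, H (v + n * P) = H v + n * H P := by
    intro n v
    obtain ⟨k, rfl | rfl⟩ := n.eq_nat_or_neg
    · exact_mod_cast nP k v
    · have := nP k (v + (-(k:ℤ) : ℤ) * P)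
      push_cast at this ⊢
      rw [show v + -(k:ℝ) * P + k * P = v by ring] at this
      linarith
  have bd : ∀ v, |H v - c * v| ≤ H P := by
    intro v
    obtain ⟨n, u, u0, u1, rfl⟩ := exists_rep hP v
    rw [add_comm, zP]
    have a1 := hm u0; have a2 := hm u1.le
    rw [h0] at a1
    rw [show H u + n * H P - c * (u + n * P) = H u - c * u by rw [← hcP]; ring]
    have b1 : 0 ≤ c * u := mul_nonneg hc0 u0
    have b2 : c * u ≤ c * P := mul_le_mul_of_nonneg_left u1.le hc0
    rw [abs_le]
    constructor <;> linarith
  have hY : H Y = c * Y := by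
    by_contra hne
    have hpos : 0 < |H Y - c * Y| := abs_pos.2 (sub_ne_zero.2 hne)
    obtain ⟨n, hn⟩ := exists_nat_gt (H P / |H Y - c * Y|)
    rw [div_lt_iff₀ hpos] at hn
    have := bd (0 + n * Y)
    rw [nY, h0, show 0 + n * H Y - c * (0 + n * Y) = n * (H Y - c * Y) by ring, abs_mul, Nat.abs_cast] at this
    linarith
  let S : AddSubgroup ℝ := 
    { carrier := {g | ∀ v, H (v + g) = H v + c * g}
      zero_mem' := by intro v; simp
      add_mem' := by
        intro a b ha hb v
        rw [← add_assoc, hb, ha]; ring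
      neg_mem' := by
        intro a ha v
        have := ha (v + -a)
        rw [neg_add_cancel_right] at this
        linarith }
  have hS : AddSubgroup.closure {Y, P} ≤ S := by
    rw [AddSubgroup.closure_le]
    rintro g (rfl | rfl)
    · intro v; rw [h2, hY]
    · intro v; rw [h1, ← hcP]
  have hd : Dense (S : Set ℝ) := (dense_addSubgroupClosure_pair_iff.2 hirr).mono hS
  intro v
  apply le_antisymm
  · refine le_of_forall_pos_le_add fun ε hε => ?_
    obtain ⟨g, hg, hg1, hg2⟩ := hd.exists_between (show v < v + ε / (c + 1) by have : 0 < ε / (c+1) := by positivity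
                                                                               linarith)
    have e := hg 0
    rw [zero_add, h0, zero_add] at e
    have := hm hg1.le
    rw [e] at this
    have h3 : c * g ≤ c * (v + ε / (c+1)) := mul_le_mul_of_nonneg_left hg2.le hc0
    have h4 : c * (ε / (c+1)) ≤ ε := by
      rw [mul_div_assoc', div_le_iff₀ (by linarith)]; nlinarith
    nlinarith
  · refine le_of_forall_pos_le_add fun ε hε => ?_
    obtain ⟨g, hg, hg1, hg2⟩ := hd.exists_between (show v - ε / (c + 1) < v by have : 0 < ε / (c+1) := by positivity
                                                                               linarith)
    have e := hg 0
    rw [zero_add, h0, zero_add] at e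
    have := hm hg2.le
    rw [e] at this
    have h3 : c * (v - ε / (c+1)) ≤ c * g := mul_le_mul_of_nonneg_left hg1.le hc0
    have h4 : c * (ε / (c+1)) ≤ ε := by
      rw [mul_div_assoc', div_le_iff₀ (by linarith)]; nlinarith
    nlinarith

/-- incommensurable positive numbers -/
def IrrP (x y : ℝ) : Prop := 0 < x ∧ 0 < y ∧ Irrational (x / y)

theorem IrrP.symm {x y} (h : IrrP x y) : IrrP y x :=
  ⟨h.2.1, h.1, by have := h.2.2.inv; rwa [inv_div] at this⟩

theorem IrrP.add_right {x y} (h : IrrP x y) : IrrP x (x + y) := by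
  refine ⟨h.1, add_pos h.1 h.2.1, ?_⟩
  rw [← inv_div, irrational_inv_iff]
  have hx := h.1.ne'
  rw [show (x + y) / x = (1:ℕ) + y / x by push_cast; field_simp]
  exact h.symm.2.2.natCast_add 1

theorem IrrP.add_left {x y} (h : IrrP x y) : IrrP (x + y) y := by
  rw [add_comm]; exact h.symm.add_right.symm

theorem IrrP.sub_right {x y} (h : IrrP x y) (hxy : x < y) : IrrP x (y - x) := by
  refine ⟨h.1, by linarith, ?_⟩
  rw [← inv_div, irrational_inv_iff]
  have hx := h.1.ne'
  rw [show (y - x) / x = y / x - (1:ℕ) by push_cast; field_simp]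
  exact h.symm.2.2.sub_natCast 1

theorem IrrP.sub_left {x y} (h : IrrP x y) (hxy : y < x) : IrrP (x - y) y :=
  (h.symm.sub_right hxy).symm

theorem IrrP.ne {x y} (h : IrrP x y) : x ≠ y := by
  rintro rfl
  have := h.2.2
  rw [div_self h.1.ne'] at this
  exact this ⟨1, by simp⟩

theorem twoIET {F : ℝ → ℝ} {X Y : ℝ} (hm : Monotone F) (h0 : F 0 = 0) (hXY : IrrP X Y)
    (h1 : ∀ u, 0 ≤ u → u ≤ X → F (Y + u) = F Y + F u)
    (h2 : ∀ u, 0 ≤ u → u ≤ Y → F (X + u) = F X + F u) :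
    ∃ c, ∀ v, 0 ≤ v → v ≤ X + Y → F v = c * v := by
  have hX := hXY.1; have hY := hXY.2.1
  have hP : 0 < X + Y := by linarith
  set P := X + Y with hPd
  have key := lin_of_quasi (qext_mono hP h0 hm) (P := P) (Y := Y)
    (by have := qext_eq (F := F) hP h0 0 le_rfl hP.le; simpa [h0] using this) hP hXY.add_left.symm.2.2
  have e0 : ∀ u, 0 ≤ u → u ≤ P → qext F P u = F u := by
    intro u a b
    have := qext_eq (F := F) hP h0 0 a b
    simpa using this
  have hFP : F P = F X + F Y := by rw [hPd]; exact h2 Y hY.le le_rfl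
  have kk := key (by
      intro v
      obtain ⟨n, u, u0, u1, rfl⟩ := exists_rep hP v
      rw [qext_eq hP h0 n u0 u1.le, e0 P hP.le le_rfl,
        show (n:ℝ) * P + u + P = ((n + 1 : ℤ) : ℝ) * P + u by push_cast; ring, qext_eq hP h0 _ u0 u1.le]
      push_cast; ring) (by
      intro v
      obtain ⟨n, u, u0, u1, rfl⟩ := exists_rep hP v
      rw [qext_eq hP h0 n u0 u1.le, e0 Y hY.le (by linarith)]
      rcases le_total u X with h | h
      · rw [show (n:ℝ) * P + u + Y = n * P + (Y + u) by ring, qext_eq hP h0 n (by linarith) (by linarith), h1 u u0 h]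
        ring
      · rw [show (n:ℝ) * P + u + Y = ((n + 1 : ℤ) : ℝ) * P + (u - X) by push_cast; rw [hPd]; ring,
          qext_eq hP h0 _ (by linarith) (by linarith)]
        have := h2 (u - X) (by linarith) (by linarith)
        rw [add_sub_cancel] at this
        push_cast
        rw [this, hFP]; ring)
  refine ⟨qext F P P / P, fun v a b => ?_⟩
  rw [← e0 v a b]; exact kk v

end IETPath

open MeasureTheory Filter Topology

namespace IETPath

def ed (i j : Fin 4) (x y : ℝ) : Fin 4 → ℝ :=
  fun n => (if n = i then x else 0) + (if n = j then y else 0)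

def f3 (i j k : Fin 4) (x y z : ℝ) : Fin 4 → ℝ :=
  fun n => (if n = i then x else 0) + (if n = j then y else 0) + (if n = k then z else 0)

def Wt (t b : Fin 4 → Fin 4) : Set (Fin 4 → ℝ) :=
  {L | (∀ i, 0 ≤ L i) ∧ 0 < ∑ i, L i ∧ PU t b L}

theorem Wt_symm (t b) : Wt t b = Wt b t := by
  ext L; exact ⟨fun h => ⟨h.1, h.2.1, h.2.2.symm⟩, fun h => ⟨h.1, h.2.1, h.2.2.symm⟩⟩

theorem W_eq (s) : W s = Wt (tR s) (bR s) := rfl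

theorem ed_comm (i j x y) : ed i j x y = ed j i y x := by
  funext n; simp only [ed]; ring

theorem f3_x (i j k y z) : f3 i j k 0 y z = ed j k y z := by
  funext n; simp [f3, ed]
theorem f3_y (i j k x z) : f3 i j k x 0 z = ed i k x z := by
  funext n; simp [f3, ed]
theorem f3_z (i j k x y) : f3 i j k x y 0 = ed i j x y := by
  funext n; simp [f3, ed]

theorem sum_f3 (i j k x y z) : ∑ n, f3 i j k x y z n = x + y + z := by
  simp [f3, Finset.sum_add_distrib]

theorem f3_nonneg {i j k x y z} (hx : 0 ≤ x) (hy : 0 ≤ y) (hz : 0 ≤ z) (n) : 0 ≤ f3 i j k x y z n := by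
  unfold f3; positivity

theorem continuous_f3 (i j k : Fin 4) {f g h : ℝ → ℝ} (hf : Continuous f) (hg : Continuous g) (hh : Continuous h) :
    Continuous (fun u => f3 i j k (f u) (g u) (h u)) := by
  refine continuous_pi fun n => ?_
  unfold f3
  split_ifs <;> fun_prop

theorem rp_f3 (r : Fin 4 → Fin 4) (i j k x y z n) : rp r (f3 i j k x y z) n =
    (if r i < r n then x else 0) + (if r j < r n then y else 0) + (if r k < r n then z else 0) := by
  unfold rp f3
  have : ∀ m, (if r m < r n then (if m = i then x else 0) + (if m = j then y else 0) + (if m = k then z else 0) else 0)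
    = (if m = i then (if r i < r n then x else 0) else 0) + (if m = j then (if r j < r n then y else 0) else 0)
      + (if m = k then (if r k < r n then z else 0) else 0) := by
    intro m
    by_cases h1 : m = i <;> by_cases h2 : m = j <;> by_cases h3 : m = k <;> simp_all <;> split_ifs <;> simp_all
  rw [Finset.sum_congr rfl fun m _ => this m]
  simp [Finset.sum_add_distrib]

/-- letters in a strict order -/
def Ord (r : Fin 4 → Fin 4) (i j k : Fin 4) : Prop := r i < r j ∧ r j < r k

theorem Ord.rp1 {r i j k} (h : Ord r i j k) (x y z) : rp r (f3 i j k x y z) i = 0 := by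
  rw [rp_f3, if_neg (lt_irrefl _), if_neg h.1.not_gt, if_neg (h.1.trans h.2).not_gt]; simp
theorem Ord.rp2 {r i j k} (h : Ord r i j k) (x y z) : rp r (f3 i j k x y z) j = x := by
  rw [rp_f3, if_neg (lt_irrefl _), if_pos h.1, if_neg h.2.not_gt]; simp
theorem Ord.rp3 {r i j k} (h : Ord r i j k) (x y z) : rp r (f3 i j k x y z) k = x + y := by
  rw [rp_f3, if_neg (lt_irrefl _), if_pos (h.1.trans h.2), if_pos h.2]; simp
theorem Ord.ne {r i j k} (h : Ord r i j k) : i ≠ j ∧ j ≠ k ∧ i ≠ k := by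
  refine ⟨?_, ?_, ?_⟩ <;> rintro rfl
  · exact lt_irrefl _ h.1
  · exact lt_irrefl _ h.2
  · exact lt_irrefl _ (h.1.trans h.2)
theorem Ord.v1 {r i j k} (h : Ord r i j k) (x y z) : f3 i j k x y z i = x := by
  simp [f3, h.ne.1, h.ne.2.2]
theorem Ord.v2 {r i j k} (h : Ord r i j k) (x y z) : f3 i j k x y z j = y := by
  simp [f3, h.ne.1.symm, h.ne.2.1]
theorem Ord.v3 {r i j k} (h : Ord r i j k) (x y z) : f3 i j k x y z k = z := by
  simp [f3, h.ne.2.1.symm, h.ne.2.2.symm]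

theorem f3_perm1 (i j k x y z) : f3 i j k x y z = f3 k j i z y x := by
  funext n; simp only [f3]; ring
theorem f3_perm2 (i j k x y z) : f3 i j k x y z = f3 j k i y z x := by
  funext n; simp only [f3]; ring
theorem f3_perm3 (i j k x y z) : f3 i j k x y z = f3 k i j z x y := by
  funext n; simp only [f3]; ring
theorem f3_perm4 (i j k x y z) : f3 i j k x y z = f3 i k j x z y := by
  funext n; simp only [f3]; ring
theorem f3_perm5 (i j k x y z) : f3 i j k x y z = f3 j i k y x z := by
  funext n; simp only [f3]; ring

section
variable {t b : Fin 4 → Fin 4} {i j k : Fin 4} {x y z : ℝ}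

theorem PU321 (ht : Ord t i j k) (hb : Ord b k j i) (hx : 0 ≤ x) (hy : 0 ≤ y) (hz : 0 ≤ z)
    (h : IrrP (x + y) (y + z)) : PU t b (f3 i j k x y z) := by
  intro F hm h0 hE
  have e1 := fun (u : ℝ) (a : 0 ≤ u) (b' : u ≤ x) => hE i u a (b'.trans_eq (ht.v1 x y z).symm)
  have e2 := fun (u : ℝ) (a : 0 ≤ u) (b' : u ≤ y) => hE j u a (b'.trans_eq (ht.v2 x y z).symm)
  have e3 := fun (u : ℝ) (a : 0 ≤ u) (b' : u ≤ z) => hE k u a (b'.trans_eq (ht.v3 x y z).symm)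
  have b1 : rp b (f3 i j k x y z) i = z + y := by rw [f3_perm1]; exact hb.rp3 _ _ _
  have b2 : rp b (f3 i j k x y z) j = z := by rw [f3_perm1]; exact hb.rp2 _ _ _
  have b3 : rp b (f3 i j k x y z) k = 0 := by rw [f3_perm1]; exact hb.rp1 _ _ _
  simp only [ht.rp1, ht.rp2, ht.rp3, b1, b2, b3, zero_add, h0, sub_zero] at e1 e2 e3
  have hz' : F (x + y + z) = F (x + y) + F z := by have := e3 z hz le_rfl; linarith
  have hx' : F (x + y + z) = F (z + y) + F x := by
    have := e1 x hx le_rfl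
    rw [show z + y + x = x + y + z by ring] at this; linarith
  have eA : ∀ v, 0 ≤ v → v ≤ y → ext (x + y + z) y x F (x + y + z + v) = F (x + y + z) + (F (x + v) - F x) :=
    fun v a b => ext_add F a b
  have eB : ∀ v, v ≤ x + y + z → ext (x + y + z) y x F v = F v := fun v a => ext_le F a
  obtain ⟨c, hc⟩ := twoIET (F := ext (x + y + z) y x F) (ext_mono hm) (by rw [eB _ (by positivity), h0]) h
    (by
      intro u a b
      rw [eB (y + z) (by linarith), eB u (by linarith)]
      rcases le_total u x with h | h
      · rw [eB _ (by linarith), e1 u a h, add_comm y z]; ring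
      · have := eA (u - x) (by linarith) (by linarith)
        rw [show x + y + z + (u - x) = y + z + u by ring, add_sub_cancel] at this
        rw [this, hx', add_comm y z]; ring)
    (by
      intro u a b
      rw [eB (x + y) (by linarith), eB u (by linarith)]
      rcases le_total u z with h | h
      · rw [eB _ (by linarith)]; have := e3 u a h; linarith
      · have := eA (u - z) (by linarith) (by linarith)
        rw [e2 (u - z) (by linarith) (by linarith), show x + y + z + (u - z) = x + y + u by ring, add_sub_cancel] at this
        rw [this, hz']; ring)
  refine ⟨c, fun v a b => ?_⟩
  rw [sum_f3] at b
  rw [← hc v a (by linarith), eB v b]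

theorem PU231 (ht : Ord t i j k) (hb : Ord b j k i) (hx : 0 ≤ x) (hy : 0 ≤ y) (hz : 0 ≤ z)
    (h : IrrP x (y + z)) : PU t b (f3 i j k x y z) := by
  intro F hm h0 hE
  have e1 := fun (u : ℝ) (a : 0 ≤ u) (b' : u ≤ x) => hE i u a (b'.trans_eq (ht.v1 x y z).symm)
  have e2 := fun (u : ℝ) (a : 0 ≤ u) (b' : u ≤ y) => hE j u a (b'.trans_eq (ht.v2 x y z).symm)
  have e3 := fun (u : ℝ) (a : 0 ≤ u) (b' : u ≤ z) => hE k u a (b'.trans_eq (ht.v3 x y z).symm)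
  have b1 : rp b (f3 i j k x y z) i = y + z := by rw [f3_perm2]; exact hb.rp3 _ _ _
  have b2 : rp b (f3 i j k x y z) j = 0 := by rw [f3_perm2]; exact hb.rp1 _ _ _
  have b3 : rp b (f3 i j k x y z) k = y := by rw [f3_perm2]; exact hb.rp2 _ _ _
  simp only [ht.rp1, ht.rp2, ht.rp3, b1, b2, b3, zero_add, h0, sub_zero] at e1 e2 e3
  obtain ⟨c, hc⟩ := twoIET hm h0 h
    (by intro u a b; linarith [e1 u a b])
    (by
      intro u a b
      rcases le_total u y with h | h
      · linarith [e2 u a h]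
      · have h1 := e3 (u - y) (by linarith) (by linarith)
        have h2 := e2 y hy le_rfl
        rw [show x + y + (u - y) = x + u by ring, add_sub_cancel] at h1
        linarith)
  refine ⟨c, fun v a b => ?_⟩
  rw [sum_f3] at b
  exact hc v a (by linarith)

theorem PU312 (ht : Ord t i j k) (hb : Ord b k i j) (hx : 0 ≤ x) (hy : 0 ≤ y) (hz : 0 ≤ z)
    (h : IrrP (x + y) z) : PU t b (f3 i j k x y z) := by
  have := (PU231 (x := z) (y := x) (z := y) hb ht hz hx hy h.symm).symm
  rwa [← f3_perm3] at this

theorem joined_line {S : Set (Fin 4 → ℝ)} {f : ℝ → Fin 4 → ℝ} (hf : Continuous f) {a b : ℝ} (hab : a ≤ b)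
    (h : ∀ u, a ≤ u → u ≤ b → f u ∈ S) : JoinedIn S (f a) (f b) := by
  refine JoinedIn.ofLine (f := fun v => f (a + v * (b - a))) (by fun_prop) (by simp) (by simp) ?_
  rintro _ ⟨v, ⟨h0, h1⟩, rfl⟩
  exact h _ (by nlinarith) (by nlinarith)

theorem J321 (ht : Ord t i j k) (hb : Ord b k j i) (hx : 0 ≤ x) (hy : 0 ≤ y) (hz : 0 ≤ z)
    (h : IrrP (x + y) (y + z)) : JoinedIn (Wt t b) (f3 i j k x y z) (ed i k (x + y) (y + z)) := by
  have := joined_line (S := Wt t b) (f := fun u => f3 i j k (x + y - u) u (y + z - u))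
    (continuous_f3 _ _ _ (by fun_prop) (by fun_prop) (by fun_prop)) hy (fun u a b => by
      refine ⟨f3_nonneg (by linarith) a (by linarith), ?_, ?_⟩
      · rw [sum_f3]; linarith [h.1]
      · exact PU321 ht hb (by linarith) a (by linarith) (by simpa using h))
  simp only [sub_zero, add_sub_cancel_right, add_sub_cancel_left, f3_y] at this
  exact this.symm

theorem J231 (ht : Ord t i j k) (hb : Ord b j k i) (hx : 0 ≤ x) (hy : 0 ≤ y) (hz : 0 ≤ z)
    (h : IrrP x (y + z)) : JoinedIn (Wt t b) (f3 i j k x y z) (ed i k x (y + z)) := by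
  have := joined_line (S := Wt t b) (f := fun u => f3 i j k x u (y + z - u))
    (continuous_f3 _ _ _ (by fun_prop) (by fun_prop) (by fun_prop)) hy (fun u a b => by
      refine ⟨f3_nonneg (by linarith) a (by linarith), ?_, ?_⟩
      · rw [sum_f3]; linarith [h.1]
      · exact PU231 ht hb (by linarith) a (by linarith) (by simpa using h))
  simp only [sub_zero, add_sub_cancel_left, f3_y] at this
  exact this.symm

theorem J312 (ht : Ord t i j k) (hb : Ord b k i j) (hx : 0 ≤ x) (hy : 0 ≤ y) (hz : 0 ≤ z)
    (h : IrrP (x + y) z) : JoinedIn (Wt t b) (f3 i j k x y z) (ed i k (x + y) z) := by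
  have := joined_line (S := Wt t b) (f := fun u => f3 i j k (x + y - u) u z)
    (continuous_f3 _ _ _ (by fun_prop) (by fun_prop) (by fun_prop)) hy (fun u a b => by
      refine ⟨f3_nonneg (by linarith) a (by linarith), ?_, ?_⟩
      · rw [sum_f3]; linarith [h.1]
      · exact PU312 ht hb (by linarith) a (by linarith) (by simpa using h))
  simp only [sub_zero, add_sub_cancel_right, f3_y] at this
  exact this.symm

/-- negative criterion: rational displacements -/
theorem not_QU_rat {L : Fin 4 → ℝ} {d : ℝ} (hd : 0 < d) (hdS : d ≤ ∑ n, L n)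
    (h : ∀ n, L n = 0 ∨ ∃ p : ℤ, rp t L n = rp b L n + p * d) : ¬ QU t b L := by
  intro hQ
  let F : ℝ → ℝ := fun u => u + d / (2 * Real.pi) * Real.sin (2 * Real.pi / d * u)
  have hpi := Real.pi_pos
  obtain ⟨c, hc⟩ := hQ F (by
      intro u v huv
      have h1 : |Real.sin (2 * Real.pi / d * v) - Real.sin (2 * Real.pi / d * u)|
          ≤ |2 * Real.pi / d * v - 2 * Real.pi / d * u| := by
        have := Real.lipschitzWith_sin.dist_le_mul (2 * Real.pi / d * v) (2 * Real.pi / d * u)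
        simpa [Real.dist_eq] using this
      have h2 : 2 * Real.pi / d * v - 2 * Real.pi / d * u = 2 * Real.pi / d * (v - u) := by ring
      rw [h2, abs_of_nonneg (a := 2 * Real.pi / d * (v - u)) (mul_nonneg (by positivity) (by linarith))] at h1
      have h3 := (abs_le.1 h1).1
      have h4 : d / (2 * Real.pi) * (2 * Real.pi / d * (v - u)) = v - u := by field_simp
      have h5 := mul_le_mul_of_nonneg_left h3 (show 0 ≤ d / (2 * Real.pi) by positivity)
      simp only [F]
      nlinarith) (by simp only [F]; fun_prop) (by simp [F]) (by
      intro n v v0 v1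
      rcases h n with h | ⟨p, h⟩
      · rw [h] at v1
        have : v = 0 := le_antisymm v1 v0
        subst this; simp
      · simp only [F, h]
        have : ∀ u, Real.sin (2 * Real.pi / d * (u + p * d)) = Real.sin (2 * Real.pi / d * u) := by
          intro u
          rw [show 2 * Real.pi / d * (u + p * d) = 2 * Real.pi / d * u + p * (2 * Real.pi) by field_simp]
          exact Real.sin_add_int_mul_two_pi _ _
        rw [show rp b L n + p * d + v = (rp b L n + v) + p * d by ring, this, this]
        ring)
  have h1 := hc d hd.le hdS
  have h2 := hc (d / 4) (by positivity) (by linarith)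
  simp only [F] at h1 h2
  rw [show 2 * Real.pi / d * d = 2 * Real.pi by field_simp, Real.sin_two_pi] at h1
  rw [show 2 * Real.pi / d * (d / 4) = Real.pi / 2 by field_simp; norm_num, Real.sin_pi_div_two] at h2
  have : 0 < d / (2 * Real.pi) := by positivity
  have hc1 : c = 1 := by
    have : (c - 1) * d = 0 := by linarith
    rcases mul_eq_zero.1 this with h | h
    · linarith
    · exact absurd h hd.ne'
  rw [hc1] at h2
  linarith

/-- negative criterion: reducible -/
theorem not_QU_kink {L : Fin 4 → ℝ} {e : ℝ} (he : 0 < e) (heS : e < ∑ n, L n)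
    (h : ∀ n, L n = 0 ∨ (rp t L n + L n ≤ e ∧ rp b L n + L n ≤ e) ∨ (e ≤ rp t L n ∧ e ≤ rp b L n)) :
    ¬ QU t b L := by
  intro hQ
  let F : ℝ → ℝ := fun u => u + max (u - e) 0
  obtain ⟨c, hc⟩ := hQ F (fun u v huv => by simp only [F]; gcongr) (by simp only [F]; fun_prop)
    (by simp [F, he.le]) (by
      intro n v v0 v1
      simp only [F]
      rcases h n with h | h | h
      · rw [h] at v1
        have : v = 0 := le_antisymm v1 v0
        subst this; simp
      · rw [max_eq_right (by linarith), max_eq_right (by linarith), max_eq_right (by linarith), max_eq_right (by linarith)]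
        ring
      · rw [max_eq_left (by linarith), max_eq_left (by linarith), max_eq_left (by linarith), max_eq_left (by linarith)]
        ring)
  have h1 := hc e he.le heS.le
  have h2 := hc (∑ n, L n) (by linarith) le_rfl
  simp only [F] at h1 h2
  rw [max_eq_left (by linarith)] at h2
  rw [sub_self, max_self] at h1
  have hc1 : c = 1 := by
    have : (c - 1) * e = 0 := by linarith
    rcases mul_eq_zero.1 this with h | h
    · linarith
    · exact absurd h he.ne'
  rw [hc1] at h2
  linarith

theorem commens {X Y S : ℝ} (hX : 0 ≤ X) (hY : 0 ≤ Y) (hS : 0 < S) (h1 : X ≤ S) (h2 : Y ≤ S) (h : ¬ IrrP X Y) :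
    ∃ d, 0 < d ∧ d ≤ S ∧ ∃ p q : ℤ, X = p * d ∧ Y = q * d := by
  rcases hX.eq_or_lt with hX | hX
  · rcases hY.eq_or_lt with hY | hY
    · exact ⟨S, hS, le_rfl, 0, 0, by simp [← hX], by simp [← hY]⟩
    · exact ⟨Y, hY, h2, 0, 1, by simp [← hX], by simp⟩
  rcases hY.eq_or_lt with hY | hY
  · exact ⟨X, hX, h1, 1, 0, by simp, by simp [← hY]⟩
  have : ¬ Irrational (X / Y) := fun h' => h ⟨hX, hY, h'⟩
  unfold Irrational at this
  rw [not_not] at this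
  obtain ⟨q, hq⟩ := this
  have hden : (0:ℝ) < q.den := by exact_mod_cast q.den_pos
  have hden1 : (1:ℝ) ≤ q.den := by exact_mod_cast q.den_pos
  refine ⟨Y / q.den, by positivity, (div_le_self hY.le hden1).trans h2, q.num, q.den, ?_, ?_⟩
  · have hq' : X = q * Y := by rw [hq]; field_simp
    rw [hq']
    have : (q:ℝ) = q.num / q.den := by exact_mod_cast (Rat.num_div_den q).symm
    rw [this]; field_simp
  · push_cast; field_simp

end
end IETPath

open MeasureTheory Filter Topology

namespace IETPath

/-- irrational points on the edges -/
def Edg (t b : Fin 4 → Fin 4) : Set (Fin 4 → ℝ) :=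
  {v | ∃ i j x y, t i < t j ∧ b j < b i ∧ IrrP x y ∧ v = ed i j x y}

theorem Edg_symm (t b) : Edg t b = Edg b t := by
  have : ∀ t b, Edg t b ⊆ Edg b t := by
    rintro t b v ⟨i, j, x, y, h1, h2, h3, rfl⟩
    exact ⟨j, i, y, x, h2, h1, h3.symm, ed_comm _ _ _ _⟩
  exact Set.Subset.antisymm (this _ _) (this _ _)

theorem f3_cases (i j k x y z n) : n = i ∨ n = j ∨ n = k ∨ f3 i j k x y z n = 0 := by
  by_cases h1 : n = i
  · exact Or.inl h1
  by_cases h2 : n = j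
  · exact Or.inr (Or.inl h2)
  by_cases h3 : n = k
  · exact Or.inr (Or.inr (Or.inl h3))
  · right; right; right; simp [f3, h1, h2, h3]

section
variable {t b : Fin 4 → Fin 4} {i j k : Fin 4} {x y z : ℝ}

theorem Edg_sub : Edg t b ⊆ Wt t b := by
  rintro v ⟨i, j, x, y, h1, h2, h3, rfl⟩
  have hij : i ≠ j := by rintro rfl; exact lt_irrefl _ h1
  have e : ed i j x y = f3 i j j x y 0 := (f3_z _ _ _ _ _).symm
  have t1 : rp t (ed i j x y) i = 0 := by rw [e, rp_f3]; simp [h1.not_gt]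
  have t2 : rp t (ed i j x y) j = x := by rw [e, rp_f3]; simp [h1]
  have b1 : rp b (ed i j x y) i = y := by rw [e, rp_f3]; simp [h2]
  have b2 : rp b (ed i j x y) j = 0 := by rw [e, rp_f3]; simp [h2.not_gt]
  have v1 : ed i j x y i = x := by simp [ed, hij]
  have v2 : ed i j x y j = y := by simp [ed, hij.symm]
  have sm : ∑ n, ed i j x y n = x + y := by rw [e, sum_f3]; ring
  refine ⟨by rw [e]; exact f3_nonneg h3.1.le h3.2.1.le le_rfl, by rw [sm]; linarith [h3.1, h3.2.1], ?_⟩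
  intro F hm h0 hE
  have e1 := fun (u : ℝ) (a : 0 ≤ u) (b' : u ≤ x) => hE i u a (b'.trans_eq v1.symm)
  have e2 := fun (u : ℝ) (a : 0 ≤ u) (b' : u ≤ y) => hE j u a (b'.trans_eq v2.symm)
  simp only [t1, t2, b1, b2, zero_add, h0, sub_zero] at e1 e2
  obtain ⟨c, hc⟩ := twoIET hm h0 h3 (fun u a b => by linarith [e1 u a b]) (fun u a b => by linarith [e2 u a b])
  exact ⟨c, fun v a b => hc v a (by rwa [sm] at b)⟩

theorem F321 (ht : Ord t i j k) (hb : Ord b k j i) (hx : 0 ≤ x) (hy : 0 ≤ y) (hz : 0 ≤ z) (hS : 0 < x + y + z)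
    (hQ : QU t b (f3 i j k x y z)) : ∃ p ∈ Edg t b, JoinedIn (Wt t b) (f3 i j k x y z) p := by
  by_cases h : IrrP (x + y) (y + z)
  · exact ⟨_, ⟨i, k, _, _, ht.1.trans ht.2, hb.1.trans hb.2, h, rfl⟩, J321 ht hb hx hy hz h⟩
  · exfalso
    obtain ⟨d, hd, hdS, p, q, hp, hq⟩ := commens (by linarith) (by linarith) hS (by linarith) (by linarith) h
    refine not_QU_rat hd (by rwa [sum_f3]) (fun n => ?_) hQ
    have b1 : rp b (f3 i j k x y z) i = z + y := by rw [f3_perm1]; exact hb.rp3 _ _ _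
    have b2 : rp b (f3 i j k x y z) j = z := by rw [f3_perm1]; exact hb.rp2 _ _ _
    have b3 : rp b (f3 i j k x y z) k = 0 := by rw [f3_perm1]; exact hb.rp1 _ _ _
    rcases f3_cases i j k x y z n with rfl | rfl | rfl | h
    · right; refine ⟨-q, ?_⟩; rw [ht.rp1, b1]; push_cast; linarith
    · right; refine ⟨p - q, ?_⟩; rw [ht.rp2, b2]; push_cast; linarith
    · right; refine ⟨p, ?_⟩; rw [ht.rp3, b3]; linarith
    · exact Or.inl h

theorem F231 (ht : Ord t i j k) (hb : Ord b j k i) (hx : 0 ≤ x) (hy : 0 ≤ y) (hz : 0 ≤ z) (hS : 0 < x + y + z)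
    (hQ : QU t b (f3 i j k x y z)) : ∃ p ∈ Edg t b, JoinedIn (Wt t b) (f3 i j k x y z) p := by
  by_cases h : IrrP x (y + z)
  · exact ⟨_, ⟨i, k, _, _, ht.1.trans ht.2, hb.2, h, rfl⟩, J231 ht hb hx hy hz h⟩
  · exfalso
    obtain ⟨d, hd, hdS, p, q, hp, hq⟩ := commens (by linarith) (by linarith) hS (by linarith) (by linarith) h
    refine not_QU_rat hd (by rwa [sum_f3]) (fun n => ?_) hQ
    have b1 : rp b (f3 i j k x y z) i = y + z := by rw [f3_perm2]; exact hb.rp3 _ _ _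
    have b2 : rp b (f3 i j k x y z) j = 0 := by rw [f3_perm2]; exact hb.rp1 _ _ _
    have b3 : rp b (f3 i j k x y z) k = y := by rw [f3_perm2]; exact hb.rp2 _ _ _
    rcases f3_cases i j k x y z n with rfl | rfl | rfl | h
    · right; refine ⟨-q, ?_⟩; rw [ht.rp1, b1]; push_cast; linarith
    · right; refine ⟨p, ?_⟩; rw [ht.rp2, b2]; linarith
    · right; refine ⟨p, ?_⟩; rw [ht.rp3, b3]; linarith
    · exact Or.inl h

theorem F312 (ht : Ord t i j k) (hb : Ord b k i j) (hx : 0 ≤ x) (hy : 0 ≤ y) (hz : 0 ≤ z) (hS : 0 < x + y + z)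
    (hQ : QU t b (f3 i j k x y z)) : ∃ p ∈ Edg t b, JoinedIn (Wt t b) (f3 i j k x y z) p := by
  rw [f3_perm3] at hQ ⊢
  rw [Edg_symm, Wt_symm]
  exact F231 hb ht hz hx hy (by linarith) hQ.symm

theorem F132 (ht : Ord t i j k) (hb : Ord b i k j) (hx : 0 ≤ x) (hy : 0 ≤ y) (hz : 0 ≤ z) (hS : 0 < x + y + z)
    (hQ : QU t b (f3 i j k x y z)) : ∃ p ∈ Edg t b, JoinedIn (Wt t b) (f3 i j k x y z) p := by
  have b1 : rp b (f3 i j k x y z) i = 0 := by rw [f3_perm4]; exact hb.rp1 _ _ _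
  have b2 : rp b (f3 i j k x y z) j = x + z := by rw [f3_perm4]; exact hb.rp3 _ _ _
  have b3 : rp b (f3 i j k x y z) k = x := by rw [f3_perm4]; exact hb.rp2 _ _ _
  by_cases h : IrrP y z
  · rcases hx.eq_or_lt with h0 | h0
    · have : f3 i j k x y z ∈ Edg t b := ⟨j, k, y, z, ht.2, hb.2, h, by rw [← h0, f3_x]⟩
      exact ⟨_, this, JoinedIn.refl (Edg_sub this)⟩
    · exfalso
      refine not_QU_kink h0 (by rw [sum_f3]; linarith [h.1, h.2.1]) (fun n => ?_) hQ
      rcases f3_cases i j k x y z n with rfl | rfl | rfl | h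
      · right; left; rw [ht.rp1, b1, ht.v1]; simp
      · right; right; rw [ht.rp2, b2]; exact ⟨le_rfl, by linarith⟩
      · right; right; rw [ht.rp3, b3]; exact ⟨by linarith, le_rfl⟩
      · exact Or.inl h
  · exfalso
    obtain ⟨d, hd, hdS, p, q, hp, hq⟩ := commens hy hz hS (by linarith) (by linarith) h
    refine not_QU_rat hd (by rwa [sum_f3]) (fun n => ?_) hQ
    rcases f3_cases i j k x y z n with rfl | rfl | rfl | h
    · right; refine ⟨0, ?_⟩; rw [ht.rp1, b1]; simp
    · right; refine ⟨-q, ?_⟩; rw [ht.rp2, b2]; push_cast; linarith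
    · right; refine ⟨p, ?_⟩; rw [ht.rp3, b3]; linarith
    · exact Or.inl h

theorem F213 (ht : Ord t i j k) (hb : Ord b j i k) (hx : 0 ≤ x) (hy : 0 ≤ y) (hz : 0 ≤ z) (hS : 0 < x + y + z)
    (hQ : QU t b (f3 i j k x y z)) : ∃ p ∈ Edg t b, JoinedIn (Wt t b) (f3 i j k x y z) p := by
  have b1 : rp b (f3 i j k x y z) i = y := by rw [f3_perm5]; exact hb.rp2 _ _ _
  have b2 : rp b (f3 i j k x y z) j = 0 := by rw [f3_perm5]; exact hb.rp1 _ _ _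
  have b3 : rp b (f3 i j k x y z) k = y + x := by rw [f3_perm5]; exact hb.rp3 _ _ _
  by_cases h : IrrP x y
  · rcases hz.eq_or_lt with h0 | h0
    · have : f3 i j k x y z ∈ Edg t b := ⟨i, j, x, y, ht.1, hb.1, h, by rw [← h0, f3_z]⟩
      exact ⟨_, this, JoinedIn.refl (Edg_sub this)⟩
    · exfalso
      refine not_QU_kink (e := x + y) (by linarith [h.1, h.2.1]) (by rw [sum_f3]; linarith) (fun n => ?_) hQ
      rcases f3_cases i j k x y z n with rfl | rfl | rfl | h
      · right; left; rw [ht.rp1, b1, ht.v1]; constructor <;> linarith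
      · right; left; rw [ht.rp2, b2, ht.v2]; constructor <;> linarith
      · right; right; rw [ht.rp3, b3]; constructor <;> linarith
      · exact Or.inl h
  · exfalso
    obtain ⟨d, hd, hdS, p, q, hp, hq⟩ := commens hx hy hS (by linarith) (by linarith) h
    refine not_QU_rat hd (by rwa [sum_f3]) (fun n => ?_) hQ
    rcases f3_cases i j k x y z n with rfl | rfl | rfl | h
    · right; refine ⟨-q, ?_⟩; rw [ht.rp1, b1]; push_cast; linarith
    · right; refine ⟨p, ?_⟩; rw [ht.rp2, b2]; linarith
    · right; refine ⟨0, ?_⟩; rw [ht.rp3, b3]; push_cast; linarith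
    · exact Or.inl h
end

instance (r i j k) : Decidable (Ord r i j k) := by unfold Ord; infer_instance

set_option maxRecDepth 10000 in
theorem erase_type (s : Fin 7) (m : Fin 4) : ∃ i j k, Ord (tR s) i j k ∧ (∀ n, n = m ∨ n = i ∨ n = j ∨ n = k) ∧
    i ≠ m ∧ j ≠ m ∧ k ≠ m ∧
    (Ord (bR s) k j i ∨ Ord (bR s) j k i ∨ Ord (bR s) k i j ∨ Ord (bR s) i k j ∨ Ord (bR s) j i k) := by
  revert s m; decide

theorem face (s : Fin 7) {L : Fin 4 → ℝ} (h0 : ∀ n, 0 ≤ L n) (hS : 0 < ∑ n, L n) {m} (hm : L m = 0)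
    (hQ : QU (tR s) (bR s) L) : ∃ p ∈ Edg (tR s) (bR s), JoinedIn (W s) L p := by
  obtain ⟨i, j, k, ht, hc, hi, hj, hk, hb⟩ := erase_type s m
  have e : L = f3 i j k (L i) (L j) (L k) := by
    funext n
    rcases hc n with rfl | rfl | rfl | rfl
    · rw [hm]; simp [f3, hi.symm, hj.symm, hk.symm]
    · rw [ht.v1]
    · rw [ht.v2]
    · rw [ht.v3]
  rw [W_eq]
  have hS' : 0 < L i + L j + L k := by rwa [e, sum_f3] at hS
  rw [e] at hQ ⊢
  rcases hb with h | h | h | h | h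
  · exact F321 ht h (h0 i) (h0 j) (h0 k) hS' hQ
  · exact F231 ht h (h0 i) (h0 j) (h0 k) hS' hQ
  · exact F312 ht h (h0 i) (h0 j) (h0 k) hS' hQ
  · exact F132 ht h (h0 i) (h0 j) (h0 k) hS' hQ
  · exact F213 ht h (h0 i) (h0 j) (h0 k) hS' hQ
end IETPath

open MeasureTheory Filter Topology

namespace IETPath

/-- `v` can be joined to an edge point whose letters differ from `l` -/
def Av (t b : Fin 4 → Fin 4) (l : Fin 4) (v : Fin 4 → ℝ) : Prop :=
  ∃ i j x y, t i < t j ∧ b j < b i ∧ IrrP x y ∧ i ≠ l ∧ j ≠ l ∧ JoinedIn (Wt t b) v (ed i j x y)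

theorem Av.symm {t b l v} (h : Av t b l v) : Av b t l v := by
  obtain ⟨i, j, x, y, h1, h2, h3, h4, h5, h6⟩ := h
  refine ⟨j, i, y, x, h2, h1, h3.symm, h5, h4, ?_⟩
  rw [Wt_symm, ed_comm]; exact h6

theorem Av.trans {t b l v w} (h : JoinedIn (Wt t b) v w) (h' : Av t b l w) : Av t b l v := by
  obtain ⟨i, j, x, y, h1, h2, h3, h4, h5, h6⟩ := h'
  exact ⟨i, j, x, y, h1, h2, h3, h4, h5, h.trans h6⟩

theorem euclid {P : ℝ → ℝ → Prop} (h1 : ∀ X Y, IrrP X Y → Y < X → P X Y)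
    (h2 : ∀ X Y, IrrP X Y → X < Y → P X (Y - X) → P X Y) : ∀ {X Y}, IrrP X Y → P X Y := by
  have : ∀ (n : ℕ) X Y, IrrP X Y → Y < (n + 1) * X → P X Y := by
    intro n
    induction n with
    | zero => intro X Y h hn; exact h1 X Y h (by simpa using hn)
    | succ n ih =>
      intro X Y h hn
      rcases lt_trichotomy X Y with h' | h' | h'
      · exact h2 X Y h h' (ih _ _ (h.sub_right h') (by push_cast at hn; linarith))
      · exact absurd h' h.ne
      · exact h1 X Y h h'
  intro X Y h
  obtain ⟨n, hn⟩ := exists_nat_gt (Y / X)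
  refine this n X Y h ?_
  rw [div_lt_iff₀ h.1] at hn
  linarith [h.1]

section
variable {t b : Fin 4 → Fin 4} {i j k : Fin 4} {x y z : ℝ}

theorem m321a (ht : Ord t i j k) (hb : Ord b k j i) (h : IrrP y z) :
    JoinedIn (Wt t b) (ed j k y z) (ed i k y (y + z)) := by
  have := J321 (x := 0) ht hb le_rfl h.1.le h.2.1.le (by rw [zero_add]; exact h.add_right)
  rwa [f3_x, zero_add] at this

theorem m321b (ht : Ord t i j k) (hb : Ord b k j i) (h : IrrP x y) :
    JoinedIn (Wt t b) (ed i j x y) (ed i k (x + y) y) := by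
  have := J321 (z := 0) ht hb h.1.le h.2.1.le le_rfl (by rw [add_zero]; exact h.add_left)
  rwa [f3_z, add_zero] at this

theorem m321a' (ht : Ord t i j k) (hb : Ord b k j i) (h : IrrP x y) (hxy : x < y) :
    JoinedIn (Wt t b) (ed i k x y) (ed j k x (y - x)) := by
  have := (m321a ht hb (h.sub_right hxy)).symm
  rwa [add_sub_cancel] at this

theorem m321b' (ht : Ord t i j k) (hb : Ord b k j i) (h : IrrP x y) (hxy : y < x) :
    JoinedIn (Wt t b) (ed i k x y) (ed i j (x - y) y) := by
  have := (m321b ht hb (h.sub_left hxy)).symm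
  rwa [sub_add_cancel] at this

theorem m231 (ht : Ord t i j k) (hb : Ord b j k i) (h : IrrP x y) :
    JoinedIn (Wt t b) (ed i j x y) (ed i k x y) := by
  have := J231 (z := 0) ht hb h.1.le h.2.1.le le_rfl (by rwa [add_zero])
  rwa [f3_z, add_zero] at this

theorem m312 (ht : Ord t i j k) (hb : Ord b k i j) (h : IrrP y z) :
    JoinedIn (Wt t b) (ed j k y z) (ed i k y z) := by
  have := J312 (x := 0) ht hb le_rfl h.1.le h.2.1.le (by rwa [zero_add])
  rwa [f3_x, zero_add] at this

theorem Av.base {l} (h1 : t i < t j) (h2 : b j < b i) (h : IrrP x y) (hi : i ≠ l) (hj : j ≠ l) :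
    Av t b l (ed i j x y) :=
  ⟨i, j, x, y, h1, h2, h, hi, hj, JoinedIn.refl (Edg_sub ⟨i, j, x, y, h1, h2, h, rfl⟩)⟩
end

/-- a four-letter order -/
structure O4 (r : Fin 4 → Fin 4) (p q s u : Fin 4) : Prop where
  a : r p < r q
  b : r q < r s
  c : r s < r u

theorem O4.ac {r p q s u} (h : O4 r p q s u) : r p < r s := h.a.trans h.b
theorem O4.bd {r p q s u} (h : O4 r p q s u) : r q < r u := h.b.trans h.c
theorem O4.ad {r p q s u} (h : O4 r p q s u) : r p < r u := h.ac.trans h.c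
theorem O4.cov {r p q s u} (h : O4 r p q s u) (n) : p = n ∨ q = n ∨ s = n ∨ u = n := by
  have h1 := h.a.ne; have h2 := h.b.ne; have h3 := h.c.ne; have h4 := h.ac.ne; have h5 := h.bd.ne
  have h6 := h.ad.ne
  have e1 : p ≠ q := fun h => h1 (by rw [h])
  have e2 : q ≠ s := fun h => h2 (by rw [h])
  have e3 : s ≠ u := fun h => h3 (by rw [h])
  have e4 : p ≠ s := fun h => h4 (by rw [h])
  have e5 : q ≠ u := fun h => h5 (by rw [h])
  have e6 : p ≠ u := fun h => h6 (by rw [h])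
  clear h h1 h2 h3 h4 h5 h6
  revert p q s u n; decide

theorem ne_of_rk {r : Fin 4 → Fin 4} {i j} (h : r i < r j) : i ≠ j := by
  rintro rfl; exact lt_irrefl _ h

section
variable {t b : Fin 4 → Fin 4} {p q r u : Fin 4} {v : Fin 4 → ℝ}

theorem avA_u (ht : O4 t p q r u) (hb : O4 b u r q p) (hv : v ∈ Edg t b) : Av t b u v := by
  have qu : ∀ {X Y}, IrrP X Y → Av t b u (ed q u X Y) := by
    apply euclid
    · intro X Y h hl
      exact (Av.base ht.b hb.b (h.sub_left hl) (ne_of_rk ht.bd) (ne_of_rk ht.c)).trans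
        (m321b' ⟨ht.b, ht.c⟩ ⟨hb.a, hb.b⟩ h hl)
    · intro X Y h hl ih
      have h' := h.sub_right hl
      refine Av.trans (m321a' ⟨ht.b, ht.c⟩ ⟨hb.a, hb.b⟩ h hl) ?_
      refine Av.trans (m321a (i := p) ⟨ht.ac, ht.c⟩ ⟨hb.a, hb.bd⟩ h') ?_
      exact ih.trans (m321a ⟨ht.a, ht.bd⟩ ⟨hb.ac, hb.c⟩ h').symm
  obtain ⟨i, j, x, y, h1, h2, h, rfl⟩ := hv
  have pu : ∀ {X Y}, IrrP X Y → Av t b u (ed p u X Y) := by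
    intro X Y h
    rcases lt_trichotomy X Y with hl | hl | hl
    · exact (qu (h.sub_right hl)).trans (m321a' ⟨ht.a, ht.bd⟩ ⟨hb.ac, hb.c⟩ h hl)
    · exact absurd hl h.ne
    · exact (Av.base ht.a hb.c (h.sub_left hl) (ne_of_rk ht.ad) (ne_of_rk ht.bd)).trans
        (m321b' ⟨ht.a, ht.bd⟩ ⟨hb.ac, hb.c⟩ h hl)
  by_cases hi : i = u
  · exfalso; subst hi; rcases ht.cov j with rfl | rfl | rfl | rfl
    · exact h1.not_gt ht.ad
    · exact h1.not_gt ht.bd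
    · exact h1.not_gt ht.c
    · exact lt_irrefl _ h1
  by_cases hj : j = u
  · subst hj
    rcases ht.cov i with rfl | rfl | rfl | rfl
    · exact pu h
    · exact qu h
    · exact (pu h.add_right).trans (m321a ⟨ht.ac, ht.c⟩ ⟨hb.a, hb.bd⟩ h)
    · exact absurd rfl hi
  · exact Av.base h1 h2 h hi hj

theorem avB_q (ht : O4 t p q r u) (hb : O4 b u p r q) (hv : v ∈ Edg t b) : Av t b q v := by
  obtain ⟨i, j, x, y, h1, h2, h, rfl⟩ := hv
  have pu : ∀ {X Y}, IrrP X Y → Av t b q (ed p u X Y) := fun h =>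
    Av.base ht.ad hb.a h (ne_of_rk ht.a) (ne_of_rk ht.bd).symm
  have qu : ∀ {X Y}, IrrP X Y → Av t b q (ed q u X Y) := fun h =>
    (pu h).trans (m312 ⟨ht.a, ht.bd⟩ ⟨hb.a, hb.bd⟩ h)
  by_cases hi : i = q
  · subst hi; rcases ht.cov j with rfl | rfl | rfl | rfl
    · exact absurd h1 ht.a.not_gt
    · exact absurd h1 (lt_irrefl _)
    · exact (qu h.add_left).trans (m321b ⟨ht.b, ht.c⟩ ⟨hb.ac, hb.c⟩ h)
    · exact qu h
  by_cases hj : j = q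
  · exfalso; subst hj; rcases ht.cov i with rfl | rfl | rfl | rfl
    · exact h2.not_gt hb.bd
    · exact hi rfl
    · exact h1.not_gt ht.b
    · exact h1.not_gt ht.bd
  · exact Av.base h1 h2 h hi hj

theorem avB_u (ht : O4 t p q r u) (hb : O4 b u p r q) (hv : v ∈ Edg t b) : Av t b u v := by
  obtain ⟨i, j, x, y, h1, h2, h, rfl⟩ := hv
  have qu : ∀ {X Y}, IrrP X Y → Av t b u (ed q u X Y) := by
    apply euclid
    · intro X Y h hl
      exact (Av.base ht.b hb.c (h.sub_left hl) (ne_of_rk ht.bd) (ne_of_rk ht.c)).trans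
        (m321b' ⟨ht.b, ht.c⟩ ⟨hb.ac, hb.c⟩ h hl)
    · intro X Y h hl ih
      have h' := h.sub_right hl
      refine Av.trans (m321a' ⟨ht.b, ht.c⟩ ⟨hb.ac, hb.c⟩ h hl) ?_
      refine Av.trans (m312 (i := p) ⟨ht.ac, ht.c⟩ ⟨hb.a, hb.b⟩ h') ?_
      exact ih.trans (m312 ⟨ht.a, ht.bd⟩ ⟨hb.a, hb.bd⟩ h').symm
  have pu : ∀ {X Y}, IrrP X Y → Av t b u (ed p u X Y) := fun h =>
    (qu h).trans (m312 ⟨ht.a, ht.bd⟩ ⟨hb.a, hb.bd⟩ h).symm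
  by_cases hi : i = u
  · exfalso; subst hi; rcases ht.cov j with rfl | rfl | rfl | rfl
    · exact h1.not_gt ht.ad
    · exact h1.not_gt ht.bd
    · exact h1.not_gt ht.c
    · exact lt_irrefl _ h1
  by_cases hj : j = u
  · subst hj
    rcases ht.cov i with rfl | rfl | rfl | rfl
    · exact pu h
    · exact qu h
    · exact (pu h).trans (m312 ⟨ht.ac, ht.c⟩ ⟨hb.a, hb.b⟩ h)
    · exact absurd rfl hi
  · exact Av.base h1 h2 h hi hj

theorem avC_r (ht : O4 t p q r u) (hb : O4 b u q p r) (hv : v ∈ Edg t b) : Av t b r v := by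
  obtain ⟨i, j, x, y, h1, h2, h, rfl⟩ := hv
  by_cases hi : i = r
  · subst hi; rcases ht.cov j with rfl | rfl | rfl | rfl
    · exact absurd h1 ht.ac.not_gt
    · exact absurd h1 ht.b.not_gt
    · exact absurd h1 (lt_irrefl _)
    · exact (Av.base ht.ad hb.ac h (ne_of_rk ht.ac) (ne_of_rk ht.c).symm).trans
        (m312 ⟨ht.ac, ht.c⟩ ⟨hb.ac, hb.c⟩ h)
  by_cases hj : j = r
  · exfalso; subst hj; rcases ht.cov i with rfl | rfl | rfl | rfl
    · exact h2.not_gt hb.c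
    · exact h2.not_gt hb.bd
    · exact hi rfl
    · exact h1.not_gt ht.c
  · exact Av.base h1 h2 h hi hj

theorem avC_u (ht : O4 t p q r u) (hb : O4 b u q p r) (hv : v ∈ Edg t b) : Av t b u v := by
  obtain ⟨i, j, x, y, h1, h2, h, rfl⟩ := hv
  have pu : ∀ {X Y}, IrrP X Y → Av t b u (ed p u X Y) := by
    apply euclid
    · intro X Y h hl
      exact (Av.base ht.a hb.b (h.sub_left hl) (ne_of_rk ht.ad) (ne_of_rk ht.bd)).trans
        (m321b' ⟨ht.a, ht.bd⟩ ⟨hb.a, hb.b⟩ h hl)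
    · intro X Y h hl ih
      have h' := h.sub_right hl
      refine Av.trans (m321a' ⟨ht.a, ht.bd⟩ ⟨hb.a, hb.b⟩ h hl) ?_
      refine Av.trans (m312 (j := r) ⟨ht.b, ht.c⟩ ⟨hb.a, hb.bd⟩ h').symm ?_
      exact ih.trans (m312 ⟨ht.ac, ht.c⟩ ⟨hb.ac, hb.c⟩ h')
  have ru : ∀ {X Y}, IrrP X Y → Av t b u (ed r u X Y) := fun h =>
    (pu h).trans (m312 ⟨ht.ac, ht.c⟩ ⟨hb.ac, hb.c⟩ h)
  by_cases hi : i = u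
  · exfalso; subst hi; rcases ht.cov j with rfl | rfl | rfl | rfl
    · exact h1.not_gt ht.ad
    · exact h1.not_gt ht.bd
    · exact h1.not_gt ht.c
    · exact lt_irrefl _ h1
  by_cases hj : j = u
  · subst hj
    rcases ht.cov i with rfl | rfl | rfl | rfl
    · exact pu h
    · exact (ru h).trans (m312 (j := r) ⟨ht.b, ht.c⟩ ⟨hb.a, hb.bd⟩ h).symm
    · exact ru h
    · exact absurd rfl hi
  · exact Av.base h1 h2 h hi hj

theorem avD (ht : O4 t p q u r) (hb : O4 b u p r q) (hv : v ∈ Edg t b) {l} (hp : p ≠ l) (hu : u ≠ l) :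
    Av t b l v := by
  obtain ⟨i, j, x, y, h1, h2, h, rfl⟩ := hv
  have pu : ∀ {X Y}, IrrP X Y → Av t b l (ed p u X Y) := fun h =>
    Av.base ht.ac hb.a h hp hu
  have qu : ∀ {X Y}, IrrP X Y → Av t b l (ed q u X Y) := fun h =>
    (pu h).trans (m312 ⟨ht.a, ht.b⟩ ⟨hb.a, hb.bd⟩ h)
  have qr : ∀ {X Y}, IrrP X Y → Av t b l (ed q r X Y) := fun h =>
    (qu h).trans (m231 ⟨ht.b, ht.c⟩ ⟨hb.ac, hb.c⟩ h).symm
  rcases ht.cov i with rfl | rfl | rfl | rfl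
  · rcases hb.cov j with rfl | rfl | rfl | rfl
    · exact pu h
    · exact absurd h1 (lt_irrefl _)
    · exact absurd h2 hb.b.not_gt
    · exact absurd h2 hb.bd.not_gt
  · rcases hb.cov j with rfl | rfl | rfl | rfl
    · exact qu h
    · exact absurd h1 ht.a.not_gt
    · exact qr h
    · exact absurd h1 (lt_irrefl _)
  · rcases hb.cov j with rfl | rfl | rfl | rfl
    · exact absurd h1 (lt_irrefl _)
    · exact absurd h2 hb.a.not_gt
    · exact absurd h2 hb.ac.not_gt
    · exact absurd h2 hb.ad.not_gt
  · rcases hb.cov j with rfl | rfl | rfl | rfl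
    · exact absurd h1 ht.c.not_gt
    · exact absurd h1 ht.ad.not_gt
    · exact absurd h1 (lt_irrefl _)
    · exact absurd h1 ht.bd.not_gt
end

theorem avoid (y : Bool) (s : Fin 7) {v} (hv : v ∈ Edg (tR s) (bR s)) : Av (tR s) (bR s) (los y s) v := by
  have hv' := hv
  rw [Edg_symm] at hv'
  fin_cases s
  · cases y
    · exact avA_u (p := 0) (q := 1) (r := 2) (u := 3) ⟨by decide, by decide, by decide⟩ ⟨by decide, by decide, by decide⟩ hv
    · exact (avA_u (p := 3) (q := 2) (r := 1) (u := 0) ⟨by decide, by decide, by decide⟩ ⟨by decide, by decide, by decide⟩ hv').symm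
  · cases y
    · exact avB_u (p := 0) (q := 1) (r := 2) (u := 3) ⟨by decide, by decide, by decide⟩ ⟨by decide, by decide, by decide⟩ hv
    · exact avB_q (p := 0) (q := 1) (r := 2) (u := 3) ⟨by decide, by decide, by decide⟩ ⟨by decide, by decide, by decide⟩ hv
  · cases y
    · exact avC_u (p := 0) (q := 1) (r := 2) (u := 3) ⟨by decide, by decide, by decide⟩ ⟨by decide, by decide, by decide⟩ hv
    · exact avC_r (p := 0) (q := 1) (r := 2) (u := 3) ⟨by decide, by decide, by decide⟩ ⟨by decide, by decide, by decide⟩ hv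
  · exact avD (p := 0) (q := 1) (r := 2) (u := 3) ⟨by decide, by decide, by decide⟩ ⟨by decide, by decide, by decide⟩ hv
      (by revert y; decide) (by revert y; decide)
  · cases y
    · exact (avB_q (p := 3) (q := 2) (r := 1) (u := 0) ⟨by decide, by decide, by decide⟩ ⟨by decide, by decide, by decide⟩ hv').symm
    · exact (avB_u (p := 3) (q := 2) (r := 1) (u := 0) ⟨by decide, by decide, by decide⟩ ⟨by decide, by decide, by decide⟩ hv').symm
  · cases y
    · exact (avC_r (p := 3) (q := 2) (r := 1) (u := 0) ⟨by decide, by decide, by decide⟩ ⟨by decide, by decide, by decide⟩ hv').symm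
    · exact (avC_u (p := 3) (q := 2) (r := 1) (u := 0) ⟨by decide, by decide, by decide⟩ ⟨by decide, by decide, by decide⟩ hv').symm
  · exact (avD (p := 3) (q := 2) (r := 1) (u := 0) ⟨by decide, by decide, by decide⟩ ⟨by decide, by decide, by decide⟩ hv'
      (by revert y; decide) (by revert y; decide)).symm

theorem nxt_t (y s) (i j : Fin 4) (hi : i ≠ los y s) (hj : j ≠ los y s) :
    (tR (nxt y s) i < tR (nxt y s) j ↔ tR s i < tR s j) ∧ (bR (nxt y s) i < bR (nxt y s) j ↔ bR s i < bR s j) := by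
  cases y
  · rw [bR_nxt]; exact ⟨(step_bot s).h1 i j hi hj, Iff.rfl⟩
  · rw [tR_nxt]; exact ⟨Iff.rfl, (step_top s).h1 i j hi hj⟩

/-- any edge point is joined to an edge point which is unchanged by the Rauzy move -/
theorem avoid' (y : Bool) (s : Fin 7) {v} (hv : v ∈ Edg (tR s) (bR s)) :
    ∃ p, JoinedIn (W s) v p ∧ p ∈ Edg (tR s) (bR s) ∧ p ∈ Edg (tR (nxt y s)) (bR (nxt y s)) ∧ M y s p = p := by
  obtain ⟨i, j, x, z, h1, h2, h3, h4, h5, h6⟩ := avoid y s hv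
  refine ⟨_, h6, ⟨i, j, x, z, h1, h2, h3, rfl⟩, ⟨i, j, x, z, ?_, ?_, h3, rfl⟩, ?_⟩
  · exact ((nxt_t y s i j h4 h5).1).2 h1
  · exact ((nxt_t y s j i h5 h4).2).2 h2
  · have : ed i j x z (los y s) = 0 := by simp [ed, h4.symm, h5.symm]
    funext n
    simp [M, mv, this]

theorem ex_ne3 (i j k : Fin 4) : ∃ n, n ≠ i ∧ n ≠ j ∧ n ≠ k := by revert i j k; decide

theorem PU.QU {t b L} (h : PU t b L) : QU t b L := fun F h1 _ h3 h4 => h F h1 h3 h4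

/-- any edge point of the next state comes from a point joined to an edge point of the present state -/
theorem edge_up (y : Bool) (s : Fin 7) {v} (hv : v ∈ Edg (tR (nxt y s)) (bR (nxt y s))) :
    ∃ p, p ∈ Edg (tR s) (bR s) ∧ JoinedIn (W s) (M y s v) p := by
  have h := M_mem_W y s (Edg_sub hv)
  obtain ⟨i, j, x, z, h1, h2, h3, rfl⟩ := hv
  obtain ⟨n, n1, n2, n3⟩ := ex_ne3 i j (win y s)
  have h0 : M y s (ed i j x z) n = 0 := by simp [M, mv, ed, n1, n2, n3]
  exact face s h.1 h.2.1 h0 h.2.2.QU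
end IETPath

open MeasureTheory Filter Topology

namespace IETPath

theorem rp_smul (r : Fin 4 → Fin 4) (c : ℝ) (L : Fin 4 → ℝ) (j) : rp r (c • L) j = c * rp r L j := by
  simp [rp, Finset.mul_sum]

theorem PU_smul {t b L} {c : ℝ} (hc : 0 < c) (h : PU t b L) : PU t b (c • L) := by
  intro F hm h0 hE
  obtain ⟨a, ha⟩ := h (fun x => F (c * x)) (fun x y hxy => hm (mul_le_mul_of_nonneg_left hxy hc.le)) (by simpa using h0)
    (by
      intro j y y0 y1
      have := hE j (c * y) (by positivity) (by simpa using mul_le_mul_of_nonneg_left y1 hc.le)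
      simpa only [rp_smul, ← mul_add] using this)
  refine ⟨a / c, fun x x0 x1 => ?_⟩
  have hs : ∑ i, (c • L) i = c * ∑ i, L i := by simp [Finset.mul_sum]
  rw [hs] at x1
  have := ha (x / c) (by positivity) (by rw [div_le_iff₀ hc]; linarith)
  rw [show c * (x / c) = x by field_simp] at this
  rw [this]; ring

noncomputable def nrm (v : Fin 4 → ℝ) : Fin 4 → ℝ := (∑ i, v i)⁻¹ • v

theorem sum_nrm {v : Fin 4 → ℝ} (h : 0 < ∑ i, v i) : ∑ i, nrm v i = 1 := by
  simp only [nrm, Pi.smul_apply, smul_eq_mul, ← Finset.mul_sum]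
  exact inv_mul_cancel₀ h.ne'

theorem nrm_self {v : Fin 4 → ℝ} (h : ∑ i, v i = 1) : nrm v = v := by simp [nrm, h]

theorem nrm_cont {S : Set (Fin 4 → ℝ)} (h : ∀ v ∈ S, 0 < ∑ i, v i) : ContinuousOn nrm S := by
  have h1 : ContinuousOn (fun v : Fin 4 → ℝ => (∑ i, v i)⁻¹) S :=
    ContinuousOn.inv₀ (by fun_prop) fun v hv => (h v hv).ne'
  exact h1.smul continuousOn_id

/-- normalized version of `W` -/
def Wn (s : Fin 7) : Set (Fin 4 → ℝ) := {v | v ∈ W s ∧ ∑ i, v i = 1}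

theorem nrm_mem {s v} (h : v ∈ W s) : nrm v ∈ Wn s := by
  refine ⟨⟨fun i => ?_, ?_, ?_⟩, sum_nrm h.2.1⟩
  · exact mul_nonneg (inv_nonneg.2 h.2.1.le) (h.1 i)
  · rw [sum_nrm h.2.1]; exact one_pos
  · exact PU_smul (inv_pos.2 h.2.1) h.2.2

theorem joined_nrm {s v w} (h : JoinedIn (W s) v w) : JoinedIn (Wn s) (nrm v) (nrm w) := by
  refine (h.map_continuousOn (nrm_cont fun v hv => hv.2.1)).mono ?_
  rintro _ ⟨v, hv, rfl⟩
  exact nrm_mem hv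

theorem NN_W {s y} (hp : RPath s y) (k) : ∀ {v}, v ∈ W (s k) → NN s y k v ∈ W (s 0) := by
  induction k with
  | zero => exact fun h => h
  | succ k ih =>
    intro v hv
    rw [hp k] at hv
    exact ih (M_mem_W _ _ hv)

/-- every nonnegative vector has an infinite Rauzy expansion -/
theorem exists_exp (s0 : Fin 7) {L0 : Fin 4 → ℝ} (h : ∀ i, 0 ≤ L0 i) :
    ∃ s y L, RPath s y ∧ Orb s y L ∧ s 0 = s0 ∧ L 0 = L0 := by
  choose y L' h1 h2 using fun p : {p : Fin 7 × (Fin 4 → ℝ) // ∀ i, 0 ≤ p.2 i} => exists_step p.1.1 p.2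
  let f : ℕ → {p : Fin 7 × (Fin 4 → ℝ) // ∀ i, 0 ≤ p.2 i} := fun n => Nat.rec ⟨(s0, L0), h⟩
    (fun _ p => ⟨(nxt (y p) p.1.1, L' p), h1 p⟩) n
  refine ⟨fun k => (f k).1.1, fun k => y (f k), fun k => (f k).1.2, fun k => rfl, ⟨fun k => (f k).2, fun k => h2 (f k)⟩, rfl, rfl⟩

theorem Orb.QU {s y L} (hp : RPath s y) (hL : Orb s y L) (hQ : QU (tR (s 0)) (bR (s 0)) (L 0)) (k) :
    QU (tR (s k)) (bR (s k)) (L k) := by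
  induction k with
  | zero => exact hQ
  | succ k ih =>
    rw [hp k]
    rw [hL.eq k] at ih
    exact QU_M _ _ (hL.nn _) ih

theorem Orb.sum_pos {s y L} (hL : Orb s y L) (h : 0 < ∑ i, L 0 i) (k) : 0 < ∑ i, L k i := by
  induction k with
  | zero => exact h
  | succ k ih =>
    rw [hL.eq k, sum_M] at ih
    have := Finset.single_le_sum (f := L (k+1)) (fun i _ => hL.nn _ i) (Finset.mem_univ (los (y k) (s k)))
    linarith

theorem fin_case {s y L} (hp : RPath s y) (hL : Orb s y L) (h : 0 < ∑ i, L 0 i)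
    (hQ : QU (tR (s 0)) (bR (s 0)) (L 0)) {K m} (hK : L K m = 0) :
    ∃ p ∈ Edg (tR (s 0)) (bR (s 0)), JoinedIn (W (s 0)) (L 0) p := by
  suffices ∀ k ≤ K, ∃ p ∈ Edg (tR (s (K - k))) (bR (s (K - k))), JoinedIn (W (s (K - k))) (L (K - k)) p by
    simpa using this K le_rfl
  intro k
  induction k with
  | zero => intro _; exact face _ (hL.nn K) (hL.sum_pos h K) hK (hL.QU hp hQ K)
  | succ k ih =>
    intro hk
    obtain ⟨p, h1, h2⟩ := ih (by omega)
    have e : K - k = (K - (k+1)) + 1 := by omega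
    rw [e] at h1 h2
    generalize K - (k+1) = n at *
    rw [hp n] at h1 h2
    have h3 := joined_M _ _ h2
    rw [← hL.eq n] at h3
    obtain ⟨q, h4, h5⟩ := edge_up _ _ h1
    exact ⟨q, h4, h3.trans h5⟩

theorem inf_case {s y L} (hp : RPath s y) (hL : Orb s y L) (hpos : ∀ k i, 0 < L k i) (h1 : ∑ i, L 0 i = 1)
    (hQ : QU (tR (s 0)) (bR (s 0)) (L 0)) {e} (he : e ∈ Edg (tR (s 0)) (bR (s 0))) :
    JoinedIn (Wn (s 0) ∪ {L 0}) (nrm e) (L 0) := by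
  choose! f f1 f2 f3 f4 using fun k v (hv : v ∈ Edg (tR (s k)) (bR (s k))) => avoid' (y k) (s k) hv
  let q : ℕ → Fin 4 → ℝ := fun n => Nat.rec e (fun k v => f k v) n
  have hq : ∀ k, q k ∈ Edg (tR (s k)) (bR (s k)) := by
    intro k
    induction k with
    | zero => exact he
    | succ k ih => rw [hp k]; exact f3 k _ ih
  have hj : ∀ k, JoinedIn (Cn s y k ∩ Wn (s 0)) (nrm (NN s y k (q k))) (nrm (NN s y (k+1) (q (k+1)))) := by
    intro k
    have e1 : NN s y (k+1) (q (k+1)) = NN s y k (q (k+1)) := by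
      change NN s y k (M (y k) (s k) (q (k+1))) = _
      congr 1
      exact f4 k _ (hq k)
    rw [e1]
    have := (f1 k _ (hq k)).map_continuousOn (f := fun v => nrm (NN s y k v))
      ((nrm_cont (S := {v | 0 < ∑ i, v i}) fun v hv => hv).comp (NN_cont s y k).continuousOn
        fun v hv => (NN_W hp k hv).2.1)
    refine this.mono ?_
    rintro _ ⟨v, hv, rfl⟩
    have hW := NN_W hp k hv
    refine ⟨⟨(∑ i, NN s y k v i)⁻¹ • v, fun i => mul_nonneg (inv_nonneg.2 hW.2.1.le) (hv.1 i), ?_, sum_nrm hW.2.1⟩, nrm_mem hW⟩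
    rw [NN_smul]; rfl
  have := inf_concat hj (p := L 0) fun U hU => by
    filter_upwards [cone_shrink hp hL hpos hQ h1 hU] with k hk
    exact Set.inter_subset_left.trans hk
  refine this.mono ?_
  apply Set.union_subset_union_left
  exact Set.iUnion_subset fun k => Set.inter_subset_right
end IETPath

open MeasureTheory Filter Topology

namespace IETPath

/-- mass of the piece `j` -/
def ms (r : Fin 4 → Fin 4) (L : Fin 4 → ℝ) (F : ℝ → ℝ) (j : Fin 4) : ℝ := F (rp r L j + L j) - F (rp r L j)

theorem ms_symm {t b L F} (hL : ∀ i, 0 ≤ L i) (h : Eqn t b L F) : ms t L F = ms b L F := by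
  funext j; exact h j (L j) (hL j) le_rfl

theorem TopStep.ms {t b b' a l} (S : TopStep t b b' a l) {w : Fin 4 → ℝ} (hw : ∀ i, 0 ≤ w i) {F : ℝ → ℝ}
    (h : Eqn t b (mv a l w) F) : ms t (mv a l w) F = mv a l (ms t w F) := by
  funext j
  unfold IETPath.ms
  rw [S.r1]
  by_cases hj : j = a
  · subst hj
    have := S.copy h (hw l) le_rfl
    rw [mv_win, mv_win, ← add_assoc, S.r5]
    linarith
  · rw [mv_ne _ _ hj, mv_ne _ _ hj]

theorem step_Eqn (y s) {w : Fin 4 → ℝ} (hw : ∀ i, 0 ≤ w i) {F : ℝ → ℝ} (h : Eqn (tR s) (bR s) (M y s w) F) :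
    Eqn (tR (nxt y s)) (bR (nxt y s)) w F ∧
      IETPath.ms (tR s) (M y s w) F = M y s (IETPath.ms (tR (nxt y s)) w F) := by
  cases y
  · have h1 := (step_bot s).restrict hw h.symm
    refine ⟨by rw [bR_nxt]; exact h1.symm, ?_⟩
    rw [ms_symm (M_nonneg _ _ hw) h, ms_symm hw h1.symm]
    exact (step_bot s).ms hw h.symm
  · refine ⟨by rw [tR_nxt]; exact (step_top s).restrict hw h, ?_⟩
    rw [tR_nxt]
    exact (step_top s).ms hw h

theorem step_copy (y s) {w : Fin 4 → ℝ} {F : ℝ → ℝ} (h : Eqn (tR s) (bR s) (M y s w) F) :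
    ∃ r, (r = tR (nxt y s) ∨ r = bR (nxt y s)) ∧ ∀ u, 0 ≤ u → u ≤ w (los y s) →
      F (∑ i, w i + u) - F (∑ i, w i) = F (rp r w (los y s) + u) - F (rp r w (los y s)) := by
  cases y
  · exact ⟨bR (nxt false s), Or.inr rfl, fun u h0 h1 => by rw [bR_nxt]; exact (step_bot s).copy h.symm h0 h1⟩
  · exact ⟨tR (nxt true s), Or.inl rfl, fun u h0 h1 => by rw [tR_nxt]; exact (step_top s).copy h h0 h1⟩

theorem rp_succ {r : Fin 4 → Fin 4} (hr : Function.Injective r) (L : Fin 4 → ℝ) {j k}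
    (h : (r j).val = (r k).val + 1) : rp r L j = rp r L k + L k := by
  unfold rp
  have : ∀ m, (if r m < r j then L m else 0) = (if r m < r k then L m else 0) + if m = k then L m else 0 := by
    intro m
    by_cases hm : m = k
    · subst hm
      rw [if_pos (by rw [Fin.lt_def]; omega), if_neg (lt_irrefl _), if_pos rfl]; simp
    · have : (r m).val ≠ (r k).val := fun e => hm (hr (Fin.ext e))
      rw [if_neg hm, add_zero]
      congr 1
      rw [Fin.lt_def, Fin.lt_def, eq_iff_iff]; omega
  simp only [this, Finset.sum_add_distrib, Finset.sum_ite_eq', Finset.mem_univ, if_true]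

theorem rp_last {r : Fin 4 → Fin 4} (hr : Function.Injective r) (L : Fin 4 → ℝ) {k}
    (h : (r k).val = 3) : ∑ i, L i = rp r L k + L k := by
  unfold rp
  have : ∀ m, L m = (if r m < r k then L m else 0) + if m = k then L m else 0 := by
    intro m
    by_cases hm : m = k
    · subst hm
      rw [if_neg (lt_irrefl _), if_pos rfl]; simp
    · have : (r m).val ≠ (r k).val := fun e => hm (hr (Fin.ext e))
      rw [if_neg hm, add_zero, if_pos (by rw [Fin.lt_def]; omega)]
  rw [Finset.sum_congr rfl fun m _ => this m]
  simp only [Finset.sum_add_distrib, Finset.sum_ite_eq', Finset.mem_univ, if_true]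

theorem zero_ends {r : Fin 4 → Fin 4} (hr : Function.Injective r) {L : Fin 4 → ℝ} {G : ℝ → ℝ} (h0 : G 0 = 0)
    (h : ∀ j, G (rp r L j + L j) = G (rp r L j)) : (∀ j, G (rp r L j) = 0) ∧ G (∑ i, L i) = 0 := by
  have hs := Finite.surjective_of_injective hr
  have key : ∀ n j, (r j).val = n → G (rp r L j) = 0 := by
    intro n
    induction n with
    | zero =>
      intro j hj
      have : rp r L j = 0 := by
        unfold rp
        apply Finset.sum_eq_zero
        intro k _
        rw [if_neg (by rw [Fin.lt_def]; omega)]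
      rw [this, h0]
    | succ n ih =>
      intro j hj
      obtain ⟨k, hk⟩ := hs ⟨n, by omega⟩
      have hk' : (r k).val = n := by rw [hk]
      rw [rp_succ hr L (j := j) (k := k) (by omega), h k]
      exact ih k hk'
  refine ⟨fun j => key _ j rfl, ?_⟩
  obtain ⟨k, hk⟩ := hs 3
  rw [rp_last hr L (k := k) (by rw [hk]; rfl), h k]
  exact key _ k rfl

/-- if every orbit is proportional to `L`, then `L` is uniquely ergodic in the strong sense -/
theorem PU_of_prop {s y L} (hp : RPath s y) (hL : Orb s y L) (hpos : ∀ k i, 0 < L k i)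
    (H : ∀ v, Orb s y v → ∃ c : ℝ, v 0 = c • L 0) : PU (tR (s 0)) (bR (s 0)) (L 0) := by
  intro F hm h0 hE
  have hEk : ∀ k, Eqn (tR (s k)) (bR (s k)) (L k) F := by
    intro k
    induction k with
    | zero => exact hE
    | succ k ih =>
      rw [hL.eq k] at ih
      rw [hp k]; exact (step_Eqn _ _ (hL.nn _) ih).1
  have hv : Orb s y (fun k => IETPath.ms (tR (s k)) (L k) F) := by
    refine ⟨fun k i => ?_, fun k => ?_⟩
    · exact sub_nonneg.2 (hm (by linarith [hL.nn k i]))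
    · have ih := hEk k
      rw [hL.eq k] at ih
      beta_reduce
      rw [hp k]
      conv_lhs => rw [hL.eq k]
      exact (step_Eqn _ _ (hL.nn _) ih).2
  obtain ⟨c, hc⟩ := H _ hv
  have hck : ∀ k, IETPath.ms (tR (s k)) (L k) F = c • L k := by
    intro k
    apply NN_inj s y k
    rw [hv.NN k, NN_smul, hL.NN k]; exact hc
  let G : ℝ → ℝ := fun x => F x - c * x
  have G0 : G 0 = 0 := by simp [G, h0]
  have hGt : ∀ k, (∀ j, G (rp (tR (s k)) (L k) j) = 0) ∧ G (∑ i, L k i) = 0 := by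
    intro k
    refine zero_ends (tR_inj _) G0 fun j => ?_
    have := congrFun (hck k) j
    simp only [IETPath.ms, Pi.smul_apply, smul_eq_mul] at this
    simp only [G]; linarith
  have hGb : ∀ k, (∀ j, G (rp (bR (s k)) (L k) j) = 0) ∧ G (∑ i, L k i) = 0 := by
    intro k
    refine zero_ends (bR_inj _) G0 fun j => ?_
    have := congrFun (hck k) j
    rw [ms_symm (hL.nn k) (hEk k)] at this
    simp only [IETPath.ms, Pi.smul_apply, smul_eq_mul] at this
    simp only [G]; linarith
  have hS : ∀ k, 0 < ∑ i, L k i := fun k => Finset.sum_pos (fun i _ => hpos k i) Finset.univ_nonempty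
  have hD : ∀ k δ, (∀ x, 0 ≤ x → x ≤ ∑ i, L k i → |G x| ≤ δ) → ∀ x, 0 ≤ x → x ≤ ∑ i, L 0 i → |G x| ≤ δ := by
    intro k
    induction k with
    | zero => exact fun δ h => h
    | succ k ih =>
      intro δ h
      apply ih
      intro x x0 x1
      rcases le_total x (∑ i, L (k+1) i) with hx | hx
      · exact h x x0 hx
      · have he := hEk k
        rw [hL.eq k] at he
        rw [hL.eq k, sum_M] at x1
        obtain ⟨r, hr, hcp⟩ := step_copy _ _ he
        have hGr : G (rp r (L (k+1)) (los (y k) (s k))) = 0 := by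
          rcases hr with rfl | rfl
          · rw [← hp k]; exact (hGt (k+1)).1 _
          · rw [← hp k]; exact (hGb (k+1)).1 _
        have h1 := hcp (x - ∑ i, L (k+1) i) (by linarith) (by linarith)
        rw [add_sub_cancel] at h1
        have h2 := (hGt (k+1)).2
        have h3 := rp_nonneg r (hL.nn (k+1)) (los (y k) (s k))
        have h4 := rp_add_le r (hL.nn (k+1)) (los (y k) (s k))
        have h5 : G x = G (rp r (L (k+1)) (los (y k) (s k)) + (x - ∑ i, L (k+1) i)) := by
          simp only [G] at hGr h2 ⊢; linarith
        rw [h5]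
        exact h _ (by linarith) (by linarith)
  have hcS : ∀ k, F (∑ i, L k i) = c * ∑ i, L k i := fun k => by
    have := (hGt k).2; simp only [G] at this; linarith
  have hc0 : 0 ≤ c := by
    have h1 := hcS 0
    have h2 := hm (hS 0).le
    rw [h0, h1] at h2
    exact nonneg_of_mul_nonneg_left h2 (hS 0)
  refine ⟨c, fun x x0 x1 => ?_⟩
  have hb : ∀ k, |G x| ≤ c * ∑ i, L k i := by
    intro k
    refine hD k _ (fun u u0 u1 => ?_) x x0 x1
    have h1 := hm u0
    have h2 := hm u1
    rw [h0] at h1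
    rw [hcS] at h2
    have h3 := mul_nonneg hc0 u0
    have h4 := mul_le_mul_of_nonneg_left u1 hc0
    simp only [G]
    rw [abs_le]; constructor <;> linarith
  have hlim := (tendsto_zero hp hL hpos hL).const_mul c
  rw [mul_zero] at hlim
  have h1 := ge_of_tendsto' hlim hb
  have h2 : G x = 0 := abs_eq_zero.1 (le_antisymm h1 (abs_nonneg _))
  simp only [G] at h2; linarith

theorem eq_nonneg {s : ℕ → Fin 7} {y : ℕ → Bool} {d : ℕ → Fin 4 → ℝ} (h : ∀ k, d k = M (y k) (s k) (d (k+1))) {K} (hK : ∀ i, 0 ≤ d K i) :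
    ∀ k ≤ K, ∀ i, 0 ≤ d k i := by
  have : ∀ n ≤ K, ∀ i, 0 ≤ d (K - n) i := by
    intro n
    induction n with
    | zero => exact fun _ => hK
    | succ n ih =>
      intro hn
      rw [h (K - (n+1)), show K - (n+1) + 1 = K - n by omega]
      exact M_nonneg _ _ (ih (by omega))
  intro k hk
  have := this (K - k) (by omega)
  rwa [show K - (K - k) = k by omega] at this

theorem eq_comb {s : ℕ → Fin 7} {y : ℕ → Bool} {v w : ℕ → Fin 4 → ℝ} (hv : ∀ k, v k = M (y k) (s k) (v (k+1)))
    (hw : ∀ k, w k = M (y k) (s k) (w (k+1))) (a c : ℝ) (k) :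
    (fun k => a • v k + c • w k) k = M (y k) (s k) ((fun k => a • v k + c • w k) (k+1)) := by
  beta_reduce
  rw [M_add, M_smul, M_smul, ← hv, ← hw]

theorem prop_of_ten {s : ℕ → Fin 7} {y : ℕ → Bool} {L v : ℕ → Fin 4 → ℝ} (hL : Orb s y L) (hpos : ∀ k i, 0 < L k i) (hv : Orb s y v)
    (H : ∀ w, Orb s y w → ∀ n i, ∑ j, w (10*n+10) j ≤ w (10*n) i ∧ w (10*n) i ≤ 3 * ∑ j, w (10*n+10) j) :
    ∃ c : ℝ, v 0 = c • L 0 := by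
  let A : Set ℝ := {c | ∀ k i, c * L k i ≤ v k i}
  have hA0 : (0:ℝ) ∈ A := fun k i => by rw [zero_mul]; exact hv.nn k i
  have hAb : BddAbove A := ⟨v 0 0 / L 0 0, fun c hc => by rw [le_div_iff₀ (hpos 0 0)]; exact hc 0 0⟩
  have hcA : sSup A ∈ A := fun k i => by
    rw [← le_div_iff₀ (hpos k i)]
    exact csSup_le ⟨0, hA0⟩ fun c hc => by rw [le_div_iff₀ (hpos k i)]; exact hc k i
  set c := sSup A with hc
  have hu : Orb s y (fun k => (1:ℝ) • v k + (-c) • L k) :=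
    ⟨fun k i => by have := hcA k i; simp; linarith, eq_comb hv.eq hL.eq 1 (-c)⟩
  set u : ℕ → Fin 4 → ℝ := fun k => (1:ℝ) • v k + (-c) • L k with hudef
  have hS : ∀ k, 0 < ∑ i, L k i := fun k => Finset.sum_pos (fun i _ => hpos k i) Finset.univ_nonempty
  rcases (Finset.sum_nonneg fun i _ => hu.nn 0 i).eq_or_lt with h | h
  · refine ⟨c, ?_⟩
    have h1 := (Finset.sum_eq_zero_iff_of_nonneg fun i _ => hu.nn 0 i).1 h.symm
    funext i
    have := h1 i (Finset.mem_univ _)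
    simp only [hudef, Pi.add_apply, Pi.smul_apply, smul_eq_mul] at this ⊢
    linarith
  exfalso
  have hL0 := hS 0
  set ρ := (∑ i, u 0 i) / ∑ i, L 0 i with hρ
  have hρ0 : 0 < ρ := div_pos h hL0
  have hten : ∀ n i, ρ / 9 * L (10*n) i ≤ u (10*n) i := by
    intro n i
    have hSL := hS (10*n+10)
    set σL := ∑ j, L (10*n+10) j
    set σu := ∑ j, u (10*n+10) j
    have hR : ρ * σL ≤ 3 * σu := by
      have h1 := eq_nonneg (eq_comb hu.eq hL.eq (-σL) (3 * σu)) (K := 10*n) (fun j => by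
        have e1 := (H u hu n j).2
        have e2 := (H L hL n j).1
        have e3 : 0 ≤ σu := Finset.sum_nonneg fun j _ => hu.nn _ j
        simp only [Pi.add_apply, Pi.smul_apply, smul_eq_mul]
        have := mul_le_mul_of_nonneg_left e1 hSL.le
        have := mul_le_mul_of_nonneg_left e2 e3
        nlinarith) 0 (Nat.zero_le _)
      have h2 := Finset.sum_nonneg fun j (_ : j ∈ Finset.univ) => h1 j
      simp only [Pi.add_apply, Pi.smul_apply, smul_eq_mul, Finset.sum_add_distrib, ← Finset.mul_sum] at h2
      rw [hρ, div_mul_eq_mul_div, div_le_iff₀ hL0]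
      linarith
    have e1 := (H u hu n i).1
    have e2 := (H L hL n i).2
    have := mul_le_mul_of_nonneg_left e2 hρ0.le
    linarith
  have : c + ρ / 9 ∈ A := by
    intro k i
    have h1 := eq_nonneg (eq_comb hu.eq hL.eq 1 (-(ρ/9))) (K := 10*k) (fun j => by
      have := hten k j
      simp only [Pi.add_apply, Pi.smul_apply, smul_eq_mul]; linarith) k (by omega) i
    simp only [hudef, Pi.add_apply, Pi.smul_apply, smul_eq_mul] at h1
    linarith
  have := le_csSup hAb this
  linarith

end IETPath

open MeasureTheory Filter Topology

namespace IETPath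

def csT : Fin 10 → Fin 7 := ![3,1,2,2,0,4,5,0,1,3]
def cyT : Fin 10 → Bool := ![false,true,false,true,false,false,false,true,false,true]
def cs (k : ℕ) : Fin 7 := csT (Fin.ofNat 10 k)
def cy (k : ℕ) : Bool := cyT (Fin.ofNat 10 k)

theorem ofNat_succ (k : ℕ) : Fin.ofNat 10 (k+1) = Fin.ofNat 10 k + 1 := by
  apply Fin.ext; simp [Fin.ofNat, Fin.val_add]

theorem ofNat_ten (n i : ℕ) : Fin.ofNat 10 (10*n+i) = Fin.ofNat 10 i := by
  apply Fin.ext; simp [Fin.ofNat]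

theorem c_path : RPath cs cy := by
  intro k
  unfold cs cy
  rw [ofNat_succ]
  generalize Fin.ofNat 10 k = r
  revert r; decide

theorem cs_ten (n i : ℕ) : cs (10*n+i) = cs i := by unfold cs; rw [ofNat_ten]
theorem cy_ten (n i : ℕ) : cy (10*n+i) = cy i := by unfold cy; rw [ofNat_ten]

theorem prod_ten (w : Fin 4 → ℝ) : NN cs cy 10 w =
    ![2*w 0+2*w 1+w 2+2*w 3, w 0+3*w 1+2*w 2+2*w 3, w 0+2*w 1+2*w 2+w 3, w 0+2*w 1+w 2+2*w 3] := by
  funext i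
  simp only [NN]
  have e0 : cs 0 = 3 := by decide
  have e1 : cs 1 = 1 := by decide
  have e2 : cs 2 = 2 := by decide
  have e3 : cs 3 = 2 := by decide
  have e4 : cs 4 = 0 := by decide
  have e5 : cs 5 = 4 := by decide
  have e6 : cs 6 = 5 := by decide
  have e7 : cs 7 = 0 := by decide
  have e8 : cs 8 = 1 := by decide
  have e9 : cs 9 = 3 := by decide
  have f0 : cy 0 = false := by decide
  have f1 : cy 1 = true := by decide
  have f2 : cy 2 = false := by decide
  have f3 : cy 3 = true := by decide
  have f4 : cy 4 = false := by decide
  have f5 : cy 5 = false := by decide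
  have f6 : cy 6 = false := by decide
  have f7 : cy 7 = true := by decide
  have f8 : cy 8 = false := by decide
  have f9 : cy 9 = true := by decide
  simp only [zero_add, Nat.reduceAdd, e0, e1, e2, e3, e4, e5, e6, e7, e8, e9, f0, f1, f2, f3, f4, f5, f6, f7, f8, f9]
  fin_cases i <;> simp [M, mv, win, los, lT, lB] <;> ring

theorem NN_shift (s : ℕ → Fin 7) (y : ℕ → Bool) (n) {w} (h : Orb s y w) (k) :
    NN (fun j => s (j+n)) (fun j => y (j+n)) k (w (k+n)) = w n := by
  have := (h.shift n).NN k
  simpa using this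

theorem ten (w) (h : Orb cs cy w) (n) : w (10*n) = NN cs cy 10 (w (10*n+10)) := by
  have := NN_shift cs cy (10*n) h 10
  have e1 : (fun j => cs (j+10*n)) = cs := by funext j; rw [add_comm, cs_ten]
  have e2 : (fun j => cy (j+10*n)) = cy := by funext j; rw [add_comm, cy_ten]
  rw [e1, e2, add_comm 10] at this
  exact this.symm

theorem ten_bd (w) (h : Orb cs cy w) (n i) :
    ∑ j, w (10*n+10) j ≤ w (10*n) i ∧ w (10*n) i ≤ 3 * ∑ j, w (10*n+10) j := by
  rw [ten w h n, prod_ten, Fin.sum_univ_four]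
  have h0 := h.nn (10*n+10) 0
  have h1 := h.nn (10*n+10) 1
  have h2 := h.nn (10*n+10) 2
  have h3 := h.nn (10*n+10) 3
  fin_cases i <;> constructor <;> simp <;> linarith

theorem center_exists : ∃ L, Orb cs cy L ∧ (∀ k i, 0 < L k i) ∧ ∑ i, L 0 i = 1 := by
  obtain ⟨L, h1, -, h3⟩ := exists_orb cs cy (A := Set.univ) isClosed_univ fun k => by
    let v := NN cs cy k (fun _ => 1)
    have hv : 0 < ∑ i, v i := lt_of_lt_of_le (by simp) (NN_sum cs cy k (w := fun _ => (1:ℝ)) fun _ => zero_le_one)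
    refine ⟨nrm v, ⟨(∑ i, v i)⁻¹ • (fun _ => 1), fun i => ?_, ?_, sum_nrm hv⟩, trivial⟩
    · simpa using hv.le
    · rw [NN_smul]; rfl
  refine ⟨L, h1, fun k i => ?_, h3⟩
  have hs := h1.sum_pos (by rw [h3]; exact one_pos)
  calc 0 < _ := hs (10*k+10)
    _ ≤ _ := (ten_bd L h1 k i).1
    _ ≤ _ := h1.anti i (by omega)

/-- a normalized interior center joined to all edge points -/
def HC (s : Fin 7) : Prop := ∃ C ∈ W s, ∀ e ∈ Edg (tR s) (bR s), JoinedIn (W s) e C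

theorem joined_to_nrm {s v} (h : v ∈ W s) : JoinedIn (W s) v (nrm v) := by
  have hS := h.2.1
  refine JoinedIn.ofLine (f := fun u => ((1 - u) * 1 + u * (∑ i, v i)⁻¹) • v) (by fun_prop) (by simp) (by simp [nrm]) ?_
  rintro _ ⟨u, ⟨h0, h1⟩, rfl⟩
  have hi : 0 < (∑ i, v i)⁻¹ := inv_pos.2 hS
  have hc : 0 < (1 - u) * 1 + u * (∑ i, v i)⁻¹ := by
    rcases h0.eq_or_lt with h | h
    · rw [← h]; simp
    · nlinarith [mul_pos h hi]
  refine ⟨fun i => mul_nonneg hc.le (h.1 i), ?_, PU_smul hc h.2.2⟩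
  simp only [Pi.smul_apply, smul_eq_mul, ← Finset.mul_sum]
  exact mul_pos hc hS

theorem HC3 : HC 3 := by
  obtain ⟨L, hL, hpos, h1⟩ := center_exists
  have hPU : PU (tR (cs 0)) (bR (cs 0)) (L 0) :=
    PU_of_prop c_path hL hpos fun v hv => prop_of_ten hL hpos hv ten_bd
  have e0 : cs 0 = 3 := by decide
  have hW : L 0 ∈ W (cs 0) := ⟨hL.nn 0, by rw [h1]; exact one_pos, hPU⟩
  rw [← e0]
  refine ⟨L 0, hW, fun e he => ?_⟩
  refine (joined_to_nrm (Edg_sub he)).trans ?_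
  refine (inf_case c_path hL hpos h1 hPU.QU he).mono ?_
  rintro v (hv | hv)
  · exact hv.1
  · rw [hv]; exact hW

theorem HC_up (y s) (h : HC (nxt y s)) : HC s := by
  obtain ⟨C, hC, h⟩ := h
  refine ⟨M y s C, M_mem_W y s hC, fun e he => ?_⟩
  obtain ⟨p, p1, p2, p3, p4⟩ := avoid' y s he
  have := joined_M y s (h p p3)
  rw [p4] at this
  exact p1.trans this

theorem HC_all (s) : HC s := by
  have h3 := HC3
  have h1 : HC 1 := HC_up false 1 h3
  have h0 : HC 0 := HC_up true 0 h1
  have h2 : HC 2 := HC_up true 2 h0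
  have h5 : HC 5 := HC_up false 5 h0
  have h4 : HC 4 := HC_up false 4 h5
  have h6 : HC 6 := HC_up true 6 h4
  fin_cases s
  exacts [h0, h1, h2, h3, h4, h5, h6]

/-- main combinatorial result -/
theorem core (s) : ∃ C ∈ Wn s, ∀ L : Fin 4 → ℝ, (∀ i, 0 ≤ L i) → ∑ i, L i = 1 → QU (tR s) (bR s) L →
    JoinedIn (Wn s ∪ {L}) C L := by
  obtain ⟨C, hC, h⟩ := HC_all s
  have hE : ∃ e, e ∈ Edg (tR s) (bR s) := by
    have hI : IrrP (√2) 1 := ⟨by positivity, one_pos, by simpa using irrational_sqrt_two⟩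
    have : ∃ i j, tR s i < tR s j ∧ bR s j < bR s i := by clear h hC C; revert s; decide
    obtain ⟨i, j, h1, h2⟩ := this
    exact ⟨_, i, j, _, _, h1, h2, hI, rfl⟩
  refine ⟨nrm C, nrm_mem hC, fun L h0 h1 hQ => ?_⟩
  obtain ⟨s', y, L', hp, hL, rfl, rfl⟩ := exists_exp s h0
  by_cases hz : ∀ k i, 0 < L' k i
  · obtain ⟨e, he⟩ := hE
    exact ((joined_nrm (h e he)).symm.mono Set.subset_union_left).trans (inf_case hp hL hz h1 hQ he)
  · push Not at hz
    obtain ⟨k, i, hk⟩ := hz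
    obtain ⟨p, hp1, hp2⟩ := fin_case hp hL (by rw [h1]; exact one_pos) hQ (le_antisymm hk (hL.nn k i))
    have := (joined_nrm (h p hp1)).symm.trans (joined_nrm hp2).symm
    rw [nrm_self h1] at this
    exact this.mono Set.subset_union_left
end IETPath

open MeasureTheory Filter Topology



namespace IETPath

/-- The piece of letter `j`. -/
def pc (r : Fin 4 → Fin 4) (L : Fin 4 → ℝ) (j : Fin 4) : Set ℝ := Set.Ico (rp r L j) (rp r L j + L j)

theorem pc_cover (e : Equiv.Perm (Fin 4)) (L : Fin 4 → ℝ) {x : ℝ} (h0 : 0 ≤ x) (h1 : x < ∑ i, L i) :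
    ∃ j, x ∈ pc e L j := by
  have hz : rp e L (e.symm 0) = 0 := by
    unfold rp; apply Finset.sum_eq_zero; intro k _; simp
  have s1 := rp_succ (r := e) e.injective L (j := e.symm 1) (k := e.symm 0) (by simp)
  have s2 := rp_succ (r := e) e.injective L (j := e.symm 2) (k := e.symm 1) (by simp)
  have s3 := rp_succ (r := e) e.injective L (j := e.symm 3) (k := e.symm 2) (by simp)
  have s4 := rp_last (r := e) e.injective L (k := e.symm 3) (by simp)
  by_cases c1 : x < rp e L (e.symm 1)
  · exact ⟨e.symm 0, by rw [hz]; exact h0, by rw [← s1]; exact c1⟩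
  by_cases c2 : x < rp e L (e.symm 2)
  · exact ⟨e.symm 1, not_lt.1 c1, by rw [← s2]; exact c2⟩
  by_cases c3 : x < rp e L (e.symm 3)
  · exact ⟨e.symm 2, not_lt.1 c2, by rw [← s3]; exact c3⟩
  · exact ⟨e.symm 3, not_lt.1 c3, by rw [← s4]; exact h1⟩

theorem pc_unique (e : Equiv.Perm (Fin 4)) {L : Fin 4 → ℝ} (hL : ∀ i, 0 ≤ L i) {x : ℝ} {i j}
    (hi : x ∈ pc e L i) (hj : x ∈ pc e L j) : i = j := by
  by_contra hne
  have hne' : e i ≠ e j := fun h => hne (e.injective h)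
  unfold pc at hi hj
  rcases lt_or_gt_of_ne hne' with h | h
  · have := rp_lt_le e hL h
    linarith [hi.2, hj.1]
  · have := rp_lt_le e hL h
    linarith [hj.2, hi.1]

theorem pc_sub (e : Equiv.Perm (Fin 4)) {L : Fin 4 → ℝ} (hL : ∀ i, 0 ≤ L i) (h1 : ∑ i, L i = 1) (j) :
    pc e L j ⊆ Set.Ico 0 1 := by
  intro x hx
  exact ⟨(rp_nonneg e hL j).trans hx.1, hx.2.trans_le (h1 ▸ rp_add_le e hL j)⟩

theorem iet_val (π : Equiv.Perm (Fin 4)) {L : Fin 4 → ℝ} (hL : ∀ i, 0 ≤ L i) {x : ℝ} {j}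
    (hj : x ∈ pc (1 : Equiv.Perm (Fin 4)) L j) :
    ietMap π L x = x - rp (1 : Equiv.Perm (Fin 4)) L j + rp π L j := by
  have e1 : ∀ j, (∑ k ∈ Finset.univ.filter (fun k => k < j), L k) = rp (1 : Equiv.Perm (Fin 4)) L j := by
    intro j; rw [Finset.sum_filter]; rfl
  have e2 : ∀ j, (∑ k ∈ Finset.univ.filter (fun k => π k < π j), L k) = rp π L j := by
    intro j; rw [Finset.sum_filter]; rfl
  unfold ietMap
  simp only [e1, e2]
  have h : ∃ j, rp (1 : Equiv.Perm (Fin 4)) L j ≤ x ∧ x < rp (1 : Equiv.Perm (Fin 4)) L j + L j := ⟨j, hj⟩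
  rw [dif_pos h]
  have : h.choose = j := pc_unique 1 hL h.choose_spec hj
  rw [this]

theorem iet_mem (π : Equiv.Perm (Fin 4)) {L : Fin 4 → ℝ} (hL : ∀ i, 0 ≤ L i) {x : ℝ} {j}
    (hj : x ∈ pc (1 : Equiv.Perm (Fin 4)) L j) : ietMap π L x ∈ pc π L j := by
  rw [iet_val π hL hj]
  constructor <;> linarith [hj.1, hj.2]

theorem PU_UE (π : Equiv.Perm (Fin 4)) {L : Fin 4 → ℝ} (hL : ∀ i, 0 ≤ L i) (h1 : ∑ i, L i = 1)
    (h : PU (1 : Equiv.Perm (Fin 4)) π L) : UniquelyErgodicOn01 (ietMap π L) := by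
  intro μ hμ h0 hinv
  have hdiff : ∀ a b : ℝ, a ≤ b → μ.real (Set.Iio b) - μ.real (Set.Iio a) = μ.real (Set.Ico a b) := by
    intro a b hab
    have : Set.Iio b = Set.Iio a ∪ Set.Ico a b := (Set.Iio_union_Ico_eq_Iio hab).symm
    rw [this, measureReal_union _ measurableSet_Ico]
    · ring
    · rw [Set.disjoint_left]; intro x hx hx'; exact absurd hx'.1 (not_le.2 hx)
  have hI : ∀ A : Set ℝ, μ A = μ (A ∩ Set.Ico 0 1) := fun A => (measure_inter_conull h0).symm
  have z0 : μ.real (Set.Iio 0) = 0 := by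
    rw [measureReal_def, hI]
    have : Set.Iio (0:ℝ) ∩ Set.Ico 0 1 = ∅ := by
      ext x; simp; intro h h'; linarith
    rw [this]; simp
  have z1 : μ.real (Set.Iio 1) = 1 := by
    have : μ (Set.Iio 1) = 1 := by
      rw [← measure_univ (μ := μ), hI, hI Set.univ]
      congr 1; ext x; simp
    rw [measureReal_def, this]; simp
  obtain ⟨c, hc⟩ := h (fun x => μ.real (Set.Iio x))
    (fun a b hab => measureReal_mono (Set.Iio_subset_Iio hab)) z0 (by
      intro j y hy hyL
      simp only
      rw [hdiff _ _ (by linarith), hdiff _ _ (by linarith), measureReal_def, measureReal_def,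
        ← hinv (Set.Ico (rp π L j) (rp π L j + y)) measurableSet_Ico, hI (ietMap π L ⁻¹' _)]
      congr 2
      ext x
      constructor
      · intro hx
        have hx' : x ∈ pc (1 : Equiv.Perm (Fin 4)) L j := ⟨hx.1, by linarith [hx.2]⟩
        refine ⟨?_, pc_sub 1 hL h1 j hx'⟩
        rw [Set.mem_preimage, iet_val π hL hx']
        constructor <;> linarith [hx.1, hx.2]
      · rintro ⟨hx, hx1⟩
        obtain ⟨i, hi⟩ := pc_cover 1 L hx1.1 (h1 ▸ hx1.2)
        have hm := iet_mem π hL hi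
        rw [Set.mem_preimage] at hx
        have : i = j := pc_unique π hL hm ⟨hx.1, by linarith [hx.2]⟩
        subst this
        rw [iet_val π hL hi] at hx
        constructor <;> linarith [hx.1, hx.2])
  rw [h1] at hc
  have hc1 : c = 1 := by
    have := hc 1 zero_le_one le_rfl
    simp only [z1] at this; linarith
  subst hc1
  refine Measure.ext_of_Ici _ _ fun a => ?_
  rw [Measure.restrict_apply measurableSet_Ici, hI]
  have : Set.Ici a ∩ Set.Ico (0:ℝ) 1 = Set.Ico (max 0 a) 1 := by
    ext x; simp; tauto
  rw [this, Real.volume_Ico]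
  by_cases hm : max 0 a ≤ 1
  · have e := hdiff _ _ hm
    rw [show μ.real (Set.Iio 1) = 1 * 1 from hc 1 zero_le_one le_rfl,
      show μ.real (Set.Iio (max 0 a)) = 1 * max 0 a from hc _ (le_max_left _ _) hm] at e
    rw [← ofReal_measureReal (μ := μ), ← e]; simp
  · rw [Set.Ico_eq_empty (by intro h; exact hm h.le), ENNReal.ofReal_of_nonpos (by linarith)]; simp

theorem shift_eq {F : ℝ → ℝ} (hF : Monotone F) {m : Measure ℝ}
    (hm : ∀ a b, m (Set.Ico a b) = ENNReal.ofReal (F b - F a)) {a b l : ℝ}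
    (h : ∀ y, 0 ≤ y → y ≤ l → F (a + y) - F a = F (b + y) - F b) (hl : 0 ≤ l) {A : Set ℝ}
    (hA : MeasurableSet A) :
    m ((fun x => x - a + b) ⁻¹' A ∩ Set.Ico a (a + l)) = m (A ∩ Set.Ico b (b + l)) := by
  have hmeas : Measurable (fun x : ℝ => x - a + b) := by fun_prop
  haveI : IsFiniteMeasure (m.restrict (Set.Ico a (a+l))) :=
    ⟨by rw [Measure.restrict_apply_univ, hm]; exact ENNReal.ofReal_lt_top⟩
  have key : (m.restrict (Set.Ico a (a+l))).map (fun x => x - a + b) = m.restrict (Set.Ico b (b+l)) := by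
    refine Measure.ext_of_Ici _ _ fun c => ?_
    rw [Measure.map_apply hmeas measurableSet_Ici,
      Measure.restrict_apply (hmeas measurableSet_Ici), Measure.restrict_apply measurableSet_Ici]
    have e1 : (fun x : ℝ => x - a + b) ⁻¹' Set.Ici c ∩ Set.Ico a (a+l) = Set.Ico (a + max 0 (c - b)) (a+l) := by
      ext x
      simp only [Set.mem_inter_iff, Set.mem_preimage, Set.mem_Ici, Set.mem_Ico]
      rw [show (a + max 0 (c-b) ≤ x) ↔ max 0 (c-b) ≤ x - a by constructor <;> intro <;> linarith, max_le_iff]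
      constructor
      · rintro ⟨h1, h2, h3⟩; exact ⟨⟨by linarith, by linarith⟩, h3⟩
      · rintro ⟨⟨h1, h2⟩, h3⟩; exact ⟨by linarith, by linarith, h3⟩
    have e2 : Set.Ici c ∩ Set.Ico b (b+l) = Set.Ico (b + max 0 (c - b)) (b+l) := by
      ext x
      simp only [Set.mem_inter_iff, Set.mem_Ici, Set.mem_Ico]
      rw [show (b + max 0 (c-b) ≤ x) ↔ max 0 (c-b) ≤ x - b by constructor <;> intro <;> linarith, max_le_iff]
      constructor
      · rintro ⟨h1, h2, h3⟩; exact ⟨⟨by linarith, by linarith⟩, h3⟩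
      · rintro ⟨⟨h1, h2⟩, h3⟩; exact ⟨by linarith, by linarith, h3⟩
    rw [e1, e2, hm, hm]
    set y := max 0 (c - b)
    have hy : 0 ≤ y := le_max_left _ _
    by_cases hyl : y ≤ l
    · congr 1
      linarith [h y hy hyl, h l hl le_rfl]
    · push Not at hyl
      rw [ENNReal.ofReal_of_nonpos, ENNReal.ofReal_of_nonpos]
      · have : F (b + l) ≤ F (b + y) := hF (by linarith)
        linarith
      · have : F (a + l) ≤ F (a + y) := hF (by linarith)
        linarith
  have := congrArg (fun ν => ν A) key
  simp only [Measure.map_apply hmeas hA, Measure.restrict_apply (hmeas hA), Measure.restrict_apply hA] at this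
  exact this

theorem UE_QU (π : Equiv.Perm (Fin 4)) {L : Fin 4 → ℝ} (hL : ∀ i, 0 ≤ L i) (h1 : ∑ i, L i = 1)
    (h : UniquelyErgodicOn01 (ietMap π L)) : QU (1 : Equiv.Perm (Fin 4)) π L := by
  intro F hF hFc hF0 hE
  rw [h1]
  have hF1 : 0 ≤ F 1 := hF0 ▸ hF zero_le_one
  rcases hF1.eq_or_lt with hz | hpos
  · refine ⟨0, fun x hx hx1 => ?_⟩
    have a1 := hF hx; have a2 := hF hx1
    linarith
  let S : StieltjesFunction ℝ := ⟨F, hF, fun x => hFc.continuousWithinAt⟩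
  have hm : ∀ a b, S.measure (Set.Ico a b) = ENNReal.ofReal (F b - F a) := by
    intro a b
    have hl : ∀ x, Function.leftLim S x = F x := fun x =>
      ContinuousWithinAt.leftLim_eq (f := F) hFc.continuousWithinAt
    rw [StieltjesFunction.measure_Ico, hl, hl]
  set m := S.measure
  -- decomposition of a set along the pieces
  have dec : ∀ (e : Equiv.Perm (Fin 4)) (B : Set ℝ), (∀ j, MeasurableSet (B ∩ pc e L j)) →
      m (B ∩ Set.Ico 0 1) = ∑ j, m (B ∩ pc e L j) := by
    intro e B hB
    have : B ∩ Set.Ico 0 1 = ⋃ j, (B ∩ pc e L j) := by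
      ext x
      simp only [Set.mem_inter_iff, Set.mem_iUnion]
      constructor
      · rintro ⟨hx, hx'⟩
        obtain ⟨j, hj⟩ := pc_cover e L hx'.1 (h1 ▸ hx'.2)
        exact ⟨j, hx, hj⟩
      · rintro ⟨j, hx, hj⟩
        exact ⟨hx, pc_sub e hL h1 j hj⟩
    rw [this, measure_iUnion _ hB, tsum_fintype]
    intro i j hij
    refine Set.disjoint_left.2 fun x hx hx' => hij (pc_unique e hL hx.2 hx'.2)
  have pre : ∀ (A : Set ℝ) j, ietMap π L ⁻¹' A ∩ pc (1 : Equiv.Perm (Fin 4)) L j =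
      (fun x => x - rp (1 : Equiv.Perm (Fin 4)) L j + rp π L j) ⁻¹' A ∩ pc (1 : Equiv.Perm (Fin 4)) L j := by
    intro A j; ext x
    simp only [Set.mem_inter_iff, Set.mem_preimage]
    constructor
    · rintro ⟨a, b⟩; rw [iet_val π hL b] at a; exact ⟨a, b⟩
    · rintro ⟨a, b⟩; rw [← iet_val π hL b] at a; exact ⟨a, b⟩
  have inv : ∀ A : Set ℝ, MeasurableSet A → m (ietMap π L ⁻¹' A ∩ Set.Ico 0 1) = m (A ∩ Set.Ico 0 1) := by
    intro A hA
    rw [dec 1, dec π A (fun j => hA.inter measurableSet_Ico)]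
    · refine Finset.sum_congr rfl fun j _ => ?_
      rw [pre]
      exact shift_eq hF hm (hE j) (hL j) hA
    · intro j; rw [pre]
      exact ((by fun_prop : Measurable (fun x : ℝ => x - rp (1 : Equiv.Perm (Fin 4)) L j + rp π L j)) hA).inter
        measurableSet_Ico
  have hc0 : ENNReal.ofReal (F 1) ≠ 0 := by simpa using hpos
  have hct : ENNReal.ofReal (F 1) ≠ ⊤ := ENNReal.ofReal_ne_top
  have res := h ((ENNReal.ofReal (F 1))⁻¹ • m.restrict (Set.Ico 0 1))
    ⟨by
      rw [Measure.smul_apply, Measure.restrict_apply_univ, hm, hF0, sub_zero, smul_eq_mul,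
        ENNReal.inv_mul_cancel hc0 hct]⟩
    (by rw [Measure.smul_apply, Measure.restrict_apply measurableSet_Ico.compl]; simp)
    (by
      intro A hA
      rw [Measure.smul_apply, Measure.smul_apply, Measure.restrict_apply' measurableSet_Ico,
        Measure.restrict_apply' measurableSet_Ico, inv A hA])
  refine ⟨F 1, fun x hx hx1 => ?_⟩
  have := congrArg (fun ν => ν (Set.Ico 0 x)) res
  simp only [Measure.smul_apply, Measure.restrict_apply measurableSet_Ico, smul_eq_mul] at this
  have e : Set.Ico 0 x ∩ Set.Ico (0:ℝ) 1 = Set.Ico 0 x :=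
    Set.inter_eq_left.2 (Set.Ico_subset_Ico_right hx1)
  rw [e, hm, hF0, Real.volume_Ico, sub_zero, sub_zero] at this
  have hFx : 0 ≤ F x := hF0 ▸ hF hx
  have t := congrArg ENNReal.toReal this
  rw [ENNReal.toReal_mul, ENNReal.toReal_inv, ENNReal.toReal_ofReal hF1, ENNReal.toReal_ofReal hFx,
    ENNReal.toReal_ofReal hx] at t
  field_simp at t
  exact t

/-- Relabelling. -/
theorem rp_comp (r : Fin 4 → Fin 4) (e : Equiv.Perm (Fin 4)) (L : Fin 4 → ℝ) (j) :
    rp (r ∘ e) (L ∘ e) j = rp r L (e j) := by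
  unfold rp
  exact Equiv.sum_comp e (fun k => if r k < r (e j) then L k else 0)

theorem Eqn_comp (t b : Fin 4 → Fin 4) (e : Equiv.Perm (Fin 4)) (L : Fin 4 → ℝ) (F) :
    Eqn (t ∘ e) (b ∘ e) (L ∘ e) F ↔ Eqn t b L F := by
  unfold Eqn
  simp only [rp_comp, Function.comp_apply]
  exact ⟨fun h j => by simpa using h (e.symm j), fun h j => h (e j)⟩

theorem PU_comp (t b : Fin 4 → Fin 4) (e : Equiv.Perm (Fin 4)) (L : Fin 4 → ℝ) :
    PU (t ∘ e) (b ∘ e) (L ∘ e) ↔ PU t b L := by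
  unfold PU
  simp only [Eqn_comp, Function.comp_apply, Equiv.sum_comp e L]

theorem QU_comp (t b : Fin 4 → Fin 4) (e : Equiv.Perm (Fin 4)) (L : Fin 4 → ℝ) :
    QU (t ∘ e) (b ∘ e) (L ∘ e) ↔ QU t b L := by
  unfold QU
  simp only [Eqn_comp, Function.comp_apply, Equiv.sum_comp e L]

theorem find_state (π : Equiv.Perm (Fin 4)) (h : π ∈ RauzyClass4321) :
    ∃ s, ∀ a, bR s a = π (tR s a) := by
  unfold RauzyClass4321 at h
  simp only [Set.mem_setOf_eq, Set.mem_insert_iff, Set.mem_singleton_iff, Prod.mk.injEq,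
    Equiv.Perm.inv_eq_iff_eq] at h
  rcases h with h | h | h | h | h | h | h
  · obtain ⟨h0, h1, h2, h3⟩ := h
    exact ⟨0, fun a => by fin_cases a <;> simp [tR, bR, ← h0, ← h1, ← h2, ← h3]⟩
  · obtain ⟨h0, h1, h2, h3⟩ := h
    exact ⟨2, fun a => by fin_cases a <;> simp [tR, bR, ← h0, ← h1, ← h2, ← h3]⟩
  · obtain ⟨h0, h1, h2, h3⟩ := h
    exact ⟨1, fun a => by fin_cases a <;> simp [tR, bR, ← h0, ← h1, ← h2, ← h3]⟩
  · obtain ⟨h0, h1, h2, h3⟩ := h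
    exact ⟨4, fun a => by fin_cases a <;> simp [tR, bR, ← h0, ← h1, ← h2, ← h3]⟩
  · obtain ⟨h0, h1, h2, h3⟩ := h
    exact ⟨5, fun a => by fin_cases a <;> simp [tR, bR, ← h0, ← h1, ← h2, ← h3]⟩
  · obtain ⟨h0, h1, h2, h3⟩ := h
    exact ⟨6, fun a => by fin_cases a <;> simp [tR, bR, ← h0, ← h1, ← h2, ← h3]⟩
  · obtain ⟨h0, h1, h2, h3⟩ := h
    exact ⟨3, fun a => by fin_cases a <;> simp [tR, bR, ← h0, ← h1, ← h2, ← h3]⟩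

theorem main (π : Equiv.Perm (Fin 4)) (hπ : π ∈ RauzyClass4321) :
    IsPathConnected {L : Fin 4 → ℝ | (∀ i, 0 ≤ L i) ∧ (∑ i, L i) = 1 ∧
      UniquelyErgodicOn01 (ietMap π L)} := by
  obtain ⟨s, hs⟩ := find_state π hπ
  let e : Equiv.Perm (Fin 4) := Equiv.ofBijective (tR s) (Finite.injective_iff_bijective.1 (tR_inj s))
  have ht : tR s = (1 : Equiv.Perm (Fin 4)) ∘ e := rfl
  have hb : bR s = π ∘ e := funext hs
  obtain ⟨C, hC, hj⟩ := core s
  let φ : (Fin 4 → ℝ) → (Fin 4 → ℝ) := fun v => v ∘ e.symm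
  have hφ : Continuous φ := by
    apply continuous_pi; intro i; exact continuous_apply _
  have hφe : ∀ v, φ v ∘ e = v := fun v => by funext i; simp [φ]
  have hmap : ∀ v ∈ Wn s, φ v ∈ {L : Fin 4 → ℝ | (∀ i, 0 ≤ L i) ∧ (∑ i, L i) = 1 ∧
      UniquelyErgodicOn01 (ietMap π L)} := by
    rintro v ⟨⟨h0, _, hp⟩, h1⟩
    have a0 : ∀ i, 0 ≤ φ v i := fun i => h0 _
    have a1 : ∑ i, φ v i = 1 := by rw [← h1]; exact Equiv.sum_comp e.symm v
    refine ⟨a0, a1, PU_UE π a0 a1 ?_⟩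
    rw [← PU_comp _ _ e, hφe, ← ht, ← hb]
    exact hp
  refine ⟨φ C, hmap C hC, ?_⟩
  rintro L ⟨h0, h1, hu⟩
  have hq := UE_QU π h0 h1 hu
  rw [← QU_comp _ _ e, ← ht, ← hb] at hq
  have J := hj (L ∘ e) (fun i => h0 _) (by rw [← h1]; exact Equiv.sum_comp e L) hq
  have hφL : φ (L ∘ e) = L := by funext i; simp [φ]
  have J' := J.map_continuousOn (f := φ) hφ.continuousOn
  rw [hφL] at J'
  refine J'.mono ?_
  rintro _ ⟨v, hv | hv, rfl⟩
  · exact hmap v hv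
  · rw [Set.mem_singleton_iff.1 hv, hφL]; exact ⟨h0, h1, hu⟩

end IETPath

/-- The set of uniquely ergodic unit-length `4`-IETs whose permutation lies in the
Rauzy class of `(4321)` is path connected. -/
theorem uniquelyErgodic_4IETs_pathConnected (π : Equiv.Perm (Fin 4))
    (hπ : π ∈ RauzyClass4321) :
    IsPathConnected {L : Fin 4 → ℝ | (∀ i, 0 ≤ L i) ∧ (∑ i, L i) = 1 ∧
      UniquelyErgodicOn01 (ietMap π L)} := by
  exact IETPath.main π hπ
end

section
/- Let π be an irreducible permutation of {1,…,d}. Then for any two increasing 4-tuples P and Q of elements of {1,…,d}, on each of which π restricts to a permutation in the Rauzy class of (4321), there exists a finite sequence P = A^0, A^1, …, A^m = Q of increasing 4-tuples of elements of {1,…,d}, each of whose restrictions lies in the Rauzy class of (4321), such that A^t and A^{t+1} form an accessible pair for every 0 ≤ t < m. -/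
/-- A permutation of `{0,…,n-1}` is irreducible if it maps no proper initial segment
`{0,…,k-1}` (with `0 < k < n`) to itself. -/
def PermIrreducible {n : ℕ} (π : Equiv.Perm (Fin n)) : Prop :=
  ∀ k : ℕ, 0 < k → k < n → ∃ i : Fin n, (i : ℕ) < k ∧ k ≤ (π i : ℕ)

/-- `σ` is the restriction of `π` to the `4`-tuple `p`: for all indices `a, b`,
`σ a < σ b` iff `π (p a) < π (p b)`. -/
def RestrictsTo {d : ℕ} (π : Equiv.Perm (Fin d)) (p : Fin 4 → Fin d)
    (σ : Equiv.Perm (Fin 4)) : Prop :=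
  ∀ a b : Fin 4, σ a < σ b ↔ π (p a) < π (p b)

/-- `π` restricts on the `4`-tuple `p` to a permutation in the Rauzy class of `(4321)`. -/
def RestrictsToRauzyClass {d : ℕ} (π : Equiv.Perm (Fin d)) (p : Fin 4 → Fin d) : Prop :=
  ∃ σ ∈ RauzyClass4321, RestrictsTo π p σ

/-- Two increasing `4`-tuples `p`, `q` form an *accessible pair* for `π`: there are
indices `r₁ < r₂` and `s₁ < s₂` such that `p r₁, p r₂, q s₁, q s₂` are pairwise
distinct, `π` restricts on them (listed in increasing order by `u`) to an irreducible
permutation of `{1,2,3,4}` other than the transposition exchanging the first and last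
symbols, and `π` acts as a rotation on both `(p r₁, p r₂)` and `(q s₁, q s₂)`. -/
def AccessiblePair {d : ℕ} (π : Equiv.Perm (Fin d)) (p q : Fin 4 → Fin d) : Prop :=
  ∃ r₁ r₂ s₁ s₂ : Fin 4, r₁ < r₂ ∧ s₁ < s₂ ∧
    ({p r₁, p r₂, q s₁, q s₂} : Finset (Fin d)).card = 4 ∧
    (∃ u : Fin 4 → Fin d, StrictMono u ∧
      Set.range u = ({p r₁, p r₂, q s₁, q s₂} : Set (Fin d)) ∧
      ∃ σ : Equiv.Perm (Fin 4), RestrictsTo π u σ ∧ PermIrreducible σ ∧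
        σ ≠ Equiv.swap 0 3) ∧
    π (p r₂) < π (p r₁) ∧ π (q s₂) < π (q s₁)

/-- Adjacency in the inversion graph. -/
def invAdj {d : ℕ} (π : Equiv.Perm (Fin d)) (i j : Fin d) : Bool :=
  decide ((i < j ∧ π j < π i) ∨ (j < i ∧ π i < π j))

lemma invAdj_comm {d : ℕ} (π : Equiv.Perm (Fin d)) (i j : Fin d) :
    invAdj π i j = invAdj π j i := by
  unfold invAdj
  rw [decide_eq_decide]
  tauto

/-- A graph on four vertices is connected with an odd number of perfect matchings. -/
def goodB (ab ac ad bc bd cd : Bool) : Bool :=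
  ((ab && cd) ^^ (ac && bd) ^^ (ad && bc)) &&
  ((ab && cd && (ac || ad || bc || bd)) || (ac && bd && (ab || ad || bc || cd)) ||
    (ad && bc && (ab || ac || bd || cd)))

/-- The inversion graph on the values of `v` is good. -/
def Good4 {d : ℕ} (π : Equiv.Perm (Fin d)) (v : Fin 4 → Fin d) : Prop :=
  goodB (invAdj π (v 0) (v 1)) (invAdj π (v 0) (v 2)) (invAdj π (v 0) (v 3))
    (invAdj π (v 1) (v 2)) (invAdj π (v 1) (v 3)) (invAdj π (v 2) (v 3)) = true

lemma rauzy_perm : ∀ σ : Equiv.Perm (Fin 4),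
    (((σ⁻¹ 0, σ⁻¹ 1, σ⁻¹ 2, σ⁻¹ 3) : Fin 4 × Fin 4 × Fin 4 × Fin 4) ∈
    ([((3 : Fin 4), (2 : Fin 4), (1 : Fin 4), (0 : Fin 4)),
      (3, 1, 0, 2), (3, 0, 2, 1), (1, 3, 2, 0), (2, 1, 3, 0), (1, 3, 0, 2), (2, 0, 3, 1)] :
      List (Fin 4 × Fin 4 × Fin 4 × Fin 4))) ↔
    goodB (decide (σ 1 < σ 0)) (decide (σ 2 < σ 0)) (decide (σ 3 < σ 0))
      (decide (σ 2 < σ 1)) (decide (σ 3 < σ 1)) (decide (σ 3 < σ 2)) = true := by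
  decide +kernel

lemma mem_rauzy (σ : Equiv.Perm (Fin 4)) : σ ∈ RauzyClass4321 ↔
    goodB (decide (σ 1 < σ 0)) (decide (σ 2 < σ 0)) (decide (σ 3 < σ 0))
      (decide (σ 2 < σ 1)) (decide (σ 3 < σ 1)) (decide (σ 3 < σ 2)) = true := by
  rw [← rauzy_perm]
  simp [RauzyClass4321]

lemma irred_perm : ∀ σ : Equiv.Perm (Fin 4),
    goodB (decide (σ 1 < σ 0)) (decide (σ 2 < σ 0)) (decide (σ 3 < σ 0))
      (decide (σ 2 < σ 1)) (decide (σ 3 < σ 1)) (decide (σ 3 < σ 2)) = true →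
    (∃ i : Fin 4, (i : ℕ) < 1 ∧ 1 ≤ (σ i : ℕ)) ∧ (∃ i : Fin 4, (i : ℕ) < 2 ∧ 2 ≤ (σ i : ℕ)) ∧
    (∃ i : Fin 4, (i : ℕ) < 3 ∧ 3 ≤ (σ i : ℕ)) ∧ σ ≠ Equiv.swap 0 3 := by
  decide +kernel

lemma rauzy_irred (σ : Equiv.Perm (Fin 4)) (h : σ ∈ RauzyClass4321) :
    PermIrreducible σ ∧ σ ≠ Equiv.swap 0 3 := by
  obtain ⟨h1, h2, h3, h4⟩ := irred_perm σ ((mem_rauzy σ).1 h)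
  refine ⟨?_, h4⟩
  intro k hk hk4
  interval_cases k <;> assumption

lemma exists_restrict {d : ℕ} (f : Fin 4 → Fin d) (hf : Function.Injective f) :
    ∃ σ : Equiv.Perm (Fin 4), ∀ a b, σ a < σ b ↔ f a < f b := by
  have hm : StrictMono (f ∘ Tuple.sort f) :=
    (Tuple.monotone_sort f).strictMono_of_injective (hf.comp (Tuple.sort f).injective)
  refine ⟨(Tuple.sort f)⁻¹, fun a b => ?_⟩
  rw [← hm.lt_iff_lt]
  simp

lemma good_of_restrict {d : ℕ} (π : Equiv.Perm (Fin d)) (p : Fin 4 → Fin d) (hp : StrictMono p)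
    (σ : Equiv.Perm (Fin 4)) (h : RestrictsTo π p σ) : σ ∈ RauzyClass4321 ↔ Good4 π p := by
  have key : ∀ a b : Fin 4, a < b → invAdj π (p a) (p b) = decide (σ b < σ a) := by
    intro a b hab
    unfold invAdj
    rw [decide_eq_decide, h b a]
    have := hp hab
    have h2 := this.not_gt
    tauto
  rw [mem_rauzy, Good4, key 0 1 (by decide), key 0 2 (by decide), key 0 3 (by decide),
    key 1 2 (by decide), key 1 3 (by decide), key 2 3 (by decide)]

lemma rauzy_iff {d : ℕ} (π : Equiv.Perm (Fin d)) (p : Fin 4 → Fin d) (hp : StrictMono p) :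
    RestrictsToRauzyClass π p ↔ Good4 π p := by
  constructor
  · rintro ⟨σ, hσ, h⟩
    exact (good_of_restrict π p hp σ h).1 hσ
  · intro hg
    obtain ⟨σ, h⟩ := exists_restrict (fun a => π (p a)) (π.injective.comp hp.injective)
    exact ⟨σ, (good_of_restrict π p hp σ h).2 hg, h⟩

/-- Symmetric Boolean function on `Fin 4` with given off-diagonal entries. -/
def symB (x : Fin 6 → Bool) (i j : Fin 4) : Bool :=
  match i, j with
  | 0, 1 => x 0 | 1, 0 => x 0
  | 0, 2 => x 1 | 2, 0 => x 1
  | 0, 3 => x 2 | 3, 0 => x 2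
  | 1, 2 => x 3 | 2, 1 => x 3
  | 1, 3 => x 4 | 3, 1 => x 4
  | 2, 3 => x 5 | 3, 2 => x 5
  | _, _ => false

lemma symB_perm : ∀ τ : Equiv.Perm (Fin 4), ∀ a b c d e f : Bool,
    goodB a b c d e f = true →
    goodB (symB ![a,b,c,d,e,f] (τ 0) (τ 1)) (symB ![a,b,c,d,e,f] (τ 0) (τ 2))
      (symB ![a,b,c,d,e,f] (τ 0) (τ 3)) (symB ![a,b,c,d,e,f] (τ 1) (τ 2))
      (symB ![a,b,c,d,e,f] (τ 1) (τ 3)) (symB ![a,b,c,d,e,f] (τ 2) (τ 3)) = true := by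
  decide +kernel

lemma good_perm {d : ℕ} (π : Equiv.Perm (Fin d)) (v : Fin 4 → Fin d) (τ : Equiv.Perm (Fin 4))
    (h : Good4 π v) : Good4 π (v ∘ τ) := by
  have key : ∀ i j : Fin 4, i ≠ j → invAdj π (v i) (v j) =
      symB ![invAdj π (v 0) (v 1), invAdj π (v 0) (v 2), invAdj π (v 0) (v 3),
        invAdj π (v 1) (v 2), invAdj π (v 1) (v 3), invAdj π (v 2) (v 3)] i j := by
    intro i j hij
    fin_cases i <;> fin_cases j <;> first | exact absurd rfl hij | rfl | exact invAdj_comm _ _ _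
  have hne : ∀ i j : Fin 4, i ≠ j → τ i ≠ τ j := fun i j hij => τ.injective.ne hij
  unfold Good4
  simp only [Function.comp_apply]
  rw [key _ _ (hne 0 1 (by decide)), key _ _ (hne 0 2 (by decide)), key _ _ (hne 0 3 (by decide)),
    key _ _ (hne 1 2 (by decide)), key _ _ (hne 1 3 (by decide)), key _ _ (hne 2 3 (by decide))]
  exact symB_perm τ _ _ _ _ _ _ h

lemma good_matching {d : ℕ} (π : Equiv.Perm (Fin d)) (v : Fin 4 → Fin d) (h : Good4 π v)
    (m : Fin 4) : ∃ j k l : Fin 4, k < l ∧ m ≠ j ∧ m ≠ k ∧ m ≠ l ∧ j ≠ k ∧ j ≠ l ∧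
      invAdj π (v m) (v j) = true ∧ invAdj π (v k) (v l) = true := by
  have h3 : (invAdj π (v 0) (v 1) = true ∧ invAdj π (v 2) (v 3) = true) ∨
      (invAdj π (v 0) (v 2) = true ∧ invAdj π (v 1) (v 3) = true) ∨
      (invAdj π (v 0) (v 3) = true ∧ invAdj π (v 1) (v 2) = true) := by
    simp only [Good4, goodB, Bool.and_eq_true, Bool.or_eq_true] at h
    tauto
  have c := invAdj_comm π
  rcases h3 with ⟨h1, h2⟩ | ⟨h1, h2⟩ | ⟨h1, h2⟩ <;> fin_cases m
  · exact ⟨1, 2, 3, by decide, by decide, by decide, by decide, by decide, by decide, h1, h2⟩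
  · exact ⟨0, 2, 3, by decide, by decide, by decide, by decide, by decide, by decide,
      (c _ _).trans h1, h2⟩
  · exact ⟨3, 0, 1, by decide, by decide, by decide, by decide, by decide, by decide, h2, h1⟩
  · exact ⟨2, 0, 1, by decide, by decide, by decide, by decide, by decide, by decide,
      (c _ _).trans h2, h1⟩
  · exact ⟨2, 1, 3, by decide, by decide, by decide, by decide, by decide, by decide, h1, h2⟩
  · exact ⟨3, 0, 2, by decide, by decide, by decide, by decide, by decide, by decide, h2, h1⟩
  · exact ⟨0, 1, 3, by decide, by decide, by decide, by decide, by decide, by decide,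
      (c _ _).trans h1, h2⟩
  · exact ⟨1, 0, 2, by decide, by decide, by decide, by decide, by decide, by decide,
      (c _ _).trans h2, h1⟩
  · exact ⟨3, 1, 2, by decide, by decide, by decide, by decide, by decide, by decide, h1, h2⟩
  · exact ⟨2, 0, 3, by decide, by decide, by decide, by decide, by decide, by decide, h2, h1⟩
  · exact ⟨1, 0, 3, by decide, by decide, by decide, by decide, by decide, by decide,
      (c _ _).trans h2, h1⟩
  · exact ⟨0, 1, 2, by decide, by decide, by decide, by decide, by decide, by decide,
      (c _ _).trans h1, h2⟩

lemma adj_lt {d : ℕ} {π : Equiv.Perm (Fin d)} {a b : Fin d} (h : invAdj π a b = true)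
    (hab : a < b) : π b < π a := by
  simp only [invAdj, decide_eq_true_eq] at h
  rcases h with h | h
  · exact h.2
  · exact absurd hab h.1.not_gt

lemma range_four {d : ℕ} (p : Fin 4 → Fin d) {i j k l : Fin 4} (hij : i ≠ j) (hik : i ≠ k)
    (hil : i ≠ l) (hjk : j ≠ k) (hjl : j ≠ l) (hkl : k ≠ l) :
    Set.range p = {p i, p j, p k, p l} := by
  have hu : ∀ i j k l : Fin 4, i ≠ j → i ≠ k → i ≠ l → j ≠ k → j ≠ l → k ≠ l →
      ∀ x, x = i ∨ x = j ∨ x = k ∨ x = l := by decide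
  ext y
  simp only [Set.mem_range, Set.mem_insert_iff, Set.mem_singleton_iff]
  constructor
  · rintro ⟨x, rfl⟩
    rcases hu i j k l hij hik hil hjk hjl hkl x with h | h | h | h <;> simp [h]
  · rintro (h | h | h | h) <;> exact ⟨_, h.symm⟩

lemma acc_symm {d : ℕ} {π : Equiv.Perm (Fin d)} {p q : Fin 4 → Fin d}
    (h : AccessiblePair π p q) : AccessiblePair π q p := by
  obtain ⟨r₁, r₂, s₁, s₂, hr, hs, hc, ⟨u, hu, hru, hσ⟩, h1, h2⟩ := h
  refine ⟨s₁, s₂, r₁, r₂, hs, hr, ?_, ⟨u, hu, ?_, hσ⟩, h2, h1⟩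
  · rw [← hc]; congr 1; ext x; simp only [Finset.mem_insert, Finset.mem_singleton]; tauto
  · rw [hru]; ext x; simp only [Set.mem_insert_iff, Set.mem_singleton_iff]; tauto

lemma acc_of_share {d : ℕ} {π : Equiv.Perm (Fin d)} {p q : Fin 4 → Fin d}
    (hp : StrictMono p) (hq : StrictMono q) (hg : Good4 π p) {m j k l : Fin 4} (hkl : k < l)
    (hmj : m ≠ j) (hmk : m ≠ k) (hml : m ≠ l) (hjk : j ≠ k) (hjl : j ≠ l)
    (h1 : invAdj π (p m) (p j) = true) (h2 : invAdj π (p k) (p l) = true)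
    (hk : p k ∈ Set.range q) (hl : p l ∈ Set.range q) : AccessiblePair π p q := by
  wlog hlt : m < j generalizing m j
  · exact this hmj.symm hjk hjl hmk hml (by rw [invAdj_comm]; exact h1)
      (lt_of_le_of_ne (not_lt.1 hlt) hmj.symm)
  obtain ⟨s₁, hs1⟩ := hk
  obtain ⟨s₂, hs2⟩ := hl
  have hpkl := hp hkl
  have hi := hp.injective
  refine ⟨m, j, s₁, s₂, hlt, ?_, ?_, ?_, adj_lt h1 (hp hlt), ?_⟩
  · rw [← hq.lt_iff_lt, hs1, hs2]; exact hpkl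
  · rw [hs1, hs2]
    rw [Finset.card_insert_of_notMem, Finset.card_insert_of_notMem, Finset.card_pair]
    · exact hi.ne hkl.ne
    · simp [hi.eq_iff, hjk, hjl]
    · simp [hi.eq_iff, hmj, hmk, hml]
  · obtain ⟨σ, hσ, hr⟩ := (rauzy_iff π p hp).2 hg
    refine ⟨p, hp, ?_, σ, hr, rauzy_irred σ hσ⟩
    rw [hs1, hs2]
    exact range_four p hmj hmk hml hjk hjl hkl.ne
  · rw [hs1, hs2]; exact adj_lt h2 hpkl

lemma exchB : ∀ bx bw bz xy xz yz cx cy cz : Bool, goodB bx bw bz xy xz yz = true →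
    goodB true bw bz cy cz yz = true ∨ goodB bx true bz cx xz cz = true ∨
    goodB bx bw true xy cx cy = true := by
  decide +kernel

lemma exists_sorted {d : ℕ} {π : Equiv.Perm (Fin d)} (v : Fin 4 → Fin d)
    (hv : Function.Injective v) (hg : Good4 π v) :
    ∃ p : Fin 4 → Fin d, StrictMono p ∧ Good4 π p ∧ Set.range p = Set.range v :=
  ⟨v ∘ Tuple.sort v,
    (Tuple.monotone_sort v).strictMono_of_injective (hv.comp (Tuple.sort v).injective),
    good_perm π v _ hg, by simp [Set.range_comp]⟩

lemma exch_labelled {d : ℕ} {π : Equiv.Perm (Fin d)} (v : Fin 4 → Fin d) (hg : Good4 π v)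
    (c : Fin d) (hc : invAdj π (v 0) c = true) :
    ∃ m : Fin 4, m ≠ 0 ∧ Good4 π (Function.update v m c) := by
  have hs := invAdj_comm π
  rcases exchB _ _ _ _ _ _ (invAdj π (v 1) c) (invAdj π (v 2) c) (invAdj π (v 3) c) hg
    with h | h | h
  · refine ⟨1, by decide, ?_⟩
    simp [Good4, Function.update, hc, hs c, h]
  · refine ⟨2, by decide, ?_⟩
    simp [Good4, Function.update, hc, hs c, h]
  · refine ⟨3, by decide, ?_⟩
    simp [Good4, Function.update, hc, hs c, h]

lemma exchange {d : ℕ} {π : Equiv.Perm (Fin d)} {p : Fin 4 → Fin d} (hp : StrictMono p)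
    (hg : Good4 π p) {b c : Fin d} (hb : b ∈ Set.range p) (hc : c ∉ Set.range p)
    (hbc : invAdj π b c = true) :
    ∃ p' : Fin 4 → Fin d, StrictMono p' ∧ Good4 π p' ∧ b ∈ Set.range p' ∧ c ∈ Set.range p' ∧
      AccessiblePair π p p' := by
  obtain ⟨i, rfl⟩ := hb
  set τ : Equiv.Perm (Fin 4) := Equiv.swap 0 i with hτ
  have hτ0 : τ 0 = i := Equiv.swap_apply_left 0 i
  obtain ⟨m, hm0, hm⟩ := exch_labelled (π := π) (p ∘ τ) (good_perm π p τ hg) c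
    (by simpa [hτ0] using hbc)
  have hold : ∀ k, k ≠ τ m → p k ∈ Set.range (Function.update (p ∘ τ) m c) := by
    intro k hk
    refine ⟨τ.symm k, ?_⟩
    rw [Function.update_of_ne]
    · simp
    · rintro h
      exact hk (by rw [← h]; simp)
  have hinj : Function.Injective (Function.update (p ∘ τ) m c) := by
    have h0 : Function.Injective (p ∘ τ) := hp.injective.comp τ.injective
    have hne : ∀ x, p (τ x) ≠ c := fun x h => hc ⟨_, h⟩
    intro x y hxy
    by_cases hx : x = m <;> by_cases hy : y = m
    · rw [hx, hy]
    · subst hx; simp [Function.update_of_ne hy] at hxy; exact absurd hxy.symm (hne y)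
    · subst hy; simp [Function.update_of_ne hx] at hxy; exact absurd hxy (hne x)
    · rw [Function.update_of_ne hx, Function.update_of_ne hy] at hxy; exact h0 hxy
  obtain ⟨p', hp', hg', hr⟩ := exists_sorted _ hinj hm
  refine ⟨p', hp', hg', ?_, ?_, ?_⟩
  · rw [hr]
    apply hold
    rw [← hτ0]
    exact τ.injective.ne hm0.symm
  · rw [hr]; exact ⟨m, by simp⟩
  · obtain ⟨j, k, l, hkl, hmj, hmk, hml, hjk, hjl, h1, h2⟩ := good_matching π p hg (τ m)
    exact acc_of_share hp hp' hg hkl hmj hmk hml hjk hjl h1 h2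
      (by rw [hr]; exact hold k hmk.symm) (by rw [hr]; exact hold l hml.symm)

lemma exists_down {d : ℕ} (π : Equiv.Perm (Fin d)) (k : ℕ)
    (h : ∃ i : Fin d, (i : ℕ) < k ∧ k ≤ (π i : ℕ)) :
    ∃ l : Fin d, k ≤ (l : ℕ) ∧ (π l : ℕ) < k := by
  by_contra! hcon
  obtain ⟨i, hi, hπi⟩ := h
  have hsub : Finset.univ.filter (fun m : Fin d => (π m : ℕ) < k) ⊆
      Finset.univ.filter (fun m : Fin d => (m : ℕ) < k) := by
    intro m
    simp only [Finset.mem_filter, Finset.mem_univ, true_and]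
    intro hm
    by_contra hmk
    exact absurd hm (not_lt.2 (hcon m (not_lt.1 hmk)))
  have hcard : (Finset.univ.filter (fun m : Fin d => (m : ℕ) < k)).card ≤
      (Finset.univ.filter (fun m : Fin d => (π m : ℕ) < k)).card := by
    refine Finset.card_le_card_of_injOn (fun m => π.symm m) ?_ (π.symm.injective.injOn)
    intro m hm
    simpa using hm
  have := Finset.eq_of_subset_of_card_le hsub hcard
  have hi2 : i ∈ Finset.univ.filter (fun m : Fin d => (m : ℕ) < k) := by simpa using hi
  rw [← this] at hi2
  simp at hi2
  omega

lemma connected {d : ℕ} (π : Equiv.Perm (Fin d)) (hπ : PermIrreducible π) (a b : Fin d) :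
    Relation.ReflTransGen (fun x y => invAdj π x y = true) a b := by
  have hsymm : ∀ x y, Relation.ReflTransGen (fun x y => invAdj π x y = true) x y →
      Relation.ReflTransGen (fun x y => invAdj π x y = true) y x := by
    intro x y h
    induction h with
    | refl => exact .refl
    | tail _ h ih => exact .head (by rw [invAdj_comm]; exact h) ih
  have step : ∀ (n : ℕ) (h : n + 1 < d),
      Relation.ReflTransGen (fun x y => invAdj π x y = true) ⟨n, by omega⟩ ⟨n + 1, h⟩ := by
    intro n h
    have hj := hπ (n + 1) (by omega) h
    obtain ⟨l, hl, hπl⟩ := exists_down π (n + 1) hj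
    obtain ⟨j, hj, hπj⟩ := hj
    have hjl : invAdj π j l = true := by
      simp only [invAdj, decide_eq_true_eq, Fin.lt_def]
      omega
    have hlj : invAdj π l j = true := by rw [invAdj_comm]; exact hjl
    have key : ∀ x : Fin d, j ≤ x → x ≤ l →
        Relation.ReflTransGen (fun x y => invAdj π x y = true) j x := by
      intro x hjx hxl
      rcases hjx.eq_or_lt with rfl | hjx
      · exact .refl
      rcases hxl.eq_or_lt with rfl | hxl
      · exact .single hjl
      by_cases hx : π x < π j
      · refine .single ?_
        simp only [invAdj, decide_eq_true_eq]
        exact Or.inl ⟨hjx, hx⟩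
      · refine .tail (.single hjl) ?_
        simp only [invAdj, decide_eq_true_eq]
        refine Or.inr ⟨hxl, ?_⟩
        rw [Fin.lt_def]
        rw [Fin.lt_def] at hx
        omega
    exact (hsymm _ _ (key _ (by rw [Fin.le_def]; simp; omega) (by rw [Fin.le_def]; simp; omega))).trans
      (key _ (by rw [Fin.le_def]; simp; omega) (by rw [Fin.le_def]; simp; omega))
  have from0 : ∀ (n : ℕ) (h : n < d),
      Relation.ReflTransGen (fun x y => invAdj π x y = true) ⟨0, by omega⟩ ⟨n, h⟩ := by
    intro n
    induction n with
    | zero => intro h; exact .refl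
    | succ n ih => intro h; exact (ih (by omega)).trans (step n h)
  exact (hsymm _ _ (from0 a.1 a.2)).trans (from0 b.1 b.2)

/-- One step of a chain of good tuples. -/
def ChainStep {d : ℕ} (π : Equiv.Perm (Fin d)) (p q : Fin 4 → Fin d) : Prop :=
  AccessiblePair π p q ∧ StrictMono q ∧ RestrictsToRauzyClass π q

lemma move {d : ℕ} {π : Equiv.Perm (Fin d)} {p : Fin 4 → Fin d} (hp : StrictMono p)
    (hg : Good4 π p) {b c : Fin d} (hb : b ∈ Set.range p) (hbc : invAdj π b c = true) :
    ∃ p' : Fin 4 → Fin d, StrictMono p' ∧ Good4 π p' ∧ b ∈ Set.range p' ∧ c ∈ Set.range p' ∧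
      Relation.ReflTransGen (ChainStep π) p p' := by
  by_cases hc : c ∈ Set.range p
  · exact ⟨p, hp, hg, hb, hc, .refl⟩
  · obtain ⟨p', h1, h2, h3, h4, h5⟩ := exchange hp hg hb hc hbc
    exact ⟨p', h1, h2, h3, h4, .single ⟨h5, h1, (rauzy_iff π p' h1).2 h2⟩⟩

lemma move_path {d : ℕ} {π : Equiv.Perm (Fin d)} {p : Fin 4 → Fin d} (hp : StrictMono p)
    (hg : Good4 π p) {b c : Fin d} (hb : b ∈ Set.range p)
    (hbc : Relation.ReflTransGen (fun x y => invAdj π x y = true) b c) :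
    ∃ p' : Fin 4 → Fin d, StrictMono p' ∧ Good4 π p' ∧ c ∈ Set.range p' ∧
      Relation.ReflTransGen (ChainStep π) p p' := by
  induction hbc with
  | refl => exact ⟨p, hp, hg, hb, .refl⟩
  | tail _ h ih =>
    obtain ⟨p1, h1, h2, h3, h4⟩ := ih
    obtain ⟨p2, k1, k2, _, k3, k4⟩ := move h1 h2 h3 h
    exact ⟨p2, k1, k2, k3, h4.trans k4⟩

/-- Any two `4`-tuples on which an irreducible permutation restricts to the Rauzy
class of `(4321)` are linked by a chain of consecutively accessible such `4`-tuples. -/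
theorem accessible_chain (d : ℕ) (π : Equiv.Perm (Fin d)) (hπ : PermIrreducible π)
    (p q : Fin 4 → Fin d) (hp : StrictMono p) (hq : StrictMono q)
    (hpR : RestrictsToRauzyClass π p) (hqR : RestrictsToRauzyClass π q) :
    ∃ (m : ℕ) (A : ℕ → Fin 4 → Fin d), A 0 = p ∧ A m = q ∧
      (∀ t ≤ m, StrictMono (A t) ∧ RestrictsToRauzyClass π (A t)) ∧
      (∀ t < m, AccessiblePair π (A t) (A (t + 1))) := by
  have hpG := (rauzy_iff π p hp).1 hpR
  have hqG := (rauzy_iff π q hq).1 hqR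
  have hchain : Relation.ReflTransGen (ChainStep π) p q := by
    obtain ⟨j, k, l, hkl, hmj, hmk, hml, hjk, hjl, h1, h2⟩ := good_matching π q hqG 0
    obtain ⟨p1, a1, a2, a3, a4⟩ := move_path hp hpG ⟨0, rfl⟩ (connected π hπ (p 0) (q k))
    obtain ⟨p2, b1, b2, b3, b4, b5⟩ := move a1 a2 a3 h2
    exact (a4.trans b5).tail
      ⟨acc_symm (acc_of_share hq b1 hqG hkl hmj hmk hml hjk hjl h1 h2 b3 b4), hq, hqR⟩
  clear hqG hq hqR
  induction hchain with
  | refl =>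
    exact ⟨0, fun _ => p, rfl, rfl, fun _ _ => ⟨hp, hpR⟩, fun t ht => absurd ht (by omega)⟩
  | @tail q q' _ h ih =>
    obtain ⟨m, A, hA0, hAm, hA, hacc⟩ := ih
    refine ⟨m + 1, fun t => if t ≤ m then A t else q', by simpa using hA0, by simp, ?_, ?_⟩
    · intro t ht
      by_cases htm : t ≤ m
      · simpa [htm] using hA t htm
      · simpa [htm] using h.2
    · intro t ht
      by_cases htm : t < m
      · have h1 : t ≤ m := htm.le
        have h2 : t + 1 ≤ m := htm
        simpa [h1, h2] using hacc t htm
      · obtain rfl : t = m := by omega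
        simpa [hAm] using h.1
end
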